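/- arXiv:1406.0733 — 3 statements merged into one kernel-verified Lean document; each statement's English description precedes it below -/
import Mathlib

section
/- Let (Ω, d_Ω) be a Hilbert geometry of dimension n. The metric space (Ω, d_Ω) is isometric to some finite-dimensional normed vector space if and only if Ω is projectively equivalent to the interior of an n-dimensional simplex (i.e., there is a projective transformation mapping Ω onto the interior of a simplex). -/
open Set Filter MeasureTheory

noncomputable section

abbrev Euc (n : ℕ) := EuclideanSpace ℝ (Fin n)

/-- `Ω` is a convex domain: a non-empty bounded open convex subset of `ℝⁿ`. -/
def IsConvexDomain {n : ℕ} (Ω : Set (Euc n)) : Prop :=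
  Ω.Nonempty ∧ IsOpen Ω ∧ Bornology.IsBounded Ω ∧ Convex ℝ Ω

/-- `d` is the Hilbert distance of the convex domain `Ω` : for distinct `p q ∈ Ω`, if `a` and
`b` are the points where the line through `p` and `q` meets `∂Ω`, in the order `a, p, q, b`
(`a = p + s•(q-p)` with `s < 0`, `b = p + t•(q-p)` with `t > 1`), then
`d p q = ½ log [a,p,q,b]`, and `d p p = 0`. -/
def IsHilbertDist {n : ℕ} (Ω : Set (Euc n)) (d : Euc n → Euc n → ℝ) : Prop :=
  (∀ p ∈ Ω, d p p = 0) ∧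
  ∀ p ∈ Ω, ∀ q ∈ Ω, p ≠ q → ∀ a b : Euc n,
    a ∈ frontier Ω → b ∈ frontier Ω →
    (∃ s t : ℝ, s < 0 ∧ 1 < t ∧ a = p + s • (q - p) ∧ b = p + t • (q - p)) →
    d p q = (1/2) * Real.log ((‖q - a‖ / ‖p - a‖) * (‖p - b‖ / ‖q - b‖))

/-- `N` is a norm on `ℝᵐ`. -/
def IsNorm {m : ℕ} (N : (Fin m → ℝ) → ℝ) : Prop :=
  (∀ x, 0 ≤ N x) ∧ (∀ x, N x = 0 ↔ x = 0) ∧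
  (∀ (c : ℝ) (x), N (c • x) = |c| * N x) ∧ ∀ x y, N (x + y) ≤ N x + N y

/-- The lift of `x ∈ ℝⁿ` to homogeneous coordinates `(x, 1) ∈ ℝ^{n+1}`. -/
def projLift {n : ℕ} (x : Euc n) : Fin (n + 1) → ℝ := Fin.snoc (fun i => x i) 1

/-- The projective transformation of `ℝPⁿ` induced by the linear equivalence `T` of `ℝ^{n+1}`
maps the subset `U` of the affine chart `ℝⁿ` onto the subset `V`. -/
def ProjMapsOnto {n : ℕ} (T : (Fin (n + 1) → ℝ) ≃ₗ[ℝ] (Fin (n + 1) → ℝ))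
    (U V : Set (Euc n)) : Prop :=
  (∀ x ∈ U, ∃ y ∈ V, ∃ c : ℝ, c ≠ 0 ∧ T (projLift x) = c • projLift y) ∧
  (∀ y ∈ V, ∃ x ∈ U, ∃ c : ℝ, c ≠ 0 ∧ T (projLift x) = c • projLift y)

section Extreme

variable {V : Type*} [NormedAddCommGroup V] [NormedSpace ℝ V]

theorem norm_eq_one_of_mem_extremePoints {u : V}
    (hu : u ∈ extremePoints ℝ (Metric.closedBall (0 : V) 1)) (hu0 : u ≠ 0) : ‖u‖ = 1 := by
  have h1 : ‖u‖ ≤ 1 := by simpa using hu.1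
  have h0 : 0 < ‖u‖ := norm_pos_iff.2 hu0
  by_contra hne
  have hlt : ‖u‖ < 1 := lt_of_le_of_ne h1 hne
  have hball : ‖u‖⁻¹ • u ∈ Metric.closedBall (0 : V) 1 := by
    simp [norm_smul, inv_mul_cancel₀ h0.ne']
  have := hu.2 (x₁ := 0) (x₂ := ‖u‖⁻¹ • u) (by simp) hball
    ⟨1 - ‖u‖, ‖u‖, by linarith, h0, by ring, by
      rw [smul_smul, mul_inv_cancel₀ h0.ne']; simp⟩
  exact hu0 this.symm

theorem eq_smul_of_mem_extremePoints {u : V}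
    (hu : u ∈ extremePoints ℝ (Metric.closedBall (0 : V) 1))
    {a b : ℝ} {x y : V} (hx : ‖x‖ ≤ a) (hy : ‖y‖ ≤ b) (hxy : x + y = (a + b) • u) :
    x = a • u := by
  have ha : 0 ≤ a := (norm_nonneg x).trans hx
  have hb : 0 ≤ b := (norm_nonneg y).trans hy
  rcases ha.eq_or_lt with rfl | ha
  · simpa using hx
  rcases hb.eq_or_lt with rfl | hb
  · have : y = 0 := by simpa using hy
    simpa [this] using hxy
  have hball : ∀ {c : ℝ} {z : V}, 0 < c → ‖z‖ ≤ c → c⁻¹ • z ∈ Metric.closedBall (0 : V) 1 := by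
    intro c z hc hz
    rw [mem_closedBall_zero_iff, norm_smul, norm_inv, Real.norm_of_nonneg hc.le,
      inv_mul_le_iff₀ hc]
    simpa using hz
  have hab : 0 < a + b := by positivity
  have := hu.2 (hball ha hx) (hball hb hy)
    ⟨a / (a + b), b / (a + b), by positivity, by positivity, by field_simp, by
      rw [smul_smul, smul_smul]
      have e1 : a / (a + b) * a⁻¹ = (a + b)⁻¹ := by field_simp
      have e2 : b / (a + b) * b⁻¹ = (a + b)⁻¹ := by field_simp
      rw [e1, e2, ← smul_add, hxy, smul_smul, inv_mul_cancel₀ hab.ne', one_smul]⟩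
  rw [← this, smul_smul, mul_inv_cancel₀ ha.ne', one_smul]

theorem span_extremePoints_closedBall [FiniteDimensional ℝ V] :
    Submodule.span ℝ (extremePoints ℝ (Metric.closedBall (0 : V) 1)) = ⊤ := by
  have : ProperSpace V := FiniteDimensional.proper ℝ V
  set S := Submodule.span ℝ (extremePoints ℝ (Metric.closedBall (0 : V) 1)) with hS
  have hKM := closure_convexHull_extremePoints (isCompact_closedBall (0 : V) 1)
    (convex_closedBall (0 : V) 1)
  have hsub : Metric.closedBall (0 : V) 1 ⊆ S := by
    rw [← hKM]
    exact closure_minimal (convexHull_min Submodule.subset_span S.convex)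
      S.closed_of_finiteDimensional
  refine Submodule.eq_top_of_nonempty_interior' S ⟨0, ?_⟩
  exact mem_interior_iff_mem_nhds.2 (mem_of_superset (Metric.closedBall_mem_nhds 0 one_pos) hsub)

end Extreme

/-- `C` is an open convex cone contained in a closed salient convex cone `K`, and `g` identifies
the space of rays of `C`, with the Hilbert metric defined by the order of `K`, isometrically
with the normed space `V`. -/
structure IsConeIsometry {E V : Type*} [NormedAddCommGroup E] [NormedSpace ℝ E]
    [NormedAddCommGroup V] [NormedSpace ℝ V] (C K : Set E) (g : E → V) : Prop where
  isOpen : IsOpen C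
  smul_mem : ∀ {c : ℝ} {x : E}, 0 < c → x ∈ C → c • x ∈ C
  add_mem : ∀ {x y : E}, x ∈ C → y ∈ C → x + y ∈ C
  subset : C ⊆ K
  isClosed : IsClosed K
  smul_mem' : ∀ {c : ℝ} {x : E}, 0 ≤ c → x ∈ K → c • x ∈ K
  add_mem' : ∀ {x y : E}, x ∈ K → y ∈ K → x + y ∈ K
  salient : ∀ {x : E}, x ∈ K → -x ∈ K → x = 0
  surj : ∀ v : V, ∃ x ∈ C, g x = v
  norm_sub_le_iff : ∀ {x y : E}, x ∈ C → y ∈ C → ∀ r : ℝ,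
    ‖g x - g y‖ ≤ r ↔
      ∃ β : ℝ, 0 < β ∧ y - β • x ∈ K ∧ (β * Real.exp (2 * r)) • x - y ∈ K

/-- `s ↦ eˢ A + e⁻ˢ B` is a curve in `C` whose image under `g` is the line through `g (A + B)`
with velocity `u`. -/
structure IsChord {E V : Type*} [NormedAddCommGroup E] [NormedSpace ℝ E]
    [NormedAddCommGroup V] [NormedSpace ℝ V] (C K : Set E) (g : E → V) (u : V) (A B : E) :
    Prop where
  left_mem : A ∈ K
  right_mem : B ∈ K
  mem : ∀ s : ℝ, Real.exp s • A + Real.exp (-s) • B ∈ C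
  map_eq : ∀ s : ℝ, g (Real.exp s • A + Real.exp (-s) • B) = g (A + B) + s • u

namespace IsConeIsometry

variable {E V : Type*} [NormedAddCommGroup E] [NormedSpace ℝ E]
  [NormedAddCommGroup V] [NormedSpace ℝ V] {C K : Set E} {g : E → V}

theorem map_smul_of_pos (h : IsConeIsometry C K g) {c : ℝ} (hc : 0 < c) {x : E} (hx : x ∈ C) :
    g (c • x) = g x := by
  have h0 : (0 : E) ∈ K := by simpa using h.smul_mem' le_rfl (h.subset hx)
  have := (h.norm_sub_le_iff hx (h.smul_mem hc hx) 0).2 ⟨c, hc, by simpa, by simpa⟩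
  exact (sub_eq_zero.1 (norm_le_zero_iff.1 this)).symm

theorem exists_smul_eq (h : IsConeIsometry C K g) {x y : E} (hx : x ∈ C) (hy : y ∈ C)
    (hxy : g x = g y) : ∃ c : ℝ, 0 < c ∧ y = c • x := by
  obtain ⟨β, hβ, h1, h2⟩ := (h.norm_sub_le_iff hx hy 0).1 (by simp [hxy])
  refine ⟨β, hβ, sub_eq_zero.1 (h.salient h1 ?_)⟩
  simpa using h2

theorem map_eq_of_eq_smul (h : IsConeIsometry C K g) {x y : E} (hx : x ∈ C) (hy : y ∈ C)
    {k : ℝ} (hk : k ≠ 0) (hxy : y = k • x) : g x = g y := by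
  rcases hk.lt_or_gt with hk | hk
  · have h1 : -y ∈ K := by
      rw [hxy, ← neg_smul]
      exact h.smul_mem' (by linarith) (h.subset hx)
    have hy0 : y = 0 := h.salient (h.subset hy) h1
    have hx0 : x = 0 := by
      rw [hy0] at hxy
      exact (smul_eq_zero.1 hxy.symm).resolve_left hk.ne
    rw [hx0, hy0]
  · rw [hxy, h.map_smul_of_pos hk hx]

theorem combo_mem (h : IsConeIsometry C K g) {x y : E} (hx : x ∈ C) (hy : y ∈ C) {a b : ℝ}
    (ha : 0 ≤ a) (hb : 0 ≤ b) (hab : 0 < a + b) : a • x + b • y ∈ C := by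
  rcases ha.eq_or_lt with rfl | ha
  · rw [zero_smul, zero_add]
    exact h.smul_mem (by linarith) hy
  rcases hb.eq_or_lt with rfl | hb
  · rw [zero_smul, add_zero]
    exact h.smul_mem ha hx
  exact h.add_mem (h.smul_mem ha hx) (h.smul_mem hb hy)

theorem norm_sub_le_of_exp (h : IsConeIsometry C K g) {A B : E} (hA : A ∈ K) (hB : B ∈ K)
    {s t : ℝ} (hst : s ≤ t) (hs : Real.exp s • A + Real.exp (-s) • B ∈ C)
    (ht : Real.exp t • A + Real.exp (-t) • B ∈ C) :
    ‖g (Real.exp s • A + Real.exp (-s) • B) - g (Real.exp t • A + Real.exp (-t) • B)‖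
      ≤ t - s := by
  refine (h.norm_sub_le_iff hs ht _).2 ⟨Real.exp (s - t), Real.exp_pos _, ?_, ?_⟩
  · have : Real.exp t • A + Real.exp (-t) • B -
        Real.exp (s - t) • (Real.exp s • A + Real.exp (-s) • B) =
        (Real.exp t - Real.exp (s - t + s)) • A := by
      have e : Real.exp (-t) = Real.exp (s - t) * Real.exp (-s) := by
        rw [← Real.exp_add]; ring_nf
      rw [e, Real.exp_add (s - t) s]
      module
    rw [this]
    exact h.smul_mem' (sub_nonneg.2 (Real.exp_le_exp.2 (by linarith))) hA
  · have : (Real.exp (s - t) * Real.exp (2 * (t - s))) •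
        (Real.exp s • A + Real.exp (-s) • B) - (Real.exp t • A + Real.exp (-t) • B) =
        (Real.exp (t - s - s) - Real.exp (-t)) • B := by
      have e0 : Real.exp (s - t) * Real.exp (2 * (t - s)) = Real.exp (t - s) := by
        rw [← Real.exp_add]; ring_nf
      have e : Real.exp t = Real.exp (t - s) * Real.exp s := by
        rw [← Real.exp_add]; ring_nf
      have e2 : Real.exp (t - s - s) = Real.exp (t - s) * Real.exp (-s) := by
        rw [← Real.exp_add]; ring_nf
      rw [e0, e2, e]
      module
    rw [this]
    exact h.smul_mem' (sub_nonneg.2 (Real.exp_le_exp.2 (by linarith))) hB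

theorem eq_of_map_eq (h : IsConeIsometry C K g) {A B A' B' : E} (hAB : A + B = A' + B')
    (hZ : ∀ s : ℝ, |s| ≤ 1 → Real.exp s • A + Real.exp (-s) • B ∈ C)
    (hZ' : ∀ s : ℝ, |s| ≤ 1 → Real.exp s • A' + Real.exp (-s) • B' ∈ C)
    {u : V} (hu : u ≠ 0)
    (hg : ∀ s : ℝ, |s| ≤ 1 → g (Real.exp s • A + Real.exp (-s) • B) = g (A + B) + s • u)
    (hg' : ∀ s : ℝ, |s| ≤ 1 →
      g (Real.exp s • A' + Real.exp (-s) • B') = g (A' + B') + s • u) :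
    A = A' := by
  by_contra hne
  have hD : A - A' ≠ 0 := sub_ne_zero.2 hne
  have key : ∀ s : ℝ, |s| ≤ 1 → s ≠ 0 → ∃ k : ℝ, k ≠ 0 ∧
      A - A' = k • (Real.exp s • A' + Real.exp (-s) • B') := by
    intro s hs hs0
    obtain ⟨c, hc, hcc⟩ := h.exists_smul_eq (hZ' s hs) (hZ s hs) (by
      rw [hg s hs, hg' s hs, hAB])
    have hw : Real.exp s - Real.exp (-s) ≠ 0 := by
      rw [sub_ne_zero]
      intro he
      have := Real.exp_injective he
      exact hs0 (by linarith)
    have hB : B = A' + B' - A := by rw [← hAB]; abel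
    have e : (Real.exp s - Real.exp (-s)) • (A - A') =
        (c - 1) • (Real.exp s • A' + Real.exp (-s) • B') := by
      rw [sub_smul c 1, ← hcc, hB]
      module
    have e2 : A - A' = ((Real.exp s - Real.exp (-s))⁻¹ * (c - 1)) •
        (Real.exp s • A' + Real.exp (-s) • B') := by
      rw [mul_smul, ← e, smul_smul, inv_mul_cancel₀ hw, one_smul]
    refine ⟨_, fun hk => hD ?_, e2⟩
    rw [e2, hk, zero_smul]
  obtain ⟨k, hk, h1⟩ := key 1 (by simp) one_ne_zero
  obtain ⟨l, hl, h2⟩ := key (-1) (by simp) (by norm_num)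
  have := h.map_eq_of_eq_smul (k := k⁻¹ * l) (hZ' (-1) (by simp)) (hZ' 1 (by simp))
    (mul_ne_zero (inv_ne_zero hk) hl) (by
      rw [mul_smul, ← h2, h1, smul_smul, inv_mul_cancel₀ hk, one_smul])
  rw [hg' 1 (by simp), hg' (-1) (by simp)] at this
  have h3 : (2 : ℝ) • u = 0 := by
    have h4 := add_left_cancel this
    have : (2 : ℝ) • u = (1 : ℝ) • u - (-1 : ℝ) • u := by module
    rw [this, ← h4, sub_self]
  exact hu ((smul_eq_zero.1 h3).resolve_left two_ne_zero)

theorem exists_chord_Icc (h : IsConeIsometry C K g) {u : V}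
    (hu : u ∈ extremePoints ℝ (Metric.closedBall (0 : V) 1)) {P : E} (hP : P ∈ C)
    {S : ℝ} (hS : 0 < S) :
    ∃ A ∈ K, ∃ B ∈ K, A + B = P ∧ ∀ s : ℝ, |s| ≤ S →
      Real.exp s • A + Real.exp (-s) • B ∈ C ∧
      g (Real.exp s • A + Real.exp (-s) • B) = g P + s • u := by
  have hu1 : ‖u‖ ≤ 1 := by simpa using hu.1
  obtain ⟨X₀, hX₀, hgX₀⟩ := h.surj (g P - S • u)
  obtain ⟨Y, hY, hgY⟩ := h.surj (g P + S • u)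
  have hdist : ‖g X₀ - g Y‖ ≤ 2 * S := by
    have : g X₀ - g Y = (-(2 * S)) • u := by rw [hgX₀, hgY]; module
    rw [this, norm_smul, norm_neg, Real.norm_of_nonneg (by positivity)]
    nlinarith
  obtain ⟨β, hβ, h1, h2⟩ := (h.norm_sub_le_iff hX₀ hY _).1 hdist
  set e := Real.exp S with he
  have he1 : 1 < e := Real.one_lt_exp_iff.2 hS
  have he0 : 0 < e := by linarith
  have hmul : Real.exp (2 * (2 * S)) = e * e * (e * e) := by
    rw [he, ← Real.exp_add, ← Real.exp_add]; ring_nf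
  rw [hmul] at h2
  set X := (β * (e * e)) • X₀ with hX
  have hXC : X ∈ C := h.smul_mem (by positivity) hX₀
  have hgX : g X = g P - S • u := by rw [hX, h.map_smul_of_pos (by positivity) hX₀, hgX₀]
  have hβX : β • X₀ = (e * e)⁻¹ • X := by
    rw [hX, smul_smul]; congr 1; field_simp
  have hβX' : (β * (e * e * (e * e))) • X₀ = (e * e) • X := by
    rw [hX, smul_smul]; congr 1; ring
  rw [hβX] at h1
  rw [hβX'] at h2
  have hD : 0 < e * e - (e * e)⁻¹ := by
    have h3 : 1 < e * e := by nlinarith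
    have : (e * e)⁻¹ < 1 := inv_lt_one_of_one_lt₀ h3
    linarith
  set D := e * e - (e * e)⁻¹ with hDdef
  set A := (e / D) • (Y - (e * e)⁻¹ • X) with hA
  set B := (e⁻¹ / D) • ((e * e) • X - Y) with hB
  have hAK : A ∈ K := h.smul_mem' (by positivity) h1
  have hBK : B ∈ K := h.smul_mem' (by positivity) h2
  have hZ : ∀ s : ℝ, Real.exp s • A + Real.exp (-s) • B =
      ((Real.exp (S + s) - Real.exp (-(S + s))) / D) • Y +
      ((Real.exp (S - s) - Real.exp (-(S - s))) / D) • X := by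
    intro s
    have e1 : Real.exp (S + s) = e * Real.exp s := Real.exp_add _ _
    have e2 : Real.exp (-(S + s)) = e⁻¹ * Real.exp (-s) := by
      rw [he, ← Real.exp_neg, ← Real.exp_add]; ring_nf
    have e3 : Real.exp (S - s) = e * Real.exp (-s) := by
      rw [he, ← Real.exp_add]; ring_nf
    have e4 : Real.exp (-(S - s)) = e⁻¹ * Real.exp s := by
      rw [he, ← Real.exp_neg, ← Real.exp_add]; ring_nf
    rw [hA, hB, e1, e2, e3, e4]
    simp only [smul_sub, smul_smul]
    have e5 : Real.exp s * (e / D * (e * e)⁻¹) = e⁻¹ * Real.exp s / D := by field_simp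
    have e6 : Real.exp (-s) * (e⁻¹ / D * (e * e)) = e * Real.exp (-s) / D := by field_simp
    rw [e5, e6]
    module
  have hmem : ∀ s : ℝ, |s| ≤ S → Real.exp s • A + Real.exp (-s) • B ∈ C := by
    intro s hs
    rw [hZ]
    obtain ⟨hs1, hs2⟩ := abs_le.1 hs
    have p1 : 0 ≤ Real.exp (S + s) - Real.exp (-(S + s)) :=
      sub_nonneg.2 (Real.exp_le_exp.2 (by linarith))
    have p2 : 0 ≤ Real.exp (S - s) - Real.exp (-(S - s)) :=
      sub_nonneg.2 (Real.exp_le_exp.2 (by linarith))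
    refine h.combo_mem hY hXC (by positivity) (by positivity) ?_
    rw [← add_div]
    refine div_pos ?_ hD
    rcases hs1.lt_or_eq with hs1 | hs1
    · have : 0 < Real.exp (S + s) - Real.exp (-(S + s)) :=
        sub_pos.2 (Real.exp_lt_exp.2 (by linarith))
      linarith
    · have : 0 < Real.exp (S - s) - Real.exp (-(S - s)) :=
        sub_pos.2 (Real.exp_lt_exp.2 (by linarith))
      linarith
  have hend1 : Real.exp (-S) • A + Real.exp (-(-S)) • B = X := by
    rw [hZ]
    have e1 : Real.exp (S - -S) = e * e := by rw [he, ← Real.exp_add]; ring_nf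
    have e2 : Real.exp (-(S - -S)) = (e * e)⁻¹ := by rw [Real.exp_neg, e1]
    rw [e1, e2, ← hDdef, div_self hD.ne']
    simp
  have hend2 : Real.exp S • A + Real.exp (-S) • B = Y := by
    rw [hZ]
    have e1 : Real.exp (S + S) = e * e := by rw [he, ← Real.exp_add]
    have e2 : Real.exp (-(S + S)) = (e * e)⁻¹ := by rw [Real.exp_neg, e1]
    rw [e1, e2, ← hDdef, div_self hD.ne']
    simp
  have hgZ : ∀ s : ℝ, |s| ≤ S →
      g (Real.exp s • A + Real.exp (-s) • B) = g P + s • u := by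
    intro s hs
    obtain ⟨hs1, hs2⟩ := abs_le.1 hs
    have d1 := h.norm_sub_le_of_exp hAK hBK hs1 (by rwa [hend1]) (hmem s hs)
    have d2 := h.norm_sub_le_of_exp hAK hBK hs2 (hmem s hs) (by rwa [hend2])
    rw [hend1, norm_sub_rev, hgX] at d1
    rw [hend2, norm_sub_rev, hgY] at d2
    have := eq_smul_of_mem_extremePoints hu d1 d2 (by module)
    rw [sub_eq_iff_eq_add] at this
    rw [this]
    module
  have h0 := hgZ 0 (by simpa using hS.le)
  have h0C := hmem 0 (by simpa using hS.le)
  simp only [Real.exp_zero, neg_zero, one_smul, zero_smul, add_zero] at h0 h0C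
  obtain ⟨c, hc, hcP⟩ := h.exists_smul_eq h0C hP h0
  refine ⟨c • A, h.smul_mem' hc.le hAK, c • B, h.smul_mem' hc.le hBK, by rw [hcP, smul_add],
    fun s hs => ?_⟩
  have : Real.exp s • c • A + Real.exp (-s) • c • B =
      c • (Real.exp s • A + Real.exp (-s) • B) := by module
  rw [this, h.map_smul_of_pos hc (hmem s hs)]
  exact ⟨h.smul_mem hc (hmem s hs), hgZ s hs⟩

theorem exists_isChord (h : IsConeIsometry C K g) {u : V}
    (hu : u ∈ extremePoints ℝ (Metric.closedBall (0 : V) 1)) (hu0 : u ≠ 0) {P : E}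
    (hP : P ∈ C) : ∃ A B : E, A + B = P ∧ IsChord C K g u A B := by
  obtain ⟨A, hA, B, hB, hAB, h1⟩ := h.exists_chord_Icc hu hP one_pos
  have key : ∀ s : ℝ, Real.exp s • A + Real.exp (-s) • B ∈ C ∧
      g (Real.exp s • A + Real.exp (-s) • B) = g (A + B) + s • u := by
    intro s
    obtain ⟨A', hA', B', hB', hAB', h2⟩ :=
      h.exists_chord_Icc hu hP (S := max 1 |s|) (by positivity)
    have hAA : A = A' := h.eq_of_map_eq (hAB.trans hAB'.symm) (fun s hs => (h1 s hs).1)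
      (fun s hs => (h2 s (hs.trans (le_max_left _ _))).1) hu0
      (fun s hs => by rw [(h1 s hs).2, hAB])
      (fun s hs => by rw [(h2 s (hs.trans (le_max_left _ _))).2, hAB'])
    have hBB : B = B' := by
      rw [hAA, ← hAB'] at hAB
      exact add_left_cancel hAB
    rw [hAA, hBB, hAB']
    exact h2 s (le_max_right _ _)
  exact ⟨A, B, hAB, hA, hB, fun s => (key s).1, fun s => (key s).2⟩

end IsConeIsometry

theorem exists_linearMap_of_additive_on_cone {E F : Type*} [NormedAddCommGroup E]
    [NormedSpace ℝ E] [AddCommGroup F] [Module ℝ F] {C : Set E} (hC : IsOpen C)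
    (hne : C.Nonempty) (hsmul : ∀ {c : ℝ} {x : E}, 0 < c → x ∈ C → c • x ∈ C)
    (hadd : ∀ {x y : E}, x ∈ C → y ∈ C → x + y ∈ C) (φ : E → F)
    (hφs : ∀ {c : ℝ} {x : E}, 0 < c → x ∈ C → φ (c • x) = c • φ x)
    (hφa : ∀ {x y : E}, x ∈ C → y ∈ C → φ (x + y) = φ x + φ y) :
    ∃ L : E →ₗ[ℝ] F, ∀ x ∈ C, L x = φ x := by
  obtain ⟨e, he⟩ := hne
  have hex : ∀ x : E, ∃ t : ℝ, 0 < t ∧ x + t • e ∈ C := by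
    intro x
    have hlim : Tendsto (fun s : ℝ => e + s • x) (nhdsWithin 0 (Ioi 0)) (nhds e) := by
      have : Continuous fun s : ℝ => e + s • x := by fun_prop
      simpa using (this.tendsto 0).mono_left nhdsWithin_le_nhds
    obtain ⟨s, hs, hs0⟩ := ((hlim.eventually (hC.mem_nhds he)).and self_mem_nhdsWithin).exists
    have hs0 : 0 < s := hs0
    refine ⟨s⁻¹, inv_pos.2 hs0, ?_⟩
    have := hsmul (inv_pos.2 hs0) hs
    rwa [smul_add, smul_smul, inv_mul_cancel₀ hs0.ne', one_smul, add_comm] at this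
  choose t ht htC using hex
  set L : E → F := fun x => φ (x + t x • e) - t x • φ e with hL
  have aux : ∀ (x : E) (a b : ℝ), a < b → x + a • e ∈ C →
      φ (x + b • e) - b • φ e = φ (x + a • e) - a • φ e := by
    intro x a b hab ha
    have : x + b • e = (x + a • e) + (b - a) • e := by module
    rw [this, hφa ha (hsmul (sub_pos.2 hab) he), hφs (sub_pos.2 hab) he]
    module
  have hLt : ∀ (x : E) (a : ℝ), x + a • e ∈ C → L x = φ (x + a • e) - a • φ e := by
    intro x a ha
    rcases lt_trichotomy (t x) a with h | h | h
    · exact (aux x _ _ h (htC x)).symm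
    · rw [← h]
    · exact aux x _ _ h ha
  have hLadd : ∀ x y, L (x + y) = L x + L y := by
    intro x y
    have e1 : x + y + (t x + t y) • e = (x + t x • e) + (y + t y • e) := by module
    rw [hLt (x + y) (t x + t y) (e1 ▸ hadd (htC x) (htC y)), e1, hφa (htC x) (htC y)]
    simp only [hL]
    module
  have hL0 : L 0 = 0 := by simpa using hLadd 0 0
  have hLpos : ∀ (c : ℝ) (x : E), 0 < c → L (c • x) = c • L x := by
    intro c x hc
    have e1 : c • x + (c * t x) • e = c • (x + t x • e) := by module
    rw [hLt (c • x) (c * t x) (e1 ▸ hsmul hc (htC x)), e1, hφs hc (htC x)]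
    simp only [hL]
    module
  have hLsmul : ∀ (c : ℝ) (x : E), L (c • x) = c • L x := by
    intro c x
    rcases lt_trichotomy c 0 with hc | rfl | hc
    · have h1 := hLadd (c • x) ((-c) • x)
      rw [← add_smul, add_neg_cancel, zero_smul, hL0, hLpos (-c) x (by linarith)] at h1
      rw [eq_neg_of_add_eq_zero_left h1.symm]
      module
    · simp [hL0]
    · exact hLpos c x hc
  refine ⟨⟨⟨L, hLadd⟩, hLsmul⟩, fun x hx => ?_⟩
  have := hLt x 0 (by simpa using hx)
  simpa using this

theorem LinearMap.ext_of_eqOn_open {E F : Type*} [NormedAddCommGroup E]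
    [NormedSpace ℝ E] [AddCommGroup F] [Module ℝ F] {C : Set E} (hC : IsOpen C)
    (hne : C.Nonempty) {L M : E →ₗ[ℝ] F} (h : ∀ x ∈ C, L x = M x) : L = M := by
  have : LinearMap.eqLocus L M = ⊤ := by
    refine Submodule.eq_top_of_nonempty_interior' _ (hne.mono ?_)
    exact hC.subset_interior_iff.2 fun x hx => h x hx
  exact LinearMap.ext fun x => (this ▸ Submodule.mem_top : x ∈ LinearMap.eqLocus L M)

namespace IsConeIsometry

variable {E V : Type*} [NormedAddCommGroup E] [NormedSpace ℝ E]
  [NormedAddCommGroup V] [NormedSpace ℝ V] {C K : Set E} {g : E → V}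

theorem nonempty (h : IsConeIsometry C K g) : C.Nonempty :=
  let ⟨x, hx, _⟩ := h.surj 0
  ⟨x, hx⟩

end IsConeIsometry

namespace IsChord

variable {E V : Type*} [NormedAddCommGroup E] [NormedSpace ℝ E]
  [NormedAddCommGroup V] [NormedSpace ℝ V] {C K : Set E} {g : E → V} {u : V} {A B : E}

theorem add_mem (hc : IsChord C K g u A B) : A + B ∈ C := by
  simpa using hc.mem 0

theorem symm (hc : IsChord C K g u A B) : IsChord C K g (-u) B A where
  left_mem := hc.right_mem
  right_mem := hc.left_mem
  mem s := by simpa [add_comm] using hc.mem (-s)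
  map_eq s := by simpa [add_comm] using hc.map_eq (-s)

theorem smul (h : IsConeIsometry C K g) (hc : IsChord C K g u A B) {c : ℝ} (hc0 : 0 < c) :
    IsChord C K g u (c • A) (c • B) := by
  have e : ∀ s : ℝ, Real.exp s • c • A + Real.exp (-s) • c • B =
      c • (Real.exp s • A + Real.exp (-s) • B) := fun s => by module
  refine ⟨h.smul_mem' hc0.le hc.left_mem, h.smul_mem' hc0.le hc.right_mem,
    fun s => ?_, fun s => ?_⟩
  · rw [e]
    exact h.smul_mem hc0 (hc.mem s)
  · rw [e, ← smul_add, h.map_smul_of_pos hc0 (hc.mem s), h.map_smul_of_pos hc0 hc.add_mem,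
      hc.map_eq]

theorem shift (h : IsConeIsometry C K g) (hc : IsChord C K g u A B) (t : ℝ) :
    IsChord C K g u (Real.exp t • A) (Real.exp (-t) • B) := by
  have e : ∀ s : ℝ, Real.exp s • Real.exp t • A + Real.exp (-s) • Real.exp (-t) • B =
      Real.exp (s + t) • A + Real.exp (-(s + t)) • B := fun s => by
    rw [smul_smul, smul_smul, ← Real.exp_add, ← Real.exp_add, neg_add]
  refine ⟨h.smul_mem' (Real.exp_pos _).le hc.left_mem,
    h.smul_mem' (Real.exp_pos _).le hc.right_mem, fun s => ?_, fun s => ?_⟩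
  · rw [e]
    exact hc.mem _
  · rw [e, hc.map_eq, hc.map_eq]
    module

theorem left_unique (h : IsConeIsometry C K g) (hu : u ≠ 0) (hc : IsChord C K g u A B)
    {A' B' : E} (hc' : IsChord C K g u A' B') (hAB : A + B = A' + B') : A = A' :=
  h.eq_of_map_eq hAB (fun s _ => hc.mem s) (fun s _ => hc'.mem s) hu
    (fun s _ => hc.map_eq s) (fun s _ => hc'.map_eq s)

theorem left_ne_zero (h : IsConeIsometry C K g) (hu : u ≠ 0) (hc : IsChord C K g u A B) :
    A ≠ 0 := by
  rintro rfl
  have h1 := hc.map_eq 1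
  have hB : B ∈ C := by simpa using hc.add_mem
  rw [smul_zero, zero_add, zero_add, one_smul, h.map_smul_of_pos (Real.exp_pos _) hB] at h1
  exact hu (by simpa using h1)

/-- The initial endpoints of two chords with the same direction dominate each other. -/
theorem exists_le_smul_left (h : IsConeIsometry C K g) (hu : u ≠ 0)
    (hc : IsChord C K g u A B) {A' B' : E} (hc' : IsChord C K g u A' B') :
    ∃ k : ℝ, 0 < k ∧ k • A - A' ∈ K := by
  set r := ‖g (A + B) - g (A' + B')‖
  have hbound : ∃ b : ℝ, ∀ β : ℝ, 0 < β → (A' + B') - β • A ∈ K → β ≤ b := by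
    by_contra! hcon
    choose β hβ hK hlt using fun n : ℕ => hcon (n + 1)
    have hmem : ∀ n, (β n)⁻¹ • (A' + B') - A ∈ K := fun n => by
      have := h.smul_mem' (inv_pos.2 (hβ n)).le (hK n)
      rwa [smul_sub, smul_smul, inv_mul_cancel₀ (hβ n).ne', one_smul] at this
    have hβinf : Tendsto β atTop atTop :=
      tendsto_atTop_mono (fun n => by linarith [hlt n]) tendsto_natCast_atTop_atTop
    have hlim : Tendsto (fun n => (β n)⁻¹ • (A' + B') - A) atTop (nhds (-A)) := by
      simpa using ((tendsto_inv_atTop_zero.comp hβinf).smul_const (A' + B')).sub_const A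
    exact hc.left_ne_zero h hu (h.salient hc.left_mem
      (h.isClosed.mem_of_tendsto hlim (Eventually.of_forall hmem)))
  obtain ⟨b, hb⟩ := hbound
  have hn : ∀ n : ℕ, (max b 1 * Real.exp (2 * r)) •
      (A + Real.exp (-(2 * n)) • B) - (A' + Real.exp (-(2 * n)) • B') ∈ K := by
    intro n
    obtain ⟨β, hβ, h1, h2⟩ := (h.norm_sub_le_iff (hc.mem n) (hc'.mem n) r).1 (by
      rw [hc.map_eq, hc'.map_eq, add_sub_add_right_eq_sub])
    set x := Real.exp (-(2 * (n : ℝ))) with hx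
    have hx0 : 0 < x := Real.exp_pos _
    have hx1 : x ≤ 1 := Real.exp_le_one_iff.2 (by simp)
    have e : Real.exp (-(n : ℝ)) = Real.exp n * x := by
      rw [hx, ← Real.exp_add]; ring_nf
    have cancel : ∀ w : E, Real.exp n • w ∈ K → w ∈ K := by
      intro w hw
      have := h.smul_mem' (inv_pos.2 (Real.exp_pos (n : ℝ))).le hw
      rwa [smul_smul, inv_mul_cancel₀ (Real.exp_pos _).ne', one_smul] at this
    have h1' : (A' + x • B') - β • (A + x • B) ∈ K := by
      apply cancel
      convert h1 using 1
      rw [e]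
      module
    have h2' : (β * Real.exp (2 * r)) • (A + x • B) - (A' + x • B') ∈ K := by
      apply cancel
      convert h2 using 1
      rw [e]
      module
    have hβb : β ≤ b := by
      apply hb β hβ
      have m1 := h.smul_mem' (sub_nonneg.2 hx1) hc'.right_mem
      have m2 := h.smul_mem' (mul_pos hβ hx0).le hc.right_mem
      convert h.add_mem' h1' (h.add_mem' m1 m2) using 1
      module
    have m3 : A + x • B ∈ K := h.add_mem' hc.left_mem (h.smul_mem' hx0.le hc.right_mem)
    have m4 := h.smul_mem' (mul_nonneg (sub_nonneg.2 (hβb.trans (le_max_left b 1)))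
      (Real.exp_pos (2 * r)).le) m3
    convert h.add_mem' h2' m4 using 1
    module
  refine ⟨max b 1 * Real.exp (2 * r), by positivity, ?_⟩
  have hx : Tendsto (fun n : ℕ => Real.exp (-(2 * (n : ℝ)))) atTop (nhds 0) :=
    Real.tendsto_exp_neg_atTop_nhds_zero.comp
      (tendsto_natCast_atTop_atTop.const_mul_atTop two_pos)
  have hlim := ((((hx.smul_const B).const_add A).const_smul
    (max b 1 * Real.exp (2 * r))).sub ((hx.smul_const B').const_add A'))
  rw [zero_smul, zero_smul, add_zero, add_zero] at hlim
  exact h.isClosed.mem_of_tendsto hlim (Eventually.of_forall hn)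

theorem eq_zero_of_add_sub_mem (h : IsConeIsometry C K g)
    (hu : u ∈ extremePoints ℝ (Metric.closedBall (0 : V) 1)) (hu0 : u ≠ 0)
    (hc : IsChord C K g u A B) {z : E} (hA₁ : A + z ∈ K) (hA₂ : A - z ∈ K)
    (hB₁ : B + z ∈ K) (hB₂ : B - z ∈ K) : z = 0 := by
  have hu1 := norm_eq_one_of_mem_extremePoints hu hu0
  set e := Real.exp 1 with he
  have he2 : 2 < e := by linarith [Real.exp_one_gt_d9]
  have hei : Real.exp (-1) = e⁻¹ := Real.exp_neg 1
  have hee : Real.exp (2 * 1) = e * e := by rw [he, ← Real.exp_add]; norm_num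
  have hei' : e⁻¹ < 1 / 2 := by
    rw [one_div]
    exact inv_strictAnti₀ two_pos he2
  have he0 : 0 < e := by linarith
  have hei0 : 0 < e⁻¹ := inv_pos.2 he0
  have heei : e⁻¹ * (e * e) = e := by field_simp
  have hZ₁ : e • A + e⁻¹ • B ∈ C := by simpa [he, hei] using hc.mem 1
  have hZ₂ : e⁻¹ • A + e • B ∈ C := by simpa [he, hei] using hc.mem (-1)
  have hg₁ : g (e • A + e⁻¹ • B) = g (A + B) + u := by simpa [he, hei] using hc.map_eq 1
  have hg₂ : g (e⁻¹ • A + e • B) = g (A + B) - u := by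
    simpa [he, hei, sub_eq_add_neg] using hc.map_eq (-1)
  have hR := hc.add_mem
  have hlim : Tendsto (fun s : ℝ => A + B + s • z) (nhdsWithin 0 (Ioi 0)) (nhds (A + B)) := by
    have : Continuous fun s : ℝ => A + B + s • z := by fun_prop
    simpa using (this.tendsto 0).mono_left nhdsWithin_le_nhds
  obtain ⟨δ, ⟨hδC, hδ1⟩, hδ0⟩ := (((hlim.eventually (h.isOpen.mem_nhds hR)).and
    (nhdsWithin_le_nhds (Iio_mem_nhds (one_half_pos (α := ℝ))))).and self_mem_nhdsWithin).exists
  have hδ0 : 0 < δ := hδ0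
  have hδ1 : δ < 1 / 2 := hδ1
  have d₁ : ‖g (A + B + δ • z) - g (e⁻¹ • A + e • B)‖ ≤ 1 := by
    rw [norm_sub_rev]
    refine (h.norm_sub_le_iff hZ₂ hδC 1).2 ⟨e⁻¹, hei0, ?_, ?_⟩
    · have m1 := h.smul_mem' (show 0 ≤ 1 - e⁻¹ * e⁻¹ - δ by nlinarith) hc.left_mem
      have m2 := h.smul_mem' hδ0.le hA₁
      convert h.add_mem' m1 m2 using 1
      rw [smul_add, smul_smul, smul_smul, inv_mul_cancel₀ he0.ne']
      module
    · rw [hee, heei]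
      have m1 := h.smul_mem' (show 0 ≤ e * e - 1 - δ by nlinarith) hc.right_mem
      have m2 := h.smul_mem' hδ0.le hB₂
      convert h.add_mem' m1 m2 using 1
      have : e * e⁻¹ = 1 := mul_inv_cancel₀ he0.ne'
      rw [smul_add, smul_smul, smul_smul, this]
      module
  have d₂ : ‖g (e • A + e⁻¹ • B) - g (A + B + δ • z)‖ ≤ 1 := by
    rw [norm_sub_rev]
    refine (h.norm_sub_le_iff hδC hZ₁ 1).2 ⟨e⁻¹, hei0, ?_, ?_⟩
    · have m1 := h.smul_mem' (show 0 ≤ e - e⁻¹ - e⁻¹ * δ by nlinarith) hc.left_mem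
      have m2 := h.smul_mem' (show 0 ≤ e⁻¹ * δ by positivity) hA₂
      convert h.add_mem' m1 m2 using 1
      module
    · rw [hee, heei]
      have m1 := h.smul_mem' (show 0 ≤ e - e⁻¹ - e * δ by nlinarith) hc.right_mem
      have m2 := h.smul_mem' (show 0 ≤ e * δ by positivity) hB₁
      convert h.add_mem' m1 m2 using 1
      module
  have hmid := eq_smul_of_mem_extremePoints hu d₁ d₂ (by rw [hg₁, hg₂]; module)
  have hgR : g (A + B) = g (A + B + δ • z) := by
    rw [sub_eq_iff_eq_add, hg₂] at hmid
    rw [hmid]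
    module
  obtain ⟨c, -, hcR⟩ := h.exists_smul_eq hR hδC hgR
  set η := (c - 1) / δ with hη
  have hz : z = η • (A + B) := by
    have : δ • z = (c - 1) • (A + B) := by
      rw [sub_smul, ← hcR]; module
    rw [hη, div_eq_inv_mul, mul_smul, ← this, smul_smul, inv_mul_cancel₀ hδ0.ne', one_smul]
  by_contra hz0
  have hη0 : 0 < |η| := abs_pos.2 fun h0 => hz0 (by rw [hz, h0, zero_smul])
  have hA₃ : A - |η| • (A + B) ∈ K := by
    rcases abs_choice η with h0 | h0 <;> rw [h0]
    · rwa [← hz]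
    · rwa [neg_smul, ← hz, sub_neg_eq_add]
  have d₃ : ‖g (A + B) - g (e • A + e⁻¹ • B)‖ = 1 := by
    rw [hg₁, sub_add_cancel_left, norm_neg, hu1]
  have hβ : e⁻¹ < e⁻¹ + (e - e⁻¹) * |η| := by nlinarith
  set β := e⁻¹ + (e - e⁻¹) * |η|
  have hβ0 : 0 < β := hei0.trans hβ
  have d₄ := (h.norm_sub_le_iff hR hZ₁ ((1 - Real.log β) / 2)).2 ⟨β, hβ0, by
      convert h.smul_mem' (show 0 ≤ e - e⁻¹ by linarith) hA₃ using 1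
      module, by
      have : β * Real.exp (2 * ((1 - Real.log β) / 2)) = e := by
        rw [mul_div_cancel₀ _ two_ne_zero, Real.exp_sub, Real.exp_log hβ0,
          mul_div_cancel₀ _ hβ0.ne']
      rw [this]
      convert h.smul_mem' (show 0 ≤ e - e⁻¹ by linarith) hc.right_mem using 1
      module⟩
  rw [d₃] at d₄
  have : -1 < Real.log β := by
    rw [Real.lt_log_iff_exp_lt hβ0, hei]
    exact hβ
  linarith

theorem left_add (h : IsConeIsometry C K g)
    (hu : u ∈ extremePoints ℝ (Metric.closedBall (0 : V) 1)) (hu0 : u ≠ 0)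
    {A' B' A'' B'' : E} (hc : IsChord C K g u A B) (hc' : IsChord C K g u A' B')
    (hc'' : IsChord C K g u A'' B'') (hsum : A'' + B'' = (A + B) + (A' + B')) :
    A'' = A + A' := by
  obtain ⟨k₁, hk₁, hA₁⟩ := hc''.exists_le_smul_left h hu0 hc
  obtain ⟨k₂, hk₂, hA₂⟩ := hc''.exists_le_smul_left h hu0 hc'
  obtain ⟨k₃, hk₃, hB₁⟩ := hc''.symm.exists_le_smul_left h (neg_ne_zero.2 hu0) hc.symm
  obtain ⟨k₄, hk₄, hB₂⟩ := hc''.symm.exists_le_smul_left h (neg_ne_zero.2 hu0) hc'.symm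
  set k := 1 + k₁ + k₂ + k₃ + k₄
  have hk : 0 < k := by positivity
  have hk1 : k⁻¹ ≤ 1 := inv_le_one_of_one_le₀ (by simp only [k]; linarith)
  have hz : A + A' - A'' = -(B + B' - B'') := by
    have : A'' = A + B + (A' + B') - B'' := by rw [← hsum]; abel
    rw [this]
    abel
  have upper : ∀ {X Y Z : E}, X ∈ K → Y ∈ K → Z ∈ K →
      X + k⁻¹ • (Y + Z - X) ∈ K := by
    intro X Y Z hX hY hZ
    convert h.add_mem' (h.smul_mem' (sub_nonneg.2 hk1) hX)
      (h.smul_mem' (inv_pos.2 hk).le (h.add_mem' hY hZ)) using 1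
    module
  have lower : ∀ {X Y Z : E} {a b : ℝ}, X ∈ K → a • X - Y ∈ K → b • X - Z ∈ K →
      a + b ≤ k → X - k⁻¹ • (Y + Z - X) ∈ K := by
    intro X Y Z a b hX hY hZ hab
    have m1 := h.add_mem' (h.smul_mem' (show 0 ≤ k - (a + b) + 1 by linarith) hX)
      (h.add_mem' hY hZ)
    convert h.smul_mem' (inv_pos.2 hk).le m1 using 1
    have : X = (k⁻¹ * k) • X := by rw [inv_mul_cancel₀ hk.ne', one_smul]
    nth_rw 1 [this]
    module
  have hz0 := hc''.eq_zero_of_add_sub_mem h hu hu0 (z := k⁻¹ • (A + A' - A''))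
    (upper hc''.left_mem hc.left_mem hc'.left_mem)
    (lower hc''.left_mem hA₁ hA₂ (by simp only [k]; linarith))
    (by
      rw [hz, smul_neg, ← sub_eq_add_neg]
      exact lower hc''.right_mem hB₁ hB₂ (by simp only [k]; linarith))
    (by
      rw [hz, smul_neg, sub_neg_eq_add]
      exact upper hc''.right_mem hc.right_mem hc'.right_mem)
  have := (smul_eq_zero.1 hz0).resolve_left (inv_pos.2 hk).ne'
  exact (sub_eq_zero.1 this).symm

end IsChord

namespace IsConeIsometry

variable {E V : Type*} [NormedAddCommGroup E] [NormedSpace ℝ E]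
  [NormedAddCommGroup V] [NormedSpace ℝ V] {C K : Set E} {g : E → V}

theorem exists_linearMap (h : IsConeIsometry C K g) {u : V}
    (hu : u ∈ extremePoints ℝ (Metric.closedBall (0 : V) 1)) (hu0 : u ≠ 0) :
    ∃ L : E →ₗ[ℝ] E, ∀ x ∈ C, IsChord C K g u (L x) (x - L x) := by
  have hex : ∀ x ∈ C, ∃ A : E, IsChord C K g u A (x - A) := by
    intro x hx
    obtain ⟨A, B, rfl, hc⟩ := h.exists_isChord hu hu0 hx
    exact ⟨A, by rwa [add_sub_cancel_left]⟩
  choose! φ hφ using hex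
  obtain ⟨L, hL⟩ := exists_linearMap_of_additive_on_cone h.isOpen h.nonempty h.smul_mem
    h.add_mem φ
    (fun {c x} hc hx => (hφ _ (h.smul_mem hc hx)).left_unique h hu0 ((hφ x hx).smul h hc)
      (by module))
    (fun {x y} hx hy => (hφ x hx).left_add h hu hu0 (hφ y hy) (hφ _ (h.add_mem hx hy))
      (by abel))
  exact ⟨L, fun x hx => by rw [hL x hx]; exact hφ x hx⟩

theorem isIdempotentElem (h : IsConeIsometry C K g) {u : V} (hu0 : u ≠ 0) {L : E →ₗ[ℝ] E}
    (hL : ∀ x ∈ C, IsChord C K g u (L x) (x - L x)) (x : E) : L (L x) = L x := by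
  suffices L ∘ₗ L = L from LinearMap.congr_fun this x
  refine LinearMap.ext_of_eqOn_open h.isOpen h.nonempty fun x hx => ?_
  set e := Real.exp 1
  have he : Real.exp (-1) = e⁻¹ := Real.exp_neg 1
  have he1 : 1 < e := Real.one_lt_exp_iff.2 one_pos
  have he0 : 0 < e := by linarith
  have hs := (hL x hx).shift h 1
  have h1 := (hL _ hs.add_mem).left_unique h hu0 hs (by abel)
  simp only [map_add, map_smul, map_sub] at h1
  rw [he] at h1
  have h2 : (e - e⁻¹) • (L (L x) - L x) = 0 := by
    have : (e - e⁻¹) • (L (L x) - L x) =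
      (e • L (L x) + e⁻¹ • (L x - L (L x))) - e • L x := by module
    rw [this, h1, sub_self]
  have h3 : e - e⁻¹ ≠ 0 := by
    have : e⁻¹ < 1 := inv_lt_one_of_one_lt₀ he1
    linarith
  exact sub_eq_zero.1 ((smul_eq_zero.1 h2).resolve_left h3)

theorem commute [FiniteDimensional ℝ E] (h : IsConeIsometry C K g)
    {u v : V} (hu0 : u ≠ 0) {L M : E →ₗ[ℝ] E}
    (hL : ∀ x ∈ C, IsChord C K g u (L x) (x - L x))
    (hM : ∀ x ∈ C, IsChord C K g v (M x) (x - M x)) (hK : K ⊆ closure C) (x : E) :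
    L (M x) = M (L x) := by
  suffices L ∘ₗ M = M ∘ₗ L from LinearMap.congr_fun this x
  refine LinearMap.ext_of_eqOn_open h.isOpen h.nonempty fun x hx => ?_
  set e := Real.exp 1
  have he : Real.exp (-1) = e⁻¹ := Real.exp_neg 1
  have he1 : 1 < e := Real.one_lt_exp_iff.2 one_pos
  have he0 : 0 < e := by linarith
  set T : E →ₗ[ℝ] E := e • M + e⁻¹ • (LinearMap.id - M) with hT
  have hTx : ∀ y, T y = e • M y + e⁻¹ • (y - M y) := fun y => by simp [hT]
  have hTC : ∀ y ∈ C, T y ∈ C := fun y hy => by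
    rw [hTx]; simpa [e, he] using (hM y hy).mem 1
  have hTg : ∀ y ∈ C, g (T y) = g y + v := fun y hy => by
    rw [hTx]; simpa [e, he] using (hM y hy).map_eq 1
  have hTK : ∀ y ∈ K, T y ∈ K := fun y hy =>
    closure_minimal h.subset h.isClosed (map_mem_closure T.continuous_of_finiteDimensional
      (hK hy) hTC)
  have hc : IsChord C K g u (T (L x)) (T x - T (L x)) := by
    have e1 : ∀ s : ℝ, Real.exp s • T (L x) + Real.exp (-s) • (T x - T (L x)) =
        T (Real.exp s • L x + Real.exp (-s) • (x - L x)) := fun s => by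
      simp only [map_add, map_smul, map_sub]
    refine ⟨hTK _ (hL x hx).left_mem, ?_, fun s => ?_, fun s => ?_⟩
    · rw [← map_sub]
      exact hTK _ (hL x hx).right_mem
    · rw [e1]
      exact hTC _ ((hL x hx).mem s)
    · rw [e1, hTg _ ((hL x hx).mem s), (hL x hx).map_eq, add_sub_cancel, add_sub_cancel,
        hTg x hx]
      abel
  have h1 := (hL _ (hTC x hx)).left_unique h hu0 hc (by abel)
  rw [hTx, hTx] at h1
  simp only [map_add, map_smul, map_sub] at h1
  have h2 : (e - e⁻¹) • (L (M x) - M (L x)) = 0 := by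
    have : (e - e⁻¹) • (L (M x) - M (L x)) =
      (e • L (M x) + e⁻¹ • (L x - L (M x))) - (e • M (L x) + e⁻¹ • (L x - M (L x))) := by
      module
    rw [this, h1, sub_self]
  have h3 : e - e⁻¹ ≠ 0 := by
    have : e⁻¹ < 1 := inv_lt_one_of_one_lt₀ he1
    linarith
  exact sub_eq_zero.1 ((smul_eq_zero.1 h2).resolve_left h3)

end IsConeIsometry

theorem span_eigenvectors_of_commuting_idempotents {ι E : Type*} [AddCommGroup E] [Module ℝ E]
    (L : ι → E →ₗ[ℝ] E) (hid : ∀ i x, L i (L i x) = L i x)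
    (hcomm : ∀ i j x, L i (L j x) = L j (L i x)) (s : Finset ι) :
    Submodule.span ℝ {x : E | ∀ i ∈ s, L i x = x ∨ L i x = 0} = ⊤ := by
  classical
  induction s using Finset.induction_on with
  | empty => simp
  | insert a s _ ih =>
    refine top_unique (ih.symm.le.trans (Submodule.span_le.2 fun x hx => ?_))
    have h1 : L a x ∈ {x : E | ∀ i ∈ insert a s, L i x = x ∨ L i x = 0} := by
      intro i hi
      rcases Finset.mem_insert.1 hi with rfl | hi
      · exact Or.inl (hid i x)
      · rw [hcomm]
        rcases hx i hi with h | h <;> simp [h]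
    have h2 : x - L a x ∈ {x : E | ∀ i ∈ insert a s, L i x = x ∨ L i x = 0} := by
      intro i hi
      rcases Finset.mem_insert.1 hi with rfl | hi
      · exact Or.inr (by rw [map_sub, hid, sub_self])
      · rw [map_sub, hcomm]
        rcases hx i hi with h | h <;> simp [h]
    rw [← add_sub_cancel (L a x) x]
    exact add_mem (Submodule.subset_span h1) (Submodule.subset_span h2)

namespace IsConeIsometry

variable {E V : Type*} [NormedAddCommGroup E] [NormedSpace ℝ E]
  [NormedAddCommGroup V] [NormedSpace ℝ V] {C K : Set E} {g : E → V}

/-- An open cone whose Hilbert metric is isometric to a normed space is an open orthant. -/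
theorem exists_basis [FiniteDimensional ℝ E] [FiniteDimensional ℝ V]
    (h : IsConeIsometry C K g) (hK : K ⊆ closure C) :
    ∃ b : Module.Basis (Fin (Module.finrank ℝ E)) ℝ E, C = {x | ∀ j, 0 < b.repr x j} := by
  classical
  obtain ⟨B, hB⟩ : ∃ v : Module.Basis (Fin (Module.finrank ℝ V)) ℝ V,
      ∀ i, v i ∈ extremePoints ℝ (Metric.closedBall (0 : V) 1) := by
    let b := Module.Basis.ofSpan (span_extremePoints_closedBall (V := V)).ge
    have : Fintype _ := FiniteDimensional.fintypeBasisIndex b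
    exact ⟨b.reindex (Fintype.equivFinOfCardEq (Module.finrank_eq_card_basis b).symm),
      fun i => by
        rw [Module.Basis.reindex_apply]
        exact Module.Basis.ofSpan_subset _ (mem_range_self _)⟩
  choose L hL using fun i => h.exists_linearMap (hB i) (B.ne_zero i)
  have hid := fun i => h.isIdempotentElem (B.ne_zero i) (hL i)
  have hcomm := fun i j => h.commute (B.ne_zero i) (hL i) (hL j) hK
  have hspan := span_eigenvectors_of_commuting_idempotents L hid hcomm Finset.univ
  obtain ⟨b₀, hb₀⟩ : ∃ b : Module.Basis (Fin (Module.finrank ℝ E)) ℝ E,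
      ∀ j i, L i (b j) = b j ∨ L i (b j) = 0 := by
    let b := Module.Basis.ofSpan hspan.ge
    have : Fintype _ := FiniteDimensional.fintypeBasisIndex b
    refine ⟨b.reindex (Fintype.equivFinOfCardEq (Module.finrank_eq_card_basis b).symm),
      fun j i => ?_⟩
    rw [Module.Basis.reindex_apply]
    exact Module.Basis.ofSpan_subset hspan.ge (mem_range_self _) i (Finset.mem_univ i)
  set χ : Fin (Module.finrank ℝ V) → Fin (Module.finrank ℝ E) → ℝ :=
    fun i j => if L i (b₀ j) = b₀ j then 1 else -1 with hχ
  have hflow : ∀ i (s : ℝ) (x : E) j,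
      b₀.repr (Real.exp s • L i x + Real.exp (-s) • (x - L i x)) j =
        Real.exp (s * χ i j) * b₀.repr x j := by
    intro i s x j
    let φ : E →ₗ[ℝ] ℝ := b₀.coord j ∘ₗ (Real.exp s • L i + Real.exp (-s) • (LinearMap.id - L i))
    let ψ : E →ₗ[ℝ] ℝ := Real.exp (s * χ i j) • b₀.coord j
    suffices φ = ψ from LinearMap.congr_fun this x
    refine b₀.ext fun k => ?_
    simp only [φ, ψ, LinearMap.comp_apply, LinearMap.add_apply, LinearMap.smul_apply,
      LinearMap.sub_apply, LinearMap.id_apply, Module.Basis.coord_apply, smul_eq_mul]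
    by_cases hk : L i (b₀ k) = b₀ k
    · rw [hk, sub_self, smul_zero, add_zero, map_smul, Finsupp.smul_apply, smul_eq_mul]
      by_cases hkj : k = j
      · subst hkj
        simp [hχ, hk]
      · simp [Finsupp.single_eq_of_ne' hkj]
    · have hk0 := (hb₀ k i).resolve_left hk
      rw [hk0, sub_zero, smul_zero, zero_add, map_smul, Finsupp.smul_apply, smul_eq_mul]
      by_cases hkj : k = j
      · subst hkj
        simp [hχ, hk]
      · simp [Finsupp.single_eq_of_ne' hkj]
  have hmove : ∀ (t : Fin (Module.finrank ℝ V) → ℝ) (s : Finset (Fin (Module.finrank ℝ V))),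
      ∀ x ∈ C, ∃ y ∈ C, g y = g x + ∑ i ∈ s, t i • B i ∧
        ∀ j, b₀.repr y j = Real.exp (∑ i ∈ s, t i * χ i j) * b₀.repr x j := by
    intro t s x hx
    induction s using Finset.induction_on with
    | empty => exact ⟨x, hx, by simp, by simp⟩
    | insert a s ha ih =>
      obtain ⟨y, hy, hgy, hry⟩ := ih
      refine ⟨_, (hL a y hy).mem (t a), ?_, fun j => ?_⟩
      · rw [(hL a y hy).map_eq, add_sub_cancel, hgy, Finset.sum_insert ha]
        abel
      · rw [hflow, hry, Finset.sum_insert ha, Real.exp_add, mul_assoc]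
  obtain ⟨p, hp⟩ := h.nonempty
  have hreach : ∀ x ∈ C, ∃ (c : ℝ) (t : Fin (Module.finrank ℝ V) → ℝ),
      ∀ j, b₀.repr x j = Real.exp (c + ∑ i, t i * χ i j) * b₀.repr p j := by
    intro x hx
    obtain ⟨y, hy, hgy, hry⟩ := hmove (fun i => B.repr (g x - g p) i) Finset.univ p hp
    rw [B.sum_repr, add_sub_cancel] at hgy
    obtain ⟨c, hc, hcx⟩ := h.exists_smul_eq hy hx hgy
    refine ⟨Real.log c, fun i => B.repr (g x - g p) i, fun j => ?_⟩
    have e : b₀.repr x j = c * b₀.repr y j := by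
      rw [hcx, map_smul, Finsupp.smul_apply, smul_eq_mul]
    rw [e, hry, Real.exp_add, Real.exp_log hc, mul_assoc]
  have hp0 : ∀ j, b₀.repr p j ≠ 0 := by
    intro j hj
    have : b₀.coord j = 0 := LinearMap.ext_of_eqOn_open h.isOpen h.nonempty fun x hx => by
      obtain ⟨c, t, hx⟩ := hreach x hx
      simp [hx j, hj]
    simpa using LinearMap.congr_fun this (b₀ j)
  set b := b₀.isUnitSMul (fun j => (hp0 j).isUnit) with hb
  have hrepr : ∀ x j, b.repr x j = b₀.repr x j / b₀.repr p j := by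
    intro x j
    rw [hb, Module.Basis.repr_isUnitSMul, div_eq_inv_mul]
    simp [Units.smul_def]
  have hreach' : ∀ x ∈ C, ∃ (c : ℝ) (t : Fin (Module.finrank ℝ V) → ℝ),
      ∀ j, b.repr x j = Real.exp (c + ∑ i, t i * χ i j) := by
    intro x hx
    obtain ⟨c, t, hx⟩ := hreach x hx
    exact ⟨c, t, fun j => by rw [hrepr, hx, mul_div_cancel_right₀ _ (hp0 j)]⟩
  let W : Submodule ℝ (Fin (Module.finrank ℝ E) → ℝ) :=
    Submodule.span ℝ {fun _ => 1} ⊔ Submodule.span ℝ (range χ)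
  let ex : (Fin (Module.finrank ℝ E) → ℝ) → E := fun y => ∑ j, Real.exp (y j) • b j
  have hexr : ∀ y j, b.repr (ex y) j = Real.exp (y j) := fun y j => by
    rw [b.repr_sum_self]
  have hW : W = ⊤ := by
    have hex0 : ex 0 = p := b.ext_elem fun j => by
      rw [hexr, hrepr, div_self (hp0 j)]; simp
    have hcont : Continuous ex := by fun_prop
    refine Submodule.eq_top_of_nonempty_interior' W ⟨0, ?_⟩
    rw [mem_interior_iff_mem_nhds]
    refine mem_of_superset ((h.isOpen.preimage hcont).mem_nhds (by rwa [mem_preimage, hex0])) ?_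
    intro y hy
    obtain ⟨c, t, hct⟩ := hreach' _ hy
    have : y = c • (fun _ => (1 : ℝ)) + ∑ i, t i • χ i := by
      ext j
      have := hct j
      rw [hexr, Real.exp_eq_exp] at this
      simp [this]
    rw [this]
    exact Submodule.add_mem_sup (Submodule.smul_mem _ _ (Submodule.mem_span_singleton_self _))
      (Submodule.sum_mem _ fun i _ => Submodule.smul_mem _ _ (Submodule.subset_span ⟨i, rfl⟩))
  refine ⟨b, Subset.antisymm (fun x hx j => ?_) fun x hx => ?_⟩
  · obtain ⟨c, t, hct⟩ := hreach' x hx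
    rw [hct]
    exact Real.exp_pos _
  · have hlog : (fun j => Real.log (b.repr x j)) ∈ W := hW ▸ Submodule.mem_top
    obtain ⟨y, hy, z, hz, hyz⟩ := Submodule.mem_sup.1 hlog
    obtain ⟨c, rfl⟩ := Submodule.mem_span_singleton.1 hy
    obtain ⟨t, rfl⟩ := (Submodule.mem_span_range_iff_exists_fun ℝ).1 hz
    obtain ⟨q, hq, -, hrq⟩ := hmove t Finset.univ p hp
    have : x = Real.exp c • q := b.ext_elem fun j => by
      rw [map_smul, Finsupp.smul_apply, hrepr q, hrq, mul_div_cancel_right₀ _ (hp0 j),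
        smul_eq_mul, ← Real.exp_add, ← Real.exp_log (hx j)]
      congr 1
      have := congrFun hyz j
      simpa using this.symm
    rw [this]
    exact h.smul_mem (Real.exp_pos c) hq

end IsConeIsometry

section Lift

variable {n : ℕ}

theorem projLift_last (x : Euc n) : projLift x (Fin.last n) = 1 := by simp [projLift]

theorem projLift_castSucc (x : Euc n) (i : Fin n) : projLift x i.castSucc = x i := by
  simp [projLift]

theorem projLift_injective : Function.Injective (projLift (n := n)) := fun x y h => by
  ext i
  rw [← projLift_castSucc, h, projLift_castSucc]

theorem continuous_projLift : Continuous (projLift (n := n)) := by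
  refine continuous_pi fun i => ?_
  refine Fin.lastCases ?_ (fun i => ?_) i
  · simpa [projLift_last] using continuous_const
  · simp only [projLift_castSucc]
    fun_prop

theorem projLift_sum {ι : Type*} (s : Finset ι) (w : ι → ℝ) (v : ι → Euc n)
    (hw : ∑ i ∈ s, w i = 1) : projLift (∑ i ∈ s, w i • v i) = ∑ i ∈ s, w i • projLift (v i) := by
  ext k
  refine Fin.lastCases ?_ (fun i => ?_) k
  · simp [projLift_last, Finset.sum_apply, hw]
  · simp [projLift_castSucc, Finset.sum_apply, WithLp.ofLp_sum]

theorem projLift_line (x y : Euc n) (t : ℝ) :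
    projLift (x + t • (y - x)) = projLift x + t • (projLift y - projLift x) := by
  ext k
  refine Fin.lastCases ?_ (fun i => ?_) k
  · simp [projLift_last]
  · simp [projLift_castSucc]

/-- The point of the affine chart with homogeneous coordinates `X`. -/
def projPoint (X : Fin (n + 1) → ℝ) : Euc n :=
  (X (Fin.last n))⁻¹ • WithLp.toLp 2 (Fin.init X)

theorem projPoint_smul_projLift {c : ℝ} (hc : c ≠ 0) (x : Euc n) :
    projPoint (c • projLift x) = x := by
  ext i
  simp [projPoint, projLift_last, Fin.init, projLift_castSucc, hc]

theorem smul_projLift_projPoint {X : Fin (n + 1) → ℝ} (hX : X (Fin.last n) ≠ 0) :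
    X (Fin.last n) • projLift (projPoint X) = X := by
  ext k
  refine Fin.lastCases ?_ (fun i => ?_) k
  · simp [projLift_last]
  · simp [projLift_castSucc, projPoint, Fin.init, hX]

theorem continuousAt_projPoint {X : Fin (n + 1) → ℝ} (hX : X (Fin.last n) ≠ 0) :
    ContinuousAt projPoint X := by
  unfold projPoint Fin.init
  have : ContinuousAt (fun X : Fin (n + 1) → ℝ => (X (Fin.last n))⁻¹) X :=
    (continuous_apply _).continuousAt.inv₀ hX
  refine this.smul (Continuous.continuousAt ?_)
  fun_prop

/-- The cone in `ℝ^{n+1}` over a subset of the affine chart `ℝⁿ`. -/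
def coneOver (Ω : Set (Euc n)) : Set (Fin (n + 1) → ℝ) :=
  {X | 0 < X (Fin.last n) ∧ projPoint X ∈ Ω}

theorem smul_projLift_mem_coneOver {Ω : Set (Euc n)} {x : Euc n} {c : ℝ} (hc : 0 < c)
    (hx : x ∈ Ω) : c • projLift x ∈ coneOver Ω :=
  ⟨by simpa [projLift_last], by rwa [projPoint_smul_projLift hc.ne']⟩

theorem projLift_mem_coneOver {Ω : Set (Euc n)} {x : Euc n} (hx : x ∈ Ω) :
    projLift x ∈ coneOver Ω := by
  simpa using smul_projLift_mem_coneOver one_pos hx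

theorem exists_eq_smul_projLift {Ω : Set (Euc n)} {X : Fin (n + 1) → ℝ} (hX : X ∈ coneOver Ω) :
    ∃ c : ℝ, 0 < c ∧ ∃ x ∈ Ω, X = c • projLift x :=
  ⟨_, hX.1, _, hX.2, (smul_projLift_projPoint hX.1.ne').symm⟩

theorem smul_mem_coneOver {Ω : Set (Euc n)} {c : ℝ} (hc : 0 < c) {X : Fin (n + 1) → ℝ}
    (hX : X ∈ coneOver Ω) : c • X ∈ coneOver Ω := by
  obtain ⟨a, ha, x, hx, rfl⟩ := exists_eq_smul_projLift hX
  rw [smul_smul]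
  exact smul_projLift_mem_coneOver (mul_pos hc ha) hx

theorem add_mem_coneOver {Ω : Set (Euc n)} (hΩ : Convex ℝ Ω) {X Y : Fin (n + 1) → ℝ}
    (hX : X ∈ coneOver Ω) (hY : Y ∈ coneOver Ω) : X + Y ∈ coneOver Ω := by
  obtain ⟨a, ha, x, hx, rfl⟩ := exists_eq_smul_projLift hX
  obtain ⟨b, hb, y, hy, rfl⟩ := exists_eq_smul_projLift hY
  have hab : 0 < a + b := by positivity
  have hz : x + (b / (a + b)) • (y - x) ∈ Ω :=
    hΩ.add_smul_sub_mem hx hy ⟨by positivity, (div_le_one hab).2 (by linarith)⟩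
  have : a • projLift x + b • projLift y =
      (a + b) • projLift (x + (b / (a + b)) • (y - x)) := by
    rw [projLift_line, smul_add, smul_smul, mul_div_cancel₀ _ hab.ne']
    module
  rw [this]
  exact smul_projLift_mem_coneOver hab hz

theorem isOpen_coneOver {Ω : Set (Euc n)} (hΩ : IsOpen Ω) : IsOpen (coneOver Ω) := by
  have hpos : IsOpen {X : Fin (n + 1) → ℝ | 0 < X (Fin.last n)} :=
    isOpen_lt continuous_const (continuous_apply _)
  exact ContinuousOn.isOpen_inter_preimage
    (fun X hX => (continuousAt_projPoint (ne_of_gt hX)).continuousWithinAt) hpos hΩ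

theorem smul_projLift_mem_closure_coneOver_iff {Ω : Set (Euc n)} {x : Euc n} {c : ℝ}
    (hc : 0 < c) : c • projLift x ∈ closure (coneOver Ω) ↔ x ∈ closure Ω := by
  constructor
  · intro h
    have hlast : (c • projLift x) (Fin.last n) ≠ 0 := by simp [projLift_last, hc.ne']
    have := (continuousAt_projPoint hlast).continuousWithinAt.mem_closure h
      (t := Ω) (fun X hX => hX.2)
    rwa [projPoint_smul_projLift hc.ne'] at this
  · intro h
    exact map_mem_closure (f := fun x => c • projLift x) (continuous_projLift.const_smul c) h
      fun y hy => smul_projLift_mem_coneOver hc hy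

theorem last_nonneg_of_mem_closure_coneOver {Ω : Set (Euc n)} {X : Fin (n + 1) → ℝ}
    (hX : X ∈ closure (coneOver Ω)) : 0 ≤ X (Fin.last n) :=
  closure_minimal (t := {X : Fin (n + 1) → ℝ | 0 ≤ X (Fin.last n)}) (fun _ h => h.1.le)
    (isClosed_le continuous_const (continuous_apply _)) hX

theorem eq_zero_of_mem_closure_coneOver {Ω : Set (Euc n)} (hΩ : Bornology.IsBounded Ω)
    {X : Fin (n + 1) → ℝ} (hX : X ∈ closure (coneOver Ω)) (h0 : X (Fin.last n) = 0) :
    X = 0 := by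
  obtain ⟨R, hR⟩ := hΩ.exists_norm_le
  have hcl : IsClosed {X : Fin (n + 1) → ℝ |
      ‖(WithLp.toLp 2 (Fin.init X) : Euc n)‖ ≤ X (Fin.last n) * R} := by
    refine isClosed_le ?_ (by fun_prop)
    unfold Fin.init
    fun_prop
  have hle := closure_minimal (fun X hX => ?_) hcl hX
  · rw [mem_ofPred_eq, h0, zero_mul, norm_le_zero_iff] at hle
    ext k
    refine Fin.lastCases h0 (fun i => ?_) k
    exact congrFun (congrArg WithLp.ofLp hle) i
  · have h := hR _ hX.2
    have hpos := hX.1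
    rw [projPoint, norm_smul, norm_inv, Real.norm_of_nonneg hpos.le, inv_mul_le_iff₀ hpos] at h
    exact h

theorem smul_mem_closure_coneOver {Ω : Set (Euc n)} {c : ℝ} (hc : 0 ≤ c)
    {X : Fin (n + 1) → ℝ} (hX : X ∈ closure (coneOver Ω)) : c • X ∈ closure (coneOver Ω) := by
  have key : ∀ c : ℝ, 0 < c → c • X ∈ closure (coneOver Ω) := fun c hc =>
    map_mem_closure (continuous_const_smul c) hX fun _ h => smul_mem_coneOver hc h
  rcases hc.eq_or_lt with rfl | hc
  · have hlim : Tendsto (fun c : ℝ => c • X) (nhdsWithin 0 (Ioi 0)) (nhds ((0 : ℝ) • X)) :=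
      ((continuous_id.smul continuous_const).tendsto 0).mono_left nhdsWithin_le_nhds
    exact isClosed_closure.mem_of_tendsto hlim
      (eventually_mem_nhdsWithin.mono fun c hc => key c hc)
  · exact key c hc

theorem add_mem_closure_coneOver {Ω : Set (Euc n)} (hΩ : Convex ℝ Ω) {X Y : Fin (n + 1) → ℝ}
    (hX : X ∈ closure (coneOver Ω)) (hY : Y ∈ closure (coneOver Ω)) :
    X + Y ∈ closure (coneOver Ω) :=
  map_mem_closure₂ continuous_add hX hY fun _ hX _ hY => add_mem_coneOver hΩ hX hY

end Lift

section HilbertDist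

variable {n : ℕ} {Ω : Set (Euc n)}

theorem IsConvexDomain.exists_chord (hΩ : IsConvexDomain Ω) {x y : Euc n} (hx : x ∈ Ω)
    (hy : y ∈ Ω) (hxy : x ≠ y) :
    ∃ s t : ℝ, s < 0 ∧ 1 < t ∧ x + s • (y - x) ∈ frontier Ω ∧ x + t • (y - x) ∈ frontier Ω ∧
      ∀ τ : ℝ, x + τ • (y - x) ∈ closure Ω ↔ s ≤ τ ∧ τ ≤ t := by
  obtain ⟨-, hopen, hbdd, hconv⟩ := hΩ
  have hv : y - x ≠ 0 := sub_ne_zero.2 hxy.symm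
  set ℓ : ℝ → Euc n := fun τ => x + τ • (y - x)
  have hcont : Continuous ℓ := by fun_prop
  have hO : IsOpen (ℓ ⁻¹' Ω) := hopen.preimage hcont
  have h0 : (0 : ℝ) ∈ ℓ ⁻¹' Ω := by simpa [ℓ]
  have h1 : (1 : ℝ) ∈ ℓ ⁻¹' Ω := by simpa [ℓ]
  have hsub : ℓ ⁻¹' Ω ⊆ ℓ ⁻¹' closure Ω := preimage_mono subset_closure
  have hcl : IsClosed (ℓ ⁻¹' closure Ω) := isClosed_closure.preimage hcont
  have hSbdd : Bornology.IsBounded (ℓ ⁻¹' closure Ω) := by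
    obtain ⟨R, hR⟩ := hbdd.closure.exists_norm_le
    refine (Metric.isBounded_closedBall (x := (0 : ℝ)) (r := (R + ‖x‖) / ‖y - x‖)).subset ?_
    intro τ hτ
    rw [mem_closedBall_zero_iff, le_div_iff₀ (norm_pos_iff.2 hv), ← norm_smul]
    calc ‖τ • (y - x)‖ = ‖ℓ τ - x‖ := by simp [ℓ]
      _ ≤ ‖ℓ τ‖ + ‖x‖ := norm_sub_le _ _
      _ ≤ R + ‖x‖ := by gcongr; exact hR _ hτ
  have hSconv : Convex ℝ (ℓ ⁻¹' closure Ω) := by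
    have : ℓ = AffineMap.lineMap x y := by
      ext1 τ
      simp [ℓ, AffineMap.lineMap_apply, add_comm]
    rw [this]
    exact hconv.closure.affine_preimage _
  have hIcc := eq_Icc_of_connected_compact
    (hSconv.isConnected ⟨0, hsub h0⟩) (Metric.isCompact_of_isClosed_isBounded hcl hSbdd)
  set s := sInf (ℓ ⁻¹' closure Ω)
  set t := sSup (ℓ ⁻¹' closure Ω)
  have hiff : ∀ τ : ℝ, ℓ τ ∈ closure Ω ↔ s ≤ τ ∧ τ ≤ t := fun τ => by
    rw [← mem_Icc, ← hIcc, mem_preimage]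
  have hst := (hiff 0).1 (hsub h0)
  have hst1 := (hiff 1).1 (hsub h1)
  have hs : s ∉ ℓ ⁻¹' Ω := fun h => by
    have he : ∀ᶠ τ in nhdsWithin s (Iio s), τ ∈ ℓ ⁻¹' Ω := nhdsWithin_le_nhds (hO.mem_nhds h)
    obtain ⟨τ, hτ, hτs⟩ := (he.and eventually_mem_nhdsWithin).exists
    exact absurd ((hiff τ).1 (hsub hτ)).1 (not_le.2 hτs)
  have ht : t ∉ ℓ ⁻¹' Ω := fun h => by
    have he : ∀ᶠ τ in nhdsWithin t (Ioi t), τ ∈ ℓ ⁻¹' Ω := nhdsWithin_le_nhds (hO.mem_nhds h)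
    obtain ⟨τ, hτ, hτs⟩ := (he.and eventually_mem_nhdsWithin).exists
    exact absurd ((hiff τ).1 (hsub hτ)).2 (not_le.2 hτs)
  refine ⟨s, t, hst.1.lt_of_ne fun h => hs (h ▸ h0), hst1.2.lt_of_ne fun h => ht (h ▸ h1),
    ?_, ?_, hiff⟩
  · rw [hopen.frontier_eq]
    exact ⟨(hiff s).2 ⟨le_rfl, hst.1.trans hst.2⟩, hs⟩
  · rw [hopen.frontier_eq]
    exact ⟨(hiff t).2 ⟨hst.1.trans hst.2, le_rfl⟩, ht⟩

/-- The Hilbert metric expressed through the order defined by the closed cone over `Ω`. -/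
theorem IsHilbertDist.le_iff (hΩ : IsConvexDomain Ω) {d : Euc n → Euc n → ℝ}
    (hd : IsHilbertDist Ω d) {x y : Euc n} (hx : x ∈ Ω) (hy : y ∈ Ω) (r : ℝ) :
    d x y ≤ r ↔ ∃ β : ℝ, 0 < β ∧ projLift y - β • projLift x ∈ closure (coneOver Ω) ∧
      (β * Real.exp (2 * r)) • projLift x - projLift y ∈ closure (coneOver Ω) := by
  have hlx := projLift_last x
  have hly := projLift_last y
  by_cases hxy : x = y
  · subst hxy
    rw [hd.1 x hx]
    constructor
    · intro hr
      have hK := subset_closure (projLift_mem_coneOver hx)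
      refine ⟨1, one_pos, ?_, ?_⟩
      · simpa using smul_mem_closure_coneOver le_rfl hK
      · convert smul_mem_closure_coneOver
          (sub_nonneg.2 (Real.one_le_exp (show 0 ≤ 2 * r by linarith))) hK using 1
        module
    · rintro ⟨β, hβ, h1, h2⟩
      have h1 := last_nonneg_of_mem_closure_coneOver h1
      have h2 := last_nonneg_of_mem_closure_coneOver h2
      simp only [Pi.sub_apply, Pi.smul_apply, hlx, smul_eq_mul, mul_one] at h1 h2
      have : 1 ≤ Real.exp (2 * r) := by nlinarith [Real.exp_pos (2 * r)]
      have := Real.one_le_exp_iff.1 this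
      linarith
  obtain ⟨s, t, hs, ht, ha, hb, hiff⟩ := hΩ.exists_chord hx hy hxy
  have hv : 0 < ‖y - x‖ := norm_pos_iff.2 (sub_ne_zero.2 (Ne.symm hxy))
  have hlow : ∀ β : ℝ, projLift y - β • projLift x ∈ closure (coneOver Ω) ↔
      β ≤ (t - 1) / t := by
    intro β
    have ht0 : 0 < t := by linarith
    have haux : (t - 1) / t < 1 := (div_lt_one ht0).2 (by linarith)
    rcases lt_or_ge β 1 with hβ | hβ
    · have hβ' : 0 < 1 - β := by linarith
      have e : projLift y - β • projLift x =
          (1 - β) • projLift (x + (1 - β)⁻¹ • (y - x)) := by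
        rw [projLift_line, smul_add, smul_smul, mul_inv_cancel₀ hβ'.ne']
        module
      rw [e, smul_projLift_mem_closure_coneOver_iff hβ', hiff, inv_le_iff_one_le_mul₀ hβ',
        le_div_iff₀ ht0]
      constructor
      · rintro ⟨-, h⟩
        linarith
      · intro h
        exact ⟨hs.le.trans (by positivity), by linarith⟩
    · refine iff_of_false (fun h => ?_) (by linarith)
      have h1 := last_nonneg_of_mem_closure_coneOver h
      simp only [Pi.sub_apply, Pi.smul_apply, hlx, hly, smul_eq_mul, mul_one] at h1
      have hβ1 : β = 1 := by linarith
      subst hβ1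
      have := eq_zero_of_mem_closure_coneOver hΩ.2.2.1 h (by simp [hlx, hly])
      rw [one_smul, sub_eq_zero] at this
      exact hxy (projLift_injective this).symm
  have hupp : ∀ γ : ℝ, γ • projLift x - projLift y ∈ closure (coneOver Ω) ↔
      (1 - s) / (-s) ≤ γ := by
    intro γ
    have hs0 : 0 < -s := by linarith
    have haux : 1 < (1 - s) / (-s) := (one_lt_div hs0).2 (by linarith)
    rcases lt_or_ge 1 γ with hγ | hγ
    · have hγ' : 0 < γ - 1 := by linarith
      have e : γ • projLift x - projLift y =
          (γ - 1) • projLift (x + (-(γ - 1)⁻¹) • (y - x)) := by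
        rw [projLift_line, smul_add, smul_smul, mul_neg, mul_inv_cancel₀ hγ'.ne']
        module
      rw [e, smul_projLift_mem_closure_coneOver_iff hγ', hiff, le_neg,
        inv_le_iff_one_le_mul₀ hγ', div_le_iff₀ hs0]
      constructor
      · rintro ⟨h, -⟩
        linarith
      · intro h
        refine ⟨by linarith, ?_⟩
        have := inv_pos.2 hγ'
        linarith
    · refine iff_of_false (fun h => ?_) (by linarith)
      have h1 := last_nonneg_of_mem_closure_coneOver h
      simp only [Pi.sub_apply, Pi.smul_apply, hlx, hly, smul_eq_mul, mul_one] at h1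
      have hγ1 : γ = 1 := by linarith
      subst hγ1
      have := eq_zero_of_mem_closure_coneOver hΩ.2.2.1 h (by simp [hlx, hly])
      rw [one_smul, sub_eq_zero] at this
      exact hxy (projLift_injective this)
  have hdist : d x y = (1 / 2) * Real.log ((1 - s) / (-s) * (t / (t - 1))) := by
    rw [hd.2 x hx y hy hxy _ _ ha hb ⟨s, t, hs, ht, rfl, rfl⟩]
    have e1 : y - (x + s • (y - x)) = (1 - s) • (y - x) := by module
    have e2 : x - (x + s • (y - x)) = (-s) • (y - x) := by module
    have e3 : x - (x + t • (y - x)) = (-t) • (y - x) := by module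
    have e4 : y - (x + t • (y - x)) = (-(t - 1)) • (y - x) := by module
    rw [e1, e2, e3, e4, norm_smul, norm_smul, norm_smul, norm_smul, norm_neg t, norm_neg (t - 1),
      Real.norm_of_nonneg (show 0 ≤ 1 - s by linarith),
      Real.norm_of_nonneg (show 0 ≤ -s by linarith),
      Real.norm_of_nonneg (show 0 ≤ t by linarith),
      Real.norm_of_nonneg (show 0 ≤ t - 1 by linarith),
      mul_div_mul_right _ _ hv.ne', mul_div_mul_right _ _ hv.ne']
  set a := (1 - s) / (-s)
  have ha0 : 0 < a := div_pos (by linarith) (by linarith)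
  set b := (t - 1) / t with hb
  have hb0 : 0 < b := div_pos (by linarith) (by linarith)
  have hbi : t / (t - 1) = b⁻¹ := (inv_div _ _).symm
  have hlog : d x y ≤ r ↔ a ≤ b * Real.exp (2 * r) := by
    rw [hdist, hbi, ← div_eq_mul_inv, ← div_le_iff₀' hb0, ← Real.log_le_iff_le_exp (by positivity)]
    constructor <;> intro h <;> linarith
  simp only [hlog, hlow, hupp]
  constructor
  · exact fun h => ⟨b, hb0, le_rfl, h⟩
  · rintro ⟨β, -, h1, h2⟩
    exact h2.trans (by gcongr)

theorem IsHilbertDist.isConeIsometry (hΩ : IsConvexDomain Ω) {d : Euc n → Euc n → ℝ}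
    (hd : IsHilbertDist Ω d) {V : Type*} [NormedAddCommGroup V] [NormedSpace ℝ V]
    {f : Euc n → V} (hf : SurjOn f Ω univ) (hfd : ∀ x ∈ Ω, ∀ y ∈ Ω, ‖f x - f y‖ = d x y) :
    IsConeIsometry (coneOver Ω) (closure (coneOver Ω)) (fun X => f (projPoint X)) where
  isOpen := isOpen_coneOver hΩ.2.1
  smul_mem hc hX := smul_mem_coneOver hc hX
  add_mem hX hY := add_mem_coneOver hΩ.2.2.2 hX hY
  subset := subset_closure
  isClosed := isClosed_closure
  smul_mem' hc hX := smul_mem_closure_coneOver hc hX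
  add_mem' hX hY := add_mem_closure_coneOver hΩ.2.2.2 hX hY
  salient {X} h1 h2 := by
    have h3 := last_nonneg_of_mem_closure_coneOver h1
    have h4 := last_nonneg_of_mem_closure_coneOver h2
    exact eq_zero_of_mem_closure_coneOver hΩ.2.2.1 h1 (le_antisymm (neg_nonneg.1 h4) h3)
  surj v := by
    obtain ⟨x, hx, rfl⟩ := hf (mem_univ v)
    refine ⟨projLift x, projLift_mem_coneOver hx, ?_⟩
    simpa using congrArg f (projPoint_smul_projLift one_ne_zero x)
  norm_sub_le_iff {X Y} hX hY r := by
    obtain ⟨a, ha, x, hx, rfl⟩ := exists_eq_smul_projLift hX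
    obtain ⟨b, hb, y, hy, rfl⟩ := exists_eq_smul_projLift hY
    rw [projPoint_smul_projLift ha.ne', projPoint_smul_projLift hb.ne', hfd x hx y hy,
      hd.le_iff hΩ hx hy]
    constructor
    · rintro ⟨β, hβ, h1, h2⟩
      refine ⟨β * b / a, by positivity, ?_, ?_⟩
      · convert smul_mem_closure_coneOver hb.le h1 using 1
        rw [smul_smul, div_mul_cancel₀ _ ha.ne']
        module
      · convert smul_mem_closure_coneOver hb.le h2 using 1
        rw [smul_smul, mul_right_comm, div_mul_cancel₀ _ ha.ne']
        module
    · rintro ⟨β, hβ, h1, h2⟩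
      refine ⟨β * a / b, by positivity, ?_, ?_⟩
      · convert smul_mem_closure_coneOver (inv_pos.2 hb).le h1 using 1
        rw [smul_sub, smul_smul, inv_mul_cancel₀ hb.ne']
        module
      · convert smul_mem_closure_coneOver (inv_pos.2 hb).le h2 using 1
        rw [smul_sub, smul_smul b⁻¹ b, inv_mul_cancel₀ hb.ne']
        module

end HilbertDist

theorem IsHilbertDist.eq_of_le_zero {n : ℕ} {Ω : Set (Euc n)} (hΩ : IsConvexDomain Ω)
    {d : Euc n → Euc n → ℝ} (hd : IsHilbertDist Ω d) {x y : Euc n} (hx : x ∈ Ω) (hy : y ∈ Ω)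
    (h : d x y ≤ 0) : x = y := by
  obtain ⟨β, hβ, h1, h2⟩ := (hd.le_iff hΩ hx hy 0).1 h
  have h3 := last_nonneg_of_mem_closure_coneOver h1
  have h4 := last_nonneg_of_mem_closure_coneOver h2
  simp only [mul_zero, Real.exp_zero, mul_one, Pi.sub_apply, Pi.smul_apply, projLift_last,
    smul_eq_mul] at h3 h4
  obtain rfl : β = 1 := by linarith
  have := eq_zero_of_mem_closure_coneOver hΩ.2.2.1 h1 (by simp [projLift_last])
  rw [one_smul, sub_eq_zero] at this
  exact (projLift_injective this).symm

theorem exists_normedSpace_norm_eq {W : Type} [AddCommGroup W] [Module ℝ W]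
    [FiniteDimensional ℝ W] {N : W → ℝ} (hnonneg : ∀ x, 0 ≤ N x) (hzero : ∀ x, N x = 0 ↔ x = 0)
    (hsmul : ∀ (c : ℝ) (x : W), N (c • x) = |c| * N x)
    (hadd : ∀ x y, N (x + y) ≤ N x + N y) :
    ∃ (V : Type) (_ : NormedAddCommGroup V) (_ : NormedSpace ℝ V) (_ : FiniteDimensional ℝ V)
      (e : W ≃+ V), ∀ x, ‖e x‖ = N x := by
  let _ : Norm W := ⟨N⟩
  have core : NormedSpace.Core ℝ W :=
    { norm_nonneg := hnonneg
      norm_smul := hsmul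
      norm_triangle := hadd
      norm_eq_zero_iff := hzero }
  let _ := NormedAddCommGroup.ofCore core
  let _ := NormedSpace.ofCore core
  exact ⟨W, inferInstance, inferInstance, inferInstance, AddEquiv.refl _, fun _ => rfl⟩

theorem exists_affineIndependent_simplex (n : ℕ) :
    ∃ v : Fin (n + 1) → Euc n, AffineIndependent ℝ v := by
  obtain ⟨b⟩ := AffineBasis.exists_affineBasis_of_finiteDimensional (k := ℝ) (V := Euc n)
    (P := Euc n) (ι := Fin (n + 1)) (by simp)
  exact ⟨b, b.ind⟩

theorem AffineIndependent.linearIndependent_projLift {n : ℕ} {v : Fin (n + 1) → Euc n}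
    (hv : AffineIndependent ℝ v) : LinearIndependent ℝ fun i => projLift (v i) := by
  rw [Fintype.linearIndependent_iff]
  intro w hw
  have h0 : ∑ i, w i = 0 := by
    simpa [projLift_last] using congrFun hw (Fin.last n)
  have h1 : ∑ i, w i • v i = 0 := by
    ext k
    simpa [projLift_castSucc] using congrFun hw k.castSucc
  exact fun i => (affineIndependent_iff.1 hv) Finset.univ w h0 h1 i (Finset.mem_univ i)

/-- The basis of `ℝ^{n+1}` formed by the lifts of the vertices of a simplex. -/
def simplexBasis {n : ℕ} {v : Fin (n + 1) → Euc n} (hv : AffineIndependent ℝ v) :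
    Module.Basis (Fin (n + 1)) ℝ (Fin (n + 1) → ℝ) :=
  basisOfLinearIndependentOfCardEqFinrank hv.linearIndependent_projLift (by simp)

theorem simplexBasis_apply {n : ℕ} {v : Fin (n + 1) → Euc n} (hv : AffineIndependent ℝ v)
    (i : Fin (n + 1)) : simplexBasis hv i = projLift (v i) := by
  simp [simplexBasis]

theorem mem_interior_convexHull_range_iff {n : ℕ} {v : Fin (n + 1) → Euc n}
    (hv : AffineIndependent ℝ v) {x : Euc n} :
    x ∈ interior (convexHull ℝ (range v)) ↔ ∀ i, 0 < (simplexBasis hv).repr (projLift x) i := by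
  let b : AffineBasis (Fin (n + 1)) ℝ (Euc n) :=
    ⟨v, hv, (hv.affineSpan_eq_top_iff_card_eq_finrank_add_one).2 (by simp)⟩
  have hcoord : ∀ i, (simplexBasis hv).repr (projLift x) i = b.coord i x := by
    have hx : projLift x = ∑ i, b.coord i x • simplexBasis hv i := by
      simp only [simplexBasis_apply]
      rw [← projLift_sum _ _ _ (b.sum_coord_apply_eq_one x)]
      exact congrArg _ (b.linear_combination_coord_eq_self x).symm
    intro i
    conv_lhs => rw [hx]
    rw [Module.Basis.repr_sum_self]
  have hint := b.interior_convexHull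
  simp only [hcoord]
  exact Set.ext_iff.1 hint x

theorem coneOver_interior_convexHull_range {n : ℕ} {v : Fin (n + 1) → Euc n}
    (hv : AffineIndependent ℝ v) :
    coneOver (interior (convexHull ℝ (range v))) =
      {X | ∀ i, 0 < (simplexBasis hv).repr X i} := by
  ext X
  constructor
  · intro hX i
    obtain ⟨c, hc, x, hx, rfl⟩ := exists_eq_smul_projLift hX
    simpa using mul_pos hc ((mem_interior_convexHull_range_iff hv).1 hx i)
  · intro hX
    have hlast : X (Fin.last n) = ∑ i, (simplexBasis hv).repr X i := by
      conv_lhs => rw [← (simplexBasis hv).sum_repr X]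
      simp [simplexBasis_apply, projLift_last]
    have hpos : 0 < X (Fin.last n) := by
      rw [hlast]
      exact Finset.sum_pos (fun i _ => hX i) Finset.univ_nonempty
    refine ⟨hpos, (mem_interior_convexHull_range_iff hv).2 fun i => ?_⟩
    have h := hX i
    rw [← smul_projLift_projPoint hpos.ne', map_smul, Finsupp.smul_apply, smul_eq_mul] at h
    exact pos_of_mul_pos_right h hpos.le

theorem projMapsOnto_of_image_coneOver {n : ℕ} {U W : Set (Euc n)}
    {T : (Fin (n + 1) → ℝ) ≃ₗ[ℝ] (Fin (n + 1) → ℝ)}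
    (h : ∀ X, X ∈ coneOver U ↔ T X ∈ coneOver W) : ProjMapsOnto T U W := by
  constructor
  · intro x hx
    obtain ⟨c, hc, y, hy, hxy⟩ := exists_eq_smul_projLift ((h _).1 (projLift_mem_coneOver hx))
    exact ⟨y, hy, c, hc.ne', hxy⟩
  · intro y hy
    obtain ⟨c, hc, x, hx, hxy⟩ := exists_eq_smul_projLift
      ((h (T.symm (projLift y))).2 (by simpa using projLift_mem_coneOver hy))
    refine ⟨x, hx, c⁻¹, inv_ne_zero hc.ne', ?_⟩
    rw [← T.apply_symm_apply (projLift y), hxy, map_smul, smul_smul, inv_mul_cancel₀ hc.ne',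
      one_smul]

theorem mem_coneOver_iff_of_projMapsOnto {n : ℕ} {U W : Set (Euc n)}
    {T : (Fin (n + 1) → ℝ) ≃ₗ[ℝ] (Fin (n + 1) → ℝ)} (h : ProjMapsOnto T U W)
    (hpos : ∀ x ∈ U, 0 < T (projLift x) (Fin.last n)) (X : Fin (n + 1) → ℝ) :
    X ∈ coneOver U ↔ T X ∈ coneOver W := by
  constructor
  · intro hX
    obtain ⟨a, ha, x, hx, rfl⟩ := exists_eq_smul_projLift hX
    obtain ⟨y, hy, c, -, hxy⟩ := h.1 x hx
    have hc := hpos x hx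
    rw [hxy, Pi.smul_apply, projLift_last, smul_eq_mul, mul_one] at hc
    rw [map_smul, hxy, smul_smul]
    exact smul_projLift_mem_coneOver (mul_pos ha hc) hy
  · intro hX
    obtain ⟨a, ha, y, hy, hXy⟩ := exists_eq_smul_projLift hX
    obtain ⟨x, hx, c, -, hxy⟩ := h.2 y hy
    have hc := hpos x hx
    rw [hxy, Pi.smul_apply, projLift_last, smul_eq_mul, mul_one] at hc
    have : X = (a / c) • projLift x := T.injective <| by
      rw [hXy, map_smul, hxy, smul_smul, div_mul_cancel₀ _ hc.ne']
    rw [this]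
    exact smul_projLift_mem_coneOver (div_pos ha hc) hx

theorem ProjMapsOnto.neg {n : ℕ} {U W : Set (Euc n)}
    {T : (Fin (n + 1) → ℝ) ≃ₗ[ℝ] (Fin (n + 1) → ℝ)} (h : ProjMapsOnto T U W) :
    ProjMapsOnto (T.trans (LinearEquiv.neg ℝ)) U W := by
  refine ⟨fun x hx => ?_, fun y hy => ?_⟩
  · obtain ⟨y, hy, c, hc, hxy⟩ := h.1 x hx
    exact ⟨y, hy, -c, neg_ne_zero.2 hc, by simp [hxy]⟩
  · obtain ⟨x, hx, c, hc, hxy⟩ := h.2 y hy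
    exact ⟨x, hx, -c, neg_ne_zero.2 hc, by simp [hxy]⟩

theorem ProjMapsOnto.exists_mem_coneOver_iff {n : ℕ} {U W : Set (Euc n)} (hU : Convex ℝ U)
    {T : (Fin (n + 1) → ℝ) ≃ₗ[ℝ] (Fin (n + 1) → ℝ)} (h : ProjMapsOnto T U W) :
    ∃ S : (Fin (n + 1) → ℝ) ≃ₗ[ℝ] (Fin (n + 1) → ℝ),
      ∀ X, X ∈ coneOver U ↔ S X ∈ coneOver W := by
  have hne : ∀ x ∈ U, T (projLift x) (Fin.last n) ≠ 0 := by
    intro x hx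
    obtain ⟨y, -, c, hc, hxy⟩ := h.1 x hx
    simpa [hxy, projLift_last]
  have hcont : Continuous fun x : Euc n => T (projLift x) (Fin.last n) :=
    (continuous_apply _).comp
      ((LinearMap.continuous_of_finiteDimensional T.toLinearMap).comp continuous_projLift)
  by_cases hpos : ∀ x ∈ U, 0 < T (projLift x) (Fin.last n)
  · exact ⟨T, mem_coneOver_iff_of_projMapsOnto h hpos⟩
  · push Not at hpos
    obtain ⟨x, hx, hx0⟩ := hpos
    refine ⟨_, mem_coneOver_iff_of_projMapsOnto h.neg fun y hy => ?_⟩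
    by_contra hy0
    have hy0 : 0 ≤ T (projLift y) (Fin.last n) := by simpa using hy0
    obtain ⟨z, hz, hz0⟩ :=
      hU.isPreconnected.intermediate_value hx hy hcont.continuousOn ⟨hx0, hy0⟩
    exact hne z hz hz0

theorem exists_projMapsOnto_simplex_iff {n : ℕ} {Ω : Set (Euc n)} (hΩ : Convex ℝ Ω) :
    (∃ (T : (Fin (n + 1) → ℝ) ≃ₗ[ℝ] (Fin (n + 1) → ℝ)) (v : Fin (n + 1) → Euc n),
      AffineIndependent ℝ v ∧ ProjMapsOnto T Ω (interior (convexHull ℝ (range v)))) ↔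
    ∃ b : Module.Basis (Fin (n + 1)) ℝ (Fin (n + 1) → ℝ),
      coneOver Ω = {X | ∀ i, 0 < b.repr X i} := by
  constructor
  · rintro ⟨T, v, hv, hT⟩
    obtain ⟨S, hS⟩ := hT.exists_mem_coneOver_iff hΩ
    refine ⟨(simplexBasis hv).map S.symm, ?_⟩
    ext X
    rw [hS, coneOver_interior_convexHull_range hv]
    simp
  · rintro ⟨b, hb⟩
    obtain ⟨v, hv⟩ := exists_affineIndependent_simplex n
    refine ⟨b.equiv (simplexBasis hv) (Equiv.refl _), v, hv,
      projMapsOnto_of_image_coneOver fun X => ?_⟩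
    rw [hb, coneOver_interior_convexHull_range hv]
    have : (simplexBasis hv).repr (b.equiv (simplexBasis hv) (Equiv.refl _) X) = b.repr X := by
      simp [Module.Basis.equiv]
    simp [this]

theorem closure_setOf_pos_repr {ι E : Type*} [Fintype ι] [NormedAddCommGroup E]
    [NormedSpace ℝ E] [FiniteDimensional ℝ E] (b : Module.Basis ι ℝ E) :
    closure {x | ∀ i, 0 < b.repr x i} = {x | ∀ i, 0 ≤ b.repr x i} := by
  apply Subset.antisymm
  · refine closure_minimal (fun x hx i => (hx i).le) ?_
    simp only [ofPred_forall]
    exact isClosed_iInter fun i => isClosed_le continuous_const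
      (LinearMap.continuous_of_finiteDimensional (b.coord i))
  · intro x hx
    have hlim : Tendsto (fun ε : ℝ => x + ε • ∑ i, b i) (nhdsWithin 0 (Ioi 0)) (nhds x) := by
      have : Continuous fun ε : ℝ => x + ε • ∑ i, b i := by fun_prop
      simpa using (this.tendsto 0).mono_left nhdsWithin_le_nhds
    refine mem_closure_of_tendsto hlim (eventually_mem_nhdsWithin.mono fun ε hε i => ?_)
    have h1 : b.repr (∑ i, b i) i = 1 := by
      simp
    have h2 := hx i
    have h3 : (0 : ℝ) < ε := hε
    rw [map_add, map_smul, Finsupp.add_apply, Finsupp.smul_apply, h1, smul_eq_mul, mul_one]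
    exact add_pos_of_nonneg_of_pos h2 h3

/-- The norm on `ℝⁿ ≅ ℝ^{n+1} / ℝ (1, …, 1)` given by half of the oscillation. -/
def oscNorm {n : ℕ} (y : Fin n → ℝ) : ℝ :=
  (1 / 2) * ‖fun p : Fin (n + 1) × Fin (n + 1) =>
    (Fin.cons 0 y : Fin (n + 1) → ℝ) p.1 - (Fin.cons 0 y : Fin (n + 1) → ℝ) p.2‖

theorem isNorm_oscNorm {n : ℕ} : IsNorm (oscNorm (n := n)) := by
  have hadd : ∀ (x y : Fin n → ℝ) (i : Fin (n + 1)), (Fin.cons 0 (x + y) : Fin (n + 1) → ℝ) i =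
      (Fin.cons 0 x : Fin (n + 1) → ℝ) i + (Fin.cons 0 y : Fin (n + 1) → ℝ) i := by
    intro x y i
    refine Fin.cases ?_ (fun i => ?_) i <;> simp
  have hsmul : ∀ (c : ℝ) (x : Fin n → ℝ) (i : Fin (n + 1)),
      (Fin.cons 0 (c • x) : Fin (n + 1) → ℝ) i = c * (Fin.cons 0 x : Fin (n + 1) → ℝ) i := by
    intro c x i
    refine Fin.cases ?_ (fun i => ?_) i <;> simp
  refine ⟨fun x => by unfold oscNorm; positivity, fun x => ?_, fun c x => ?_, fun x y => ?_⟩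
  · constructor
    · intro h
      have h := norm_eq_zero.1 ((mul_eq_zero.1 h).resolve_left (by norm_num))
      ext i
      simpa using congrFun h (i.succ, 0)
    · rintro rfl
      have : ∀ i, (Fin.cons 0 (0 : Fin n → ℝ) : Fin (n + 1) → ℝ) i = 0 := fun i => by
        simpa using hsmul 0 0 i
      simp only [oscNorm, this, sub_zero]
      exact mul_eq_zero_of_right _ norm_zero
  · have : (fun p : Fin (n + 1) × Fin (n + 1) => (Fin.cons 0 (c • x) : Fin (n + 1) → ℝ) p.1 -
        (Fin.cons 0 (c • x) : Fin (n + 1) → ℝ) p.2) = c • fun p =>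
        (Fin.cons 0 x : Fin (n + 1) → ℝ) p.1 - (Fin.cons 0 x : Fin (n + 1) → ℝ) p.2 := by
      ext p
      simp only [hsmul, Pi.smul_apply, smul_eq_mul, mul_sub]
    rw [oscNorm, oscNorm, this, norm_smul, Real.norm_eq_abs]
    ring
  · have : (fun p : Fin (n + 1) × Fin (n + 1) => (Fin.cons 0 (x + y) : Fin (n + 1) → ℝ) p.1 -
        (Fin.cons 0 (x + y) : Fin (n + 1) → ℝ) p.2) = (fun p =>
        (Fin.cons 0 x : Fin (n + 1) → ℝ) p.1 - (Fin.cons 0 x : Fin (n + 1) → ℝ) p.2) + fun p =>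
        (Fin.cons 0 y : Fin (n + 1) → ℝ) p.1 - (Fin.cons 0 y : Fin (n + 1) → ℝ) p.2 := by
      ext p
      simp only [hadd, Pi.add_apply]
      ring
    rw [oscNorm, oscNorm, oscNorm, this, ← mul_add]
    gcongr
    exact norm_add_le _ _

theorem oscNorm_le_iff {n : ℕ} (z : Fin (n + 1) → ℝ) (r : ℝ) :
    oscNorm (fun i => z i.succ - z 0) ≤ r ↔ ∀ i j, z i - z j ≤ 2 * r := by
  have hz : ∀ i, (Fin.cons 0 (fun i => z i.succ - z 0) : Fin (n + 1) → ℝ) i = z i - z 0 := by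
    intro i
    refine Fin.cases ?_ (fun i => ?_) i <;> simp
  have : oscNorm (fun i => z i.succ - z 0) ≤ r ↔
      ‖fun p : Fin (n + 1) × Fin (n + 1) => z p.1 - z p.2‖ ≤ 2 * r := by
    simp only [oscNorm, hz, sub_sub_sub_cancel_right]
    constructor <;> intro h <;> linarith
  rw [this, pi_norm_le_iff_of_nonempty]
  constructor
  · exact fun h i j => (le_abs_self _).trans (h (i, j))
  · intro h p
    exact abs_le.2 ⟨by linarith [h p.2 p.1], h _ _⟩

/-- The logarithmic coordinates which flatten the Hilbert metric of a simplicial cone. -/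
def logCoord {n : ℕ} (b : Module.Basis (Fin (n + 1)) ℝ (Fin (n + 1) → ℝ)) (x : Euc n) :
    Fin n → ℝ :=
  fun i => Real.log (b.repr (projLift x) i.succ) - Real.log (b.repr (projLift x) 0)

section Simplicial

variable {n : ℕ} {Ω : Set (Euc n)} {b : Module.Basis (Fin (n + 1)) ℝ (Fin (n + 1) → ℝ)}

theorem IsHilbertDist.oscNorm_logCoord_sub (hΩ : IsConvexDomain Ω) {d : Euc n → Euc n → ℝ}
    (hd : IsHilbertDist Ω d) (hb : coneOver Ω = {X | ∀ i, 0 < b.repr X i}) {x y : Euc n}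
    (hx : x ∈ Ω) (hy : y ∈ Ω) : oscNorm (logCoord b x - logCoord b y) = d x y := by
  refine eq_of_forall_ge_iff fun r => ?_
  have hX : ∀ i, 0 < b.repr (projLift x) i := by
    have := projLift_mem_coneOver hx
    rwa [hb] at this
  have hY : ∀ i, 0 < b.repr (projLift y) i := by
    have := projLift_mem_coneOver hy
    rwa [hb] at this
  rw [hd.le_iff hΩ hx hy, hb, closure_setOf_pos_repr]
  set X := b.repr (projLift x)
  set Y := b.repr (projLift y)
  have hsub : logCoord b x - logCoord b y = fun i : Fin n =>
      (Real.log (X i.succ) - Real.log (Y i.succ)) - (Real.log (X 0) - Real.log (Y 0)) := by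
    ext i
    simp only [logCoord, Pi.sub_apply]
    ring
  rw [hsub, oscNorm_le_iff fun i => Real.log (X i) - Real.log (Y i)]
  simp only [mem_ofPred_eq, map_sub, map_smul, Finsupp.sub_apply, Finsupp.smul_apply, smul_eq_mul,
    sub_nonneg]
  constructor
  · intro h
    obtain ⟨k, hk⟩ := Finite.exists_max fun i => Real.log (X i) - Real.log (Y i)
    refine ⟨Real.exp (Real.log (Y k) - Real.log (X k)), Real.exp_pos _, fun i => ?_, fun i => ?_⟩
    · change _ * X i ≤ Y i
      rw [← Real.exp_log (hX i), ← Real.exp_log (hY i), ← Real.exp_add, Real.exp_le_exp]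
      linarith [hk i]
    · change Y i ≤ _ * X i
      rw [← Real.exp_log (hX i), ← Real.exp_log (hY i), ← Real.exp_add, ← Real.exp_add,
        Real.exp_le_exp]
      linarith [h k i]
  · rintro ⟨β, hβ, h1, h2⟩ i j
    have h1 := Real.log_le_log (mul_pos hβ (hX i)) (h1 i)
    have h2 := Real.log_le_log (hY j) (h2 j)
    rw [Real.log_mul hβ.ne' (hX i).ne'] at h1
    rw [Real.log_mul (by positivity) (hX j).ne', Real.log_mul hβ.ne' (Real.exp_pos _).ne',
      Real.log_exp] at h2
    linarith

theorem bijOn_logCoord (hΩ : IsConvexDomain Ω) {d : Euc n → Euc n → ℝ}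
    (hd : IsHilbertDist Ω d) (hb : coneOver Ω = {X | ∀ i, 0 < b.repr X i}) :
    BijOn (logCoord b) Ω univ := by
  refine ⟨mapsTo_univ _ _, fun x hx y hy hxy => ?_, fun y _ => ?_⟩
  · refine hd.eq_of_le_zero hΩ hx hy ?_
    rw [← hd.oscNorm_logCoord_sub hΩ hb hx hy, hxy, sub_self, (isNorm_oscNorm.2.1 0).2 rfl]
  · set w : Fin (n + 1) → ℝ := Fin.cons 0 y
    have hrepr : ∀ i, b.repr (∑ i, Real.exp (w i) • b i) i = Real.exp (w i) := fun i =>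
      congrFun (b.repr_sum_self fun i => Real.exp (w i)) i
    have hX : ∑ i, Real.exp (w i) • b i ∈ coneOver Ω := by
      rw [hb]
      intro i
      rw [hrepr]
      exact Real.exp_pos _
    obtain ⟨c, hc, x, hx, hcx⟩ := exists_eq_smul_projLift hX
    refine ⟨x, hx, ?_⟩
    have hlog : ∀ i, Real.log (b.repr (projLift x) i) = w i - Real.log c := by
      intro i
      have hi : c * b.repr (projLift x) i = Real.exp (w i) := by
        rw [← hrepr i, hcx, map_smul, Finsupp.smul_apply, smul_eq_mul]
      rw [eq_div_of_mul_eq hc.ne' ((mul_comm _ _).trans hi),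
        Real.log_div (Real.exp_pos _).ne' hc.ne', Real.log_exp]
    ext i
    simp [logCoord, hlog, w]

end Simplicial

theorem exists_basis_of_isometry {n m : ℕ} {Ω : Set (Euc n)} (hΩ : IsConvexDomain Ω)
    {d : Euc n → Euc n → ℝ} (hd : IsHilbertDist Ω d) {Nm : (Fin m → ℝ) → ℝ} (hNm : IsNorm Nm)
    {f : Euc n → Fin m → ℝ} (hf : SurjOn f Ω univ)
    (hfd : ∀ x ∈ Ω, ∀ y ∈ Ω, Nm (f x - f y) = d x y) :
    ∃ b : Module.Basis (Fin (n + 1)) ℝ (Fin (n + 1) → ℝ),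
      coneOver Ω = {X | ∀ i, 0 < b.repr X i} := by
  obtain ⟨V, _, _, _, e, he⟩ :=
    exists_normedSpace_norm_eq hNm.1 hNm.2.1 hNm.2.2.1 hNm.2.2.2
  have hcone := hd.isConeIsometry hΩ (f := e ∘ f)
    (SurjOn.comp (surjOn_univ.2 e.surjective) hf)
    (fun x hx y hy => by rw [Function.comp, Function.comp, ← map_sub, he, hfd x hx y hy])
  obtain ⟨b, hb⟩ := hcone.exists_basis Subset.rfl
  let σ := finCongr (Module.finrank_fin_fun ℝ (n := n + 1))
  refine ⟨b.reindex σ, ?_⟩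
  rw [hb]
  ext X
  simp only [mem_ofPred_eq, Module.Basis.repr_reindex_apply]
  exact σ.forall_congr_left

/-- **Nussbaum, de la Harpe / Foertsch–Karlsson.**  A Hilbert geometry `(Ω, d_Ω)` of dimension
`n` is isometric to some finite-dimensional normed vector space if and only if `Ω` is
projectively equivalent to the interior of an `n`-dimensional simplex. -/
theorem isometric_to_normed_space_iff_simplex {n : ℕ}
    (Ω : Set (Euc n)) (hΩ : IsConvexDomain Ω)
    (d : Euc n → Euc n → ℝ) (hd : IsHilbertDist Ω d) :
    (∃ (m : ℕ) (Nm : (Fin m → ℝ) → ℝ), IsNorm Nm ∧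
      ∃ f : Euc n → (Fin m → ℝ), Set.BijOn f Ω Set.univ ∧
        ∀ x ∈ Ω, ∀ y ∈ Ω, Nm (f x - f y) = d x y) ↔
    (∃ (T : (Fin (n + 1) → ℝ) ≃ₗ[ℝ] (Fin (n + 1) → ℝ)) (v : Fin (n + 1) → Euc n),
      AffineIndependent ℝ v ∧
      ProjMapsOnto T Ω (interior (convexHull ℝ (Set.range v)))) := by
  rw [exists_projMapsOnto_simplex_iff hΩ.2.2.2]
  constructor
  · rintro ⟨m, Nm, hNm, f, hf, hfd⟩
    exact exists_basis_of_isometry hΩ hd hNm hf.surjOn hfd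
  · rintro ⟨b, hb⟩
    exact ⟨n, oscNorm, isNorm_oscNorm, logCoord b, bijOn_logCoord hΩ hd hb,
      fun x hx y hy => hd.oscNorm_logCoord_sub hΩ hb hx hy⟩
end
end

section
/- Let (V, ‖·‖) be a two-dimensional normed vector space. Then there exists a constant c with 6 ≤ c ≤ 8 such that for every R > 0 the length (measured with respect to the metric induced by ‖·‖) of the sphere of radius R centered at the origin equals c · R; equivalently, the perimeter of the unit ball of V, measured in the norm ‖·‖ itself, lies between 6 and 8. -/
open Set Filter MeasureTheory
open scoped Pointwise

noncomputable section

/-- If `p` lies in the first quadrant of a normed plane, dominated strictly by `q` in both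
coordinates, and the slope of `p` is at most that of `q`, then `‖p‖ < 1` when `‖q‖ ≤ 1`. -/
lemma norm_lt_one_of_coord_lt {V : Type*} [NormedAddCommGroup V] [NormedSpace ℝ V]
    {e f p q : V} {x y x' y' : ℝ} (he : ‖e‖ ≤ 1) (hp : p = x • e + y • f)
    (hq : q = x' • e + y' • f) (hq1 : ‖q‖ ≤ 1) (hy : 0 ≤ y)
    (hx' : x' ≤ 1) (hx'0 : 0 < x') (hy'0 : 0 < y') (hxx' : x < x')
    (hslope : y * x' ≤ x * y') : ‖p‖ < 1 := by
  set α : ℝ := y / y' with hα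
  have hα0 : 0 ≤ α := by positivity
  have hαy : α * y' = y := by rw [hα]; field_simp
  have hβ : 0 ≤ x - α * x' := by
    rw [hα, sub_nonneg, div_mul_eq_mul_div, div_le_iff₀ hy'0]
    exact hslope
  have hpq : p = α • q + (x - α * x') • e := by
    rw [hp, hq, ← hαy]
    module
  have h1 : ‖p‖ ≤ α + (x - α * x') := by
    rw [hpq]
    refine (norm_add_le _ _).trans ?_
    rw [norm_smul, norm_smul, Real.norm_of_nonneg hα0, Real.norm_of_nonneg hβ]
    nlinarith
  have hα1 : α < 1 := by
    by_contra! h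
    nlinarith
  nlinarith

/-- The part of the unit sphere in a quadrant spanned by an Auerbach basis has length at
most `2`. -/
lemma hausdorffMeasure_sphere_quadrant_le {V : Type*} [NormedAddCommGroup V] [NormedSpace ℝ V]
    [MeasurableSpace V] [BorelSpace V] {e f : V} {X Y : V →ₗ[ℝ] ℝ} (he : ‖e‖ ≤ 1)
    (hf : ‖f‖ ≤ 1) (hXY : ∀ p, p = X p • e + Y p • f) (hX : ∀ p, X p ≤ ‖p‖)
    (hY : ∀ p, Y p ≤ ‖p‖) :
    μH[(1 : ℝ)] {p : V | ‖p‖ = 1 ∧ 0 ≤ X p ∧ 0 ≤ Y p} ≤ 2 := by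
  set S := {p : V | ‖p‖ = 1 ∧ 0 ≤ X p ∧ 0 ≤ Y p} with hS
  have hnot : ∀ p ∈ S, ∀ q ∈ S, X p < X q → Y q ≤ Y p := by
    rintro p ⟨hp1, hpx, hpy⟩ q ⟨hq1, hqx, hqy⟩ hx
    by_contra! hy
    have hx1 : X q ≤ 1 := hq1 ▸ hX q
    have hy1 : Y q ≤ 1 := hq1 ▸ hY q
    rcases le_total (Y p * X q) (X p * Y q) with h | h
    · exact (norm_lt_one_of_coord_lt he (hXY p) (hXY q) hq1.le hpy hx1 (hpx.trans_lt hx)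
        (hpy.trans_lt hy) hx h).ne hp1
    · exact (norm_lt_one_of_coord_lt hf ((hXY p).trans (add_comm _ _))
        ((hXY q).trans (add_comm _ _)) hq1.le hpx hy1 (hpy.trans_lt hy)
        (hpx.trans_lt hx) hy h).ne hp1
  have hdist : ∀ p ∈ S, ∀ q ∈ S, X p ≤ X q → Y q ≤ Y p →
      ‖p - q‖ ≤ |(Y p - X p) - (Y q - X q)| := by
    intro p hp q hq hx hy
    have hpq : p - q = (X p - X q) • e + (Y p - Y q) • f := by
      conv_lhs => rw [hXY p, hXY q]
      module
    rw [hpq]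
    refine (norm_add_le _ _).trans ?_
    rw [norm_smul, norm_smul, Real.norm_of_nonpos (sub_nonpos.2 hx),
      Real.norm_of_nonneg (sub_nonneg.2 hy)]
    refine le_trans ?_ (le_abs_self _)
    nlinarith [norm_nonneg e, norm_nonneg f]
  have hanti : ∀ p ∈ S, ∀ q ∈ S, ‖p - q‖ ≤ |(Y p - X p) - (Y q - X q)| := by
    intro p hp q hq
    rcases lt_trichotomy (X p) (X q) with h | h | h
    · exact hdist p hp q hq h.le (hnot p hp q hq h)
    · rcases le_total (Y p) (Y q) with h' | h'
      · rw [norm_sub_rev, abs_sub_comm]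
        exact hdist q hq p hp h.ge h'
      · exact hdist p hp q hq h.le h'
    · rw [norm_sub_rev, abs_sub_comm]
      exact hdist q hq p hp h.le (hnot q hq p hp h)
  set φ : V → ℝ := fun p => Y p - X p with hφ
  have hinj : InjOn φ S := by
    intro p hp q hq h
    have h1 := hanti p hp q hq
    have h2 : (Y p - X p) - (Y q - X q) = 0 := sub_eq_zero.2 h
    rw [h2, abs_zero] at h1
    exact sub_eq_zero.1 (norm_le_zero_iff.1 h1)
  have hlip : LipschitzOnWith 1 (Function.invFunOn φ S) (φ '' S) := by
    refine LipschitzOnWith.of_dist_le_mul ?_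
    rintro _ ⟨p, hp, rfl⟩ _ ⟨q, hq, rfl⟩
    rw [hinj.leftInvOn_invFunOn hp, hinj.leftInvOn_invFunOn hq, dist_eq_norm, Real.dist_eq]
    simpa using hanti p hp q hq
  have h1 := hlip.hausdorffMeasure_image_le (d := 1) zero_le_one
  rw [hinj.leftInvOn_invFunOn.image_image] at h1
  have h2 : φ '' S ⊆ Icc (-1) 1 := by
    rintro _ ⟨p, ⟨hp1, hpx, hpy⟩, rfl⟩
    have hx := hX p
    have hy := hY p
    rw [hp1] at hx hy
    simp only [hφ, mem_Icc]
    constructor <;> linarith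
  calc μH[(1 : ℝ)] S ≤ μH[(1 : ℝ)] (φ '' S) := by simpa using h1
    _ ≤ μH[(1 : ℝ)] (Icc (-1 : ℝ) 1) := measure_mono h2
    _ = 2 := by
      rw [hausdorffMeasure_real, Real.volume_Icc]
      norm_num

/-- Every normed plane has an Auerbach basis. -/
lemma exists_auerbach_basis {V : Type*} [NormedAddCommGroup V] [NormedSpace ℝ V]
    (hdim : Module.finrank ℝ V = 2) :
    ∃ (e f : V) (X Y : V →ₗ[ℝ] ℝ), ‖e‖ ≤ 1 ∧ ‖f‖ ≤ 1 ∧ (∀ p, p = X p • e + Y p • f) ∧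
      (∀ p, X p ≤ ‖p‖) ∧ (∀ p, Y p ≤ ‖p‖) := by
  have : Module.Finite ℝ V := Module.finite_of_finrank_pos (by omega)
  have : ProperSpace V := FiniteDimensional.proper ℝ V
  obtain ⟨b⟩ : Nonempty (Module.Basis (Fin 2) ℝ V) := ⟨Module.finBasisOfFinrankEq ℝ V hdim⟩
  obtain ⟨A, hAdef⟩ : ∃ A : V → V → ℝ, ∀ v w,
      A v w = b.coord 0 v * b.coord 1 w - b.coord 1 v * b.coord 0 w := ⟨_, fun _ _ => rfl⟩
  have hc : ∀ i, Continuous (b.coord i) := fun i => (b.coord i).continuous_of_finiteDimensional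
  have hA : Continuous fun z : V × V => A z.1 z.2 := by
    simp only [hAdef]
    exact (((hc 0).comp continuous_fst).mul ((hc 1).comp continuous_snd)).sub
      (((hc 1).comp continuous_fst).mul ((hc 0).comp continuous_snd))
  have hsl : ∀ (r : ℝ) v w, A (r • v) w = r * A v w := by
    intro r v w; simp only [hAdef, map_smul, smul_eq_mul]; ring
  have hsr : ∀ (r : ℝ) v w, A v (r • w) = r * A v w := by
    intro r v w; simp only [hAdef, map_smul, smul_eq_mul]; ring
  obtain ⟨⟨e, f⟩, ⟨he, hf⟩, hmax⟩ :=
    ((isCompact_closedBall (0 : V) 1).prod (isCompact_closedBall (0 : V) 1)).exists_isMaxOn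
      ⟨(0, 0), by simp⟩ hA.continuousOn
  replace he : ‖e‖ ≤ 1 := by simpa using he
  replace hf : ‖f‖ ≤ 1 := by simpa using hf
  have hle : ∀ v w, ‖v‖ ≤ 1 → ‖w‖ ≤ 1 → A v w ≤ A e f := fun v w hv hw =>
    hmax (show (v, w) ∈ Metric.closedBall (0 : V) 1 ×ˢ Metric.closedBall (0 : V) 1 by
      simp [hv, hw])
  have hunit : ∀ v : V, ‖‖v‖⁻¹ • v‖ ≤ 1 := by
    intro v
    rw [norm_smul, norm_inv, norm_norm]
    exact inv_mul_le_one
  have hpos : 0 < A e f := by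
    have h := hle _ _ (hunit (b 0)) (hunit (b 1))
    have h01 : A (b 0) (b 1) = 1 := by simp [hAdef]
    rw [hsl, hsr, h01, mul_one] at h
    refine lt_of_lt_of_le ?_ h
    have h0 := norm_pos_iff.2 (b.ne_zero 0)
    have h1 := norm_pos_iff.2 (b.ne_zero 1)
    positivity
  have hboundl : ∀ p, A p f ≤ ‖p‖ * A e f := by
    intro p
    rcases eq_or_ne p 0 with rfl | hp
    · simp [hAdef]
    · have h := hle _ _ (hunit p) hf
      rwa [hsl, inv_mul_le_iff₀ (norm_pos_iff.2 hp)] at h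
  have hboundr : ∀ p, A e p ≤ ‖p‖ * A e f := by
    intro p
    rcases eq_or_ne p 0 with rfl | hp
    · simp [hAdef]
    · have h := hle _ _ he (hunit p)
      rwa [hsr, inv_mul_le_iff₀ (norm_pos_iff.2 hp)] at h
  have hXv : ∀ p, ((A e f)⁻¹ • (b.coord 1 f • b.coord 0 - b.coord 0 f • b.coord 1)) p
      = A p f / A e f := by
    intro p
    simp only [LinearMap.smul_apply, LinearMap.sub_apply, smul_eq_mul, hAdef]
    ring
  have hYv : ∀ p, ((A e f)⁻¹ • (b.coord 0 e • b.coord 1 - b.coord 1 e • b.coord 0)) p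
      = A e p / A e f := by
    intro p
    simp only [LinearMap.smul_apply, LinearMap.sub_apply, smul_eq_mul, hAdef]
    ring
  refine ⟨e, f, (A e f)⁻¹ • (b.coord 1 f • b.coord 0 - b.coord 0 f • b.coord 1),
    (A e f)⁻¹ • (b.coord 0 e • b.coord 1 - b.coord 1 e • b.coord 0), he, hf, ?_, ?_, ?_⟩
  · intro p
    rw [hXv, hYv]
    apply b.ext_elem
    intro i
    simp only [map_add, map_smul, Finsupp.add_apply, Finsupp.smul_apply, smul_eq_mul]
    rw [div_mul_eq_mul_div, div_mul_eq_mul_div, ← add_div, eq_div_iff hpos.ne']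
    simp only [hAdef, Module.Basis.coord_apply]
    fin_cases i <;> simp <;> ring
  · intro p
    rw [hXv, div_le_iff₀ hpos]
    exact hboundl p
  · intro p
    rw [hYv, div_le_iff₀ hpos]
    exact hboundr p

/-- The unit sphere of a normed plane has length at most `8`. -/
lemma hausdorffMeasure_unitSphere_le {V : Type*} [NormedAddCommGroup V] [NormedSpace ℝ V]
    [MeasurableSpace V] [BorelSpace V] (hdim : Module.finrank ℝ V = 2) :
    μH[(1 : ℝ)] (Metric.sphere (0 : V) 1) ≤ 8 := by
  obtain ⟨e, f, X, Y, he, hf, hXY, hX, hY⟩ := exists_auerbach_basis hdim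
  have hX' : ∀ p, (-X) p ≤ ‖p‖ := fun p => by simpa using hX (-p)
  have hY' : ∀ p, (-Y) p ≤ ‖p‖ := fun p => by simpa using hY (-p)
  have he' : ‖-e‖ ≤ 1 := by rwa [norm_neg]
  have hf' : ‖-f‖ ≤ 1 := by rwa [norm_neg]
  have h1 := hausdorffMeasure_sphere_quadrant_le he hf hXY hX hY
  have h2 := hausdorffMeasure_sphere_quadrant_le he' hf (fun p => by simpa using hXY p) hX' hY
  have h3 := hausdorffMeasure_sphere_quadrant_le he hf' (fun p => by simpa using hXY p) hX hY'
  have h4 := hausdorffMeasure_sphere_quadrant_le he' hf' (fun p => by simpa using hXY p) hX' hY'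
  have hsub : Metric.sphere (0 : V) 1 ⊆
      ({p | ‖p‖ = 1 ∧ 0 ≤ X p ∧ 0 ≤ Y p} ∪ {p | ‖p‖ = 1 ∧ 0 ≤ (-X) p ∧ 0 ≤ Y p}) ∪
      ({p | ‖p‖ = 1 ∧ 0 ≤ X p ∧ 0 ≤ (-Y) p} ∪ {p | ‖p‖ = 1 ∧ 0 ≤ (-X) p ∧ 0 ≤ (-Y) p}) := by
    intro p hp
    have hp1 : ‖p‖ = 1 := by simpa using hp
    simp only [mem_union, mem_ofPred_eq, hp1, true_and, LinearMap.neg_apply, Left.nonneg_neg_iff]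
    rcases le_total 0 (X p) with hx | hx <;> rcases le_total 0 (Y p) with hy | hy <;> simp [hx, hy]
  calc _ ≤ _ := measure_mono hsub
    _ ≤ (2 + 2) + (2 + 2) := (measure_union_le _ _).trans
        (add_le_add ((measure_union_le _ _).trans (add_le_add h1 h2))
          ((measure_union_le _ _).trans (add_le_add h3 h4)))
    _ = 8 := by norm_num

/-- The part of the unit sphere in the open cone spanned by two unit vectors is at least as long
as the chord joining them. -/
lemma norm_sub_le_hausdorffMeasure {V : Type*} [NormedAddCommGroup V] [NormedSpace ℝ V]
    [MeasurableSpace V] [BorelSpace V] {a b : V} (ha : ‖a‖ = 1) (hb : ‖b‖ = 1)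
    (hab : ∀ t ∈ Icc (0 : ℝ) 1, (1 - t) • a + t • b ≠ 0) {S : Set V}
    (hS : ∀ s t : ℝ, 0 < s → 0 < t → ‖s • a + t • b‖ = 1 → s • a + t • b ∈ S) :
    ENNReal.ofReal ‖b - a‖ ≤ μH[(1 : ℝ)] S := by
  let γ : ℝ → V := fun t => ‖(1 - t) • a + t • b‖⁻¹ • ((1 - t) • a + t • b)
  have hγ : ContinuousOn γ (Icc 0 1) := by
    have h : Continuous fun t : ℝ => (1 - t) • a + t • b := by fun_prop
    exact (h.norm.continuousOn.inv₀ fun t ht => norm_ne_zero_iff.2 (hab t ht)).smul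
      h.continuousOn
  have hγS : γ '' Ioo 0 1 ⊆ S := by
    rintro _ ⟨t, ht, rfl⟩
    have h0 := norm_pos_iff.2 (hab t (Ioo_subset_Icc_self ht))
    have ht1 : 0 < 1 - t := sub_pos.2 ht.2
    have ht0 : 0 < t := ht.1
    have heq : γ t = (‖(1 - t) • a + t • b‖⁻¹ * (1 - t)) • a
        + (‖(1 - t) • a + t • b‖⁻¹ * t) • b := by
      simp only [γ, smul_add, smul_smul]
    rw [heq]
    refine hS _ _ (by positivity) (by positivity) ?_
    rw [← heq]
    simp only [γ, norm_smul, norm_inv, norm_norm]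
    exact inv_mul_cancel₀ h0.ne'
  let g : V → ℝ := fun p => ‖p - a‖
  have hg : LipschitzWith 1 g := by
    simpa [g, dist_eq_norm] using LipschitzWith.dist_left a
  have hIoo : Ioo 0 ‖b - a‖ ⊆ g '' S := by
    have h := intermediate_value_Ioo zero_le_one (hg.continuous.comp_continuousOn hγ)
    have h0 : (g ∘ γ) 0 = 0 := by simp [g, γ, ha]
    have h1 : (g ∘ γ) 1 = ‖b - a‖ := by simp [g, γ, hb]
    rw [h0, h1, image_comp] at h
    exact h.trans (image_mono hγS)
  calc ENNReal.ofReal ‖b - a‖ = μH[(1 : ℝ)] (Ioo 0 ‖b - a‖) := by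
        rw [hausdorffMeasure_real, Real.volume_Ioo, sub_zero]
    _ ≤ μH[(1 : ℝ)] (g '' S) := measure_mono hIoo
    _ ≤ μH[(1 : ℝ)] S := by simpa using hg.hausdorffMeasure_image_le (d := 1) zero_le_one S

/-- In a normed plane there are two unit vectors at distance `1` from each other. -/
lemma exists_norm_eq_one_norm_sub_eq_one {V : Type*} [NormedAddCommGroup V] [NormedSpace ℝ V]
    (hdim : Module.finrank ℝ V = 2) : ∃ u v : V, ‖u‖ = 1 ∧ ‖v‖ = 1 ∧ ‖v - u‖ = 1 := by
  have hrank : 1 < Module.rank ℝ V := by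
    exact_mod_cast Module.lt_rank_of_lt_finrank (n := 1) (by omega : 1 < Module.finrank ℝ V)
  have hconn := isConnected_sphere hrank (0 : V) zero_le_one
  obtain ⟨u, hu⟩ := hconn.nonempty
  have hu1 : ‖u‖ = 1 := by simpa using hu
  have hneg : ‖-u - u‖ = 2 := by
    rw [show -u - u = (-2 : ℝ) • u by module, norm_smul, hu1]
    norm_num
  obtain ⟨v, hv, hvu⟩ := hconn.isPreconnected.intermediate_value hu
    (show -u ∈ Metric.sphere (0 : V) 1 by simpa using hu1)
    (f := fun p => ‖p - u‖) (by fun_prop)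
    (show (1 : ℝ) ∈ Icc ‖u - u‖ ‖-u - u‖ by rw [hneg]; simp)
  exact ⟨u, v, hu1, by simpa using hv, hvu⟩

/-- Unit vectors at distance `1` from each other are linearly independent. -/
lemma linearIndependent_of_norm_sub_eq_one {V : Type*} [NormedAddCommGroup V] [NormedSpace ℝ V]
    {u v : V} (hu : ‖u‖ = 1) (hv : ‖v‖ = 1) (huv : ‖v - u‖ = 1) :
    LinearIndependent ℝ ![u, v] := by
  rw [LinearIndependent.pair_iff' (norm_ne_zero_iff.1 (by rw [hu]; exact one_ne_zero))]
  rintro c rfl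
  rw [norm_smul, hu, mul_one, Real.norm_eq_abs] at hv
  rw [show c • u - u = (c - 1) • u by module, norm_smul, hu, mul_one, Real.norm_eq_abs] at huv
  rcases abs_cases c with h | h <;> rcases abs_cases (c - 1) with h' | h' <;> linarith

/-- The unit sphere of a normed plane has length at least `6`. -/
lemma le_hausdorffMeasure_unitSphere {V : Type*} [NormedAddCommGroup V] [NormedSpace ℝ V]
    [MeasurableSpace V] [BorelSpace V] (hdim : Module.finrank ℝ V = 2) :
    6 ≤ μH[(1 : ℝ)] (Metric.sphere (0 : V) 1) := by
  have : Module.Finite ℝ V := Module.finite_of_finrank_pos (by omega)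
  obtain ⟨u, v, hu, hv, huv⟩ := exists_norm_eq_one_norm_sub_eq_one hdim
  have hli := linearIndependent_of_norm_sub_eq_one hu hv huv
  let b := basisOfLinearIndependentOfCardEqFinrank hli (by simp [hdim])
  have hb : ⇑b = ![u, v] := coe_basisOfLinearIndependentOfCardEqFinrank hli _
  have hb0 : b 0 = u := by simp [hb]
  have hb1 : b 1 = v := by simp [hb]
  let X := b.coord 0
  let Y := b.coord 1
  have hXu : X u = 1 := by simp [X, ← hb0]
  have hXv : X v = 0 := by simp [X, ← hb1]
  have hYu : Y u = 0 := by simp [Y, ← hb0]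
  have hYv : Y v = 1 := by simp [Y, ← hb1]
  have hXc : Continuous X := X.continuous_of_finiteDimensional
  have hYc : Continuous Y := Y.continuous_of_finiteDimensional
  let P : Set V := Metric.sphere 0 1 ∩ {p | 0 < Y p}
  let N : Set V := Metric.sphere 0 1 ∩ {p | Y p < 0}
  let P₁ : Set V := Metric.sphere 0 1 ∩ {p | 0 < X p ∧ 0 < Y p}
  let P₂ : Set V := Metric.sphere 0 1 ∩ {p | X p < 0 ∧ 0 < X p + Y p}
  let P₃ : Set V := Metric.sphere 0 1 ∩ {p | X p + Y p < 0 ∧ 0 < Y p}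
  have hP₂m : MeasurableSet P₂ := Metric.isClosed_sphere.measurableSet.inter
    ((isOpen_lt hXc continuous_const).inter
      (isOpen_lt continuous_const (hXc.add hYc))).measurableSet
  have hP₃m : MeasurableSet P₃ := Metric.isClosed_sphere.measurableSet.inter
    ((isOpen_lt (hXc.add hYc) continuous_const).inter
      (isOpen_lt continuous_const hYc)).measurableSet
  have hNm : MeasurableSet N := Metric.isClosed_sphere.measurableSet.inter
    (isOpen_lt hYc continuous_const).measurableSet
  have hP₁ : 1 ≤ μH[(1 : ℝ)] P₁ := by
    have h := norm_sub_le_hausdorffMeasure (S := P₁) hu hv ?_ ?_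
    · rwa [huv, ENNReal.ofReal_one] at h
    · intro t _ h0
      have hx := congrArg X h0
      have hy := congrArg Y h0
      simp [hXu, hXv, hYu, hYv] at hx hy
      linarith
    · intro s t hs ht h
      simp [P₁, h, hXu, hXv, hYu, hYv, hs, ht]
  have hP₂ : 1 ≤ μH[(1 : ℝ)] P₂ := by
    have h := norm_sub_le_hausdorffMeasure (S := P₂) hv huv ?_ ?_
    · rwa [show v - u - v = -u by abel, norm_neg, hu, ENNReal.ofReal_one] at h
    · intro t _ h0
      have hx := congrArg X h0
      have hy := congrArg Y h0
      simp [hXu, hXv, hYu, hYv] at hx hy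
    · intro s t hs ht h
      simp [P₂, h, hXu, hXv, hYu, hYv, hs, ht]
  have hP₃ : 1 ≤ μH[(1 : ℝ)] P₃ := by
    have h := norm_sub_le_hausdorffMeasure (S := P₃) huv (b := -u) (by rwa [norm_neg]) ?_ ?_
    · rwa [show -u - (v - u) = -v by abel, norm_neg, hv, ENNReal.ofReal_one] at h
    · intro t _ h0
      have hx := congrArg X h0
      have hy := congrArg Y h0
      simp [hXu, hXv, hYu, hYv] at hx hy
      linarith
    · intro s t hs ht h
      refine ⟨by simpa using h, ?_⟩
      simp [hXu, hXv, hYu, hYv, hs, ht]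
  have hP : 3 ≤ μH[(1 : ℝ)] P := by
    have hsub : P₁ ∪ P₂ ∪ P₃ ⊆ P := by
      rintro p ((⟨h, h1, h2⟩ | ⟨h, h1, h2⟩) | ⟨h, h1, h2⟩)
      · exact ⟨h, h2⟩
      · exact ⟨h, show 0 < Y p by linarith⟩
      · exact ⟨h, h2⟩
    have hd₁ : Disjoint P₁ P₂ := Set.disjoint_left.2 fun p h h' => lt_asymm h.2.1 h'.2.1
    have hd₂ : Disjoint (P₁ ∪ P₂) P₃ := by
      refine Set.disjoint_left.2 ?_
      rintro p (⟨-, h1, h2⟩ | ⟨-, h1, h2⟩) ⟨-, h3, h4⟩ <;> linarith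
    calc (3 : ENNReal) = 1 + 1 + 1 := by norm_num
      _ ≤ μH[(1 : ℝ)] P₁ + μH[(1 : ℝ)] P₂ + μH[(1 : ℝ)] P₃ := by gcongr
      _ = μH[(1 : ℝ)] (P₁ ∪ P₂ ∪ P₃) := by
        rw [measure_union hd₂ hP₃m, measure_union hd₁ hP₂m]
      _ ≤ μH[(1 : ℝ)] P := measure_mono hsub
  have hN : 3 ≤ μH[(1 : ℝ)] N := by
    have h := (IsometryEquiv.neg V).hausdorffMeasure_preimage 1 P
    have hPN : IsometryEquiv.neg V ⁻¹' P = N := by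
      ext p
      simp [P, N]
    rw [← hPN, h]
    exact hP
  have hd : Disjoint P N := Set.disjoint_left.2 fun p h h' => lt_asymm (mem_ofPred.1 h.2) h'.2
  calc (6 : ENNReal) = 3 + 3 := by norm_num
    _ ≤ μH[(1 : ℝ)] P + μH[(1 : ℝ)] N := by gcongr
    _ = μH[(1 : ℝ)] (P ∪ N) := (measure_union hd hNm).symm
    _ ≤ _ := measure_mono (union_subset inter_subset_left inter_subset_left)

/-- In a two-dimensional normed vector space `(V, ‖·‖)`, there is a constant `6 ≤ c ≤ 8` such
that for every `R > 0` the length (one-dimensional Hausdorff measure with respect to the metric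
induced by the norm) of the sphere of radius `R` centered at the origin equals `c · R`. -/
theorem sphere_length_in_two_dim_normed_space
    (V : Type*) [NormedAddCommGroup V] [NormedSpace ℝ V]
    [MeasurableSpace V] [BorelSpace V]
    (hdim : Module.finrank ℝ V = 2) :
    ∃ c : ℝ, 6 ≤ c ∧ c ≤ 8 ∧
      ∀ R : ℝ, 0 < R →
        μH[(1 : ℝ)] (Metric.sphere (0 : V) R) = ENNReal.ofReal (c * R) := by
  have h6 := le_hausdorffMeasure_unitSphere hdim
  have h8 := hausdorffMeasure_unitSphere_le hdim
  have htop : μH[(1 : ℝ)] (Metric.sphere (0 : V) 1) ≠ ⊤ := ne_top_of_le_ne_top (by simp) h8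
  refine ⟨(μH[(1 : ℝ)] (Metric.sphere (0 : V) 1)).toReal, ?_, ?_, fun R hR => ?_⟩
  · simpa using ENNReal.toReal_mono htop h6
  · simpa using ENNReal.toReal_mono (by simp) h8
  · have hsphere : Metric.sphere (0 : V) R = R • Metric.sphere (0 : V) 1 := by
      rw [smul_sphere' hR.ne', smul_zero, mul_one, Real.norm_of_nonneg hR.le]
    rw [hsphere, Measure.hausdorffMeasure_smul₀ zero_le_one hR.ne', NNReal.rpow_one,
      ENNReal.ofReal_mul ENNReal.toReal_nonneg, ENNReal.ofReal_toReal htop, mul_comm,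
      ENNReal.smul_def, smul_eq_mul, ← enorm_eq_nnnorm, Real.enorm_of_nonneg hR.le]
end
end

section
/- Let P be a convex polygon in ℝ² with exactly n vertices and let (int P, d_P) be its Hilbert geometry. Fix o ∈ int P and let L(R) denote the length (one-dimensional Hausdorff measure with respect to d_P) of the metric sphere of radius R centered at o. Then L(R)/(2nR) → 1 as R → ∞. -/
open Set Filter MeasureTheory

noncomputable section

/-- The planar cross product (determinant) of two vectors. -/
def cross (u v : Euc 2) : ℝ := u 0 * v 1 - u 1 * v 0

theorem cross_add_smul_sub (u x y z : Euc 2) (t : ℝ) :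
    cross u (x + t • (y - x) - z) =
      cross u (x - z) + t * (cross u (y - z) - cross u (x - z)) := by
  simp [cross]; ring

theorem euc_two_ext {x y : Euc 2} (h0 : x 0 = y 0) (h1 : x 1 = y 1) : x = y := by
  ext i; fin_cases i <;> assumption

theorem continuousLinearMap_apply_euc_two (f : Euc 2 →L[ℝ] ℝ) (x : Euc 2) :
    f x = f !₂[1, 0] * x 0 + f !₂[0, 1] * x 1 := by
  have h : x = x 0 • !₂[(1 : ℝ), 0] + x 1 • !₂[(0 : ℝ), 1] := by
    apply euc_two_ext <;> simp
  conv_lhs => rw [h]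
  rw [map_add, map_smul, map_smul, smul_eq_mul, smul_eq_mul]
  ring

/-- Every vertex of a polygon has a counterclockwise successor. -/
theorem exists_successor {n : ℕ} (hn : 3 ≤ n) (p : Fin n → Euc 2)
    (hinj : Function.Injective p)
    (hvert : Set.extremePoints ℝ (convexHull ℝ (Set.range p)) = Set.range p) (i : Fin n) :
    ∃ j, j ≠ i ∧ ∀ k, k ≠ i → k ≠ j → 0 < cross (p j - p i) (p k - p i) := by
  have hnot : p i ∉ convexHull ℝ (p '' {k | k ≠ i}) := by
    intro hmem
    have heq : convexHull ℝ (Set.range p) = convexHull ℝ (p '' {k | k ≠ i}) := by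
      apply Set.Subset.antisymm
      · refine convexHull_min ?_ (convex_convexHull _ _)
        rintro _ ⟨k, rfl⟩
        by_cases hk : k = i
        · exact hk ▸ hmem
        · exact subset_convexHull _ _ ⟨k, hk, rfl⟩
      · exact convexHull_mono (Set.image_subset_range _ _)
    have hi : p i ∈ Set.extremePoints ℝ (convexHull ℝ (Set.range p)) := by
      rw [hvert]; exact ⟨i, rfl⟩
    rw [heq] at hi
    obtain ⟨k, hk, hki⟩ := extremePoints_convexHull_subset hi
    exact hk (hinj hki)
  have hclosed : IsClosed (convexHull ℝ (p '' {k | k ≠ i})) :=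
    ((Set.toFinite _).isCompact_convexHull ℝ).isClosed
  obtain ⟨f, u, hfu, huf⟩ :=
    geometric_hahn_banach_point_closed (convex_convexHull ℝ _) hclosed hnot
  have hpos : ∀ k, k ≠ i → 0 < f (p k - p i) := by
    intro k hk
    have := huf (p k) (subset_convexHull _ _ ⟨k, hk, rfl⟩)
    rw [map_sub]; linarith
  obtain ⟨a, b, hf⟩ : ∃ a b : ℝ, ∀ x, f x = a * x 0 + b * x 1 :=
    ⟨_, _, continuousLinearMap_apply_euc_two f⟩
  have hne : (Finset.univ.erase i).Nonempty := by
    apply Finset.card_pos.mp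
    rw [Finset.card_erase_of_mem (Finset.mem_univ _), Finset.card_univ, Fintype.card_fin]
    omega
  obtain ⟨j, hj, hmin⟩ := Finset.exists_min_image (Finset.univ.erase i)
    (fun k => (-b * (p k - p i) 0 + a * (p k - p i) 1) / f (p k - p i)) hne
  have hji : j ≠ i := (Finset.mem_erase.mp hj).1
  refine ⟨j, hji, fun k hki hkj => ?_⟩
  have hslope := hmin k (Finset.mem_erase.mpr ⟨hki, Finset.mem_univ _⟩)
  have hfj := hpos j hji
  have hfk := hpos k hki
  rw [div_le_div_iff₀ hfj hfk] at hslope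
  have hab : 0 < a ^ 2 + b ^ 2 := by
    by_contra hcon
    have ha : a = 0 := by nlinarith [sq_nonneg a, sq_nonneg b]
    have hb : b = 0 := by nlinarith [sq_nonneg a, sq_nonneg b]
    rw [hf, ha, hb] at hfj
    simp at hfj
  have hnonneg : 0 ≤ cross (p j - p i) (p k - p i) := by
    rw [hf, hf] at hslope
    unfold cross
    by_contra hcon
    push Not at hcon
    nlinarith [mul_neg_of_pos_of_neg hab hcon]
  refine lt_of_le_of_ne hnonneg fun hzero => ?_
  have hext : ∀ l, p l ∈ Set.extremePoints ℝ (convexHull ℝ (Set.range p)) :=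
    by
    intro l; rw [hvert]; exact ⟨l, rfl⟩
  have hprop : ∀ w, f (p k - p i) * (p j - p i) w = f (p j - p i) * (p k - p i) w := by
    rw [hf, hf]
    unfold cross at hzero
    intro w
    fin_cases w
    · simp only [Fin.zero_eta]
      linear_combination -b * hzero
    · simp only [Fin.mk_one]
      linear_combination a * hzero
  have key : ∀ l r, l ≠ i → r ≠ i → l ≠ r →
      (∀ w, f (p r - p i) * (p l - p i) w = f (p l - p i) * (p r - p i) w) →
      f (p l - p i) ≤ f (p r - p i) → False := by
    intro l r hl hr hlr h hle
    have h1 := hpos l hl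
    have h2 := hpos r hr
    have hpl : p i + (f (p l - p i) / f (p r - p i)) • (p r - p i) = p l := by
      ext w
      have := h w
      simp only [PiLp.add_apply, PiLp.smul_apply, PiLp.sub_apply, smul_eq_mul] at this ⊢
      field_simp
      linarith
    rcases hle.lt_or_eq with hlt | heq
    · have hmem : p l ∈ openSegment ℝ (p i) (p r) := by
        rw [openSegment_eq_image']
        exact ⟨_, ⟨by positivity, (div_lt_one h2).mpr hlt⟩, hpl⟩
      exact hl (hinj (((hext l).2 (hext i).1 (hext r).1 hmem)).symm)
    · rw [heq, div_self h2.ne', one_smul, add_sub_cancel] at hpl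
      exact hlr (hinj hpl.symm)
  rcases le_total (f (p j - p i)) (f (p k - p i)) with hle | hle
  · exact key j k hji hki hkj.symm hprop hle
  · exact key k j hki hji hkj (fun w => (hprop w).symm) hle

/-- A system of affine functions `m k` cutting out the open polygon `Ω` with vertices `p k`, where
`m k` vanishes on the edge from `p k` to its successor `p (σ k)`. -/
structure IsFacetSystem {n : ℕ} (Ω : Set (Euc 2)) (p : Fin n → Euc 2) (σ : Equiv.Perm (Fin n))
    (m : Fin n → Euc 2 → ℝ) : Prop where
  affine : ∀ k x y (t : ℝ), m k (x + t • (y - x)) = m k x + t * (m k y - m k x)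
  mem_iff : ∀ x, x ∈ Ω ↔ ∀ k, 0 < m k x
  vertex_self : ∀ k, m k (p k) = 0
  vertex_succ : ∀ k, m k (p (σ k)) = 0
  vertex_pos : ∀ k j, j ≠ k → j ≠ σ k → 0 < m k (p j)
  succ_ne : ∀ k, σ k ≠ k
  succ_succ_ne : ∀ k, σ (σ k) ≠ k
  ray : ∀ x ∈ Ω, ∀ y, y ≠ x → ∃ T : ℝ, 0 < T ∧ ∃ j, ∃ s ∈ Set.Icc (0 : ℝ) 1,
    x + T • (y - x) = p j + s • (p (σ j) - p j)
  exists_lt : ∀ x y, y ≠ x → ∃ k, m k x < m k y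

theorem IsFacetSystem.vertex_nonneg {n : ℕ} {Ω : Set (Euc 2)} {p : Fin n → Euc 2}
    {σ : Equiv.Perm (Fin n)} {m : Fin n → Euc 2 → ℝ} (h : IsFacetSystem Ω p σ m) (k j : Fin n) :
    0 ≤ m k (p j) := by
  by_cases h1 : j = k
  · rw [h1, h.vertex_self]
  · by_cases h2 : j = σ k
    · rw [h2, h.vertex_succ]
    · exact (h.vertex_pos k j h1 h2).le

theorem IsFacetSystem.const_mul {n : ℕ} {Ω : Set (Euc 2)} {p : Fin n → Euc 2}
    {σ : Equiv.Perm (Fin n)} {m : Fin n → Euc 2 → ℝ} (h : IsFacetSystem Ω p σ m)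
    {c : Fin n → ℝ} (hc : ∀ k, 0 < c k) : IsFacetSystem Ω p σ (fun k x => c k * m k x) where
  affine k x y t := by simp only [h.affine]; ring
  mem_iff x := by simp only [h.mem_iff, mul_pos_iff_of_pos_left (hc _)]
  vertex_self k := by simp [h.vertex_self]
  vertex_succ k := by simp [h.vertex_succ]
  vertex_pos k j h1 h2 := mul_pos (hc k) (h.vertex_pos k j h1 h2)
  succ_ne := h.succ_ne
  succ_succ_ne := h.succ_succ_ne
  ray := h.ray
  exists_lt x y hxy := (h.exists_lt x y hxy).imp fun k hk => mul_lt_mul_of_pos_left hk (hc k)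

/-- A direction along which no facet function of a closed polygon increases is zero. -/
theorem exists_facet_increasing {n : ℕ} (p : Fin n → Euc 2) (σ : Equiv.Perm (Fin n)) (k₀ : Fin n)
    (hpos : 0 < cross (p (σ k₀) - p k₀) (p (σ (σ k₀)) - p k₀)) {u : Euc 2} (hu : u ≠ 0) :
    ∃ k, 0 < cross (p (σ k) - p k) u := by
  by_contra! hcon
  have hsum : ∑ k, cross (p (σ k) - p k) u = 0 := by
    have h1 : ∀ w : Fin 2, ∑ k, p (σ k) w = ∑ k, p k w := fun w =>
      Equiv.sum_comp σ fun k => p k w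
    simp only [cross, PiLp.sub_apply, Finset.sum_sub_distrib, ← Finset.sum_mul, h1]
    ring
  have hzero := (Finset.sum_eq_zero_iff_of_nonpos fun k _ => hcon k).mp hsum
  have h1 := hzero k₀ (Finset.mem_univ _)
  have h2 := hzero (σ k₀) (Finset.mem_univ _)
  simp only [cross, PiLp.sub_apply] at h1 h2 hpos
  apply hu
  apply euc_two_ext
  · have : u 0 * ((p (σ k₀) 0 - p k₀ 0) * (p (σ (σ k₀)) 1 - p k₀ 1) -
        (p (σ k₀) 1 - p k₀ 1) * (p (σ (σ k₀)) 0 - p k₀ 0)) = 0 := by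
      linear_combination (p (σ (σ k₀)) 0 - p (σ k₀) 0) * h1 - (p (σ k₀) 0 - p k₀ 0) * h2
    simpa using (mul_eq_zero.mp this).resolve_right hpos.ne'
  · have : u 1 * ((p (σ k₀) 0 - p k₀ 0) * (p (σ (σ k₀)) 1 - p k₀ 1) -
        (p (σ k₀) 1 - p k₀ 1) * (p (σ (σ k₀)) 0 - p k₀ 0)) = 0 := by
      linear_combination (p (σ (σ k₀)) 1 - p (σ k₀) 1) * h1 - (p (σ k₀) 1 - p k₀ 1) * h2
    simpa using (mul_eq_zero.mp this).resolve_right hpos.ne'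

theorem exists_isFacetSystem {n : ℕ} (hn : 3 ≤ n) (p : Fin n → Euc 2)
    (hinj : Function.Injective p)
    (hvert : Set.extremePoints ℝ (convexHull ℝ (Set.range p)) = Set.range p) {o : Euc 2}
    (ho : o ∈ interior (convexHull ℝ (Set.range p))) :
    ∃ σ m, IsFacetSystem (interior (convexHull ℝ (Set.range p))) p σ m ∧ ∀ k, m k o = 1 := by
  suffices ∃ σ m, IsFacetSystem (interior (convexHull ℝ (Set.range p))) p σ m by
    obtain ⟨σ, m, h⟩ := this
    have hpos := (h.mem_iff o).mp ho
    exact ⟨σ, _, h.const_mul fun k => inv_pos.mpr (hpos k), fun k => inv_mul_cancel₀ (hpos k).ne'⟩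
  choose τ hτne hτpos using exists_successor hn p hinj hvert
  have hτinj : Function.Injective τ := by
    intro i k hik
    by_contra hne
    have h1 := hτpos i k (Ne.symm hne) fun h => hτne k (by rw [← hik, ← h])
    have h2 := hτpos k i hne fun h => hτne i (by rw [hik, ← h])
    rw [← hik] at h2
    simp only [cross, PiLp.sub_apply] at h1 h2
    linarith
  have hττ : ∀ k, τ (τ k) ≠ k := by
    intro k hk
    obtain ⟨j, hj⟩ : ∃ j, j ∉ ({k, τ k} : Finset (Fin n)) := by
      by_contra! hall
      have h1 : Finset.univ ⊆ ({k, τ k} : Finset (Fin n)) := fun j _ => hall j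
      have h2 := (Finset.card_le_card h1).trans Finset.card_le_two
      rw [Finset.card_univ, Fintype.card_fin] at h2
      omega
    simp only [Finset.mem_insert, Finset.mem_singleton, not_or] at hj
    have h1 := hτpos k j hj.1 hj.2
    have h2 := hτpos (τ k) j hj.2 (by rw [hk]; exact hj.1)
    rw [hk] at h2
    simp only [cross, PiLp.sub_apply] at h1 h2
    linarith
  obtain ⟨σ, hσ⟩ : ∃ σ : Equiv.Perm (Fin n), ∀ k, σ k = τ k :=
    ⟨Equiv.ofBijective τ (Finite.injective_iff_bijective.mp hτinj), fun _ => rfl⟩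
  simp only [← hσ] at hτne hτpos hττ
  clear hσ hτinj
  obtain ⟨m, hm⟩ : ∃ m : Fin n → Euc 2 → ℝ, ∀ k x, m k x = cross (p (σ k) - p k) (x - p k) :=
    ⟨_, fun _ _ => rfl⟩
  have haff : ∀ k x y (t : ℝ), m k (x + t • (y - x)) = m k x + t * (m k y - m k x) := by
    intro k x y t
    simp only [hm, cross_add_smul_sub]
  have hself : ∀ k, m k (p k) = 0 := by intro k; simp [hm, cross]
  have hsucc : ∀ k, m k (p (σ k)) = 0 := by intro k; simp only [hm, cross]; ring
  have hpos : ∀ k j, j ≠ k → j ≠ σ k → 0 < m k (p j) := fun k j h1 h2 => by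
    rw [hm]; exact hτpos k j h1 h2
  have hcont : ∀ k, Continuous (m k) := by
    intro k
    have : m k = fun x => cross (p (σ k) - p k) (x - p k) := funext (hm k)
    rw [this]; unfold cross; fun_prop
  have hlt : ∀ x y, y ≠ x → ∃ k, m k x < m k y := by
    intro x y hxy
    have k₀ : Fin n := ⟨0, by omega⟩
    obtain ⟨k, hk⟩ := exists_facet_increasing p σ k₀
      (hτpos k₀ _ (hττ k₀) (hτne (σ k₀))) (sub_ne_zero.mpr hxy)
    refine ⟨k, ?_⟩
    rw [hm, hm]
    simp only [cross, PiLp.sub_apply] at hk ⊢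
    linarith
  have hedge : ∀ j z, m j z = 0 → (∀ k, 0 ≤ m k z) →
      ∃ s ∈ Set.Icc (0 : ℝ) 1, z = p j + s • (p (σ j) - p j) := by
    intro j z hz hnn
    obtain ⟨s, hs⟩ : ∃ s : ℝ, z = p j + s • (p (σ j) - p j) := by
      rw [hm] at hz
      simp only [cross, PiLp.sub_apply] at hz
      by_cases h0 : p (σ j) 0 - p j 0 = 0
      · have h1 : p (σ j) 1 - p j 1 ≠ 0 := fun h1 => hτne j
          (hinj (euc_two_ext (sub_eq_zero.mp h0) (sub_eq_zero.mp h1)))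
        refine ⟨(z 1 - p j 1) / (p (σ j) 1 - p j 1), euc_two_ext ?_ ?_⟩
        · simp only [PiLp.add_apply, PiLp.smul_apply, PiLp.sub_apply, smul_eq_mul]
          field_simp
          linarith
        · simp only [PiLp.add_apply, PiLp.smul_apply, PiLp.sub_apply, smul_eq_mul]
          field_simp
          ring
      · refine ⟨(z 0 - p j 0) / (p (σ j) 0 - p j 0), euc_two_ext ?_ ?_⟩
        · simp only [PiLp.add_apply, PiLp.smul_apply, PiLp.sub_apply, smul_eq_mul]
          field_simp
          ring
        · simp only [PiLp.add_apply, PiLp.smul_apply, PiLp.sub_apply, smul_eq_mul]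
          field_simp
          linarith
    refine ⟨s, ⟨?_, ?_⟩, hs⟩
    · have h1 := hnn (σ.symm j)
      have h2 := hpos (σ.symm j) (σ j)
        (fun h => hττ (σ.symm j) (by rw [Equiv.apply_symm_apply, h]))
        (fun h => hτne j (by rw [h, Equiv.apply_symm_apply]))
      have h3 := hsucc (σ.symm j)
      rw [Equiv.apply_symm_apply] at h3
      rw [hs, haff, h3] at h1
      nlinarith
    · have h1 := hnn (σ j)
      have h2 := hpos (σ j) j (hτne j).symm (hττ j).symm
      have h3 := hself (σ j)
      rw [hs, haff, h3] at h1
      nlinarith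
  have hray : ∀ x, (∀ k, 0 < m k x) → ∀ y, y ≠ x → ∃ T : ℝ, 0 < T ∧
      (∀ k, T * (m k x - m k y) ≤ m k x) ∧
      ∃ j, ∃ s ∈ Set.Icc (0 : ℝ) 1, x + T • (y - x) = p j + s • (p (σ j) - p j) := by
    intro x hx y hxy
    have : Nonempty (Fin n) := ⟨⟨0, by omega⟩⟩
    obtain ⟨j, -, hj⟩ := Finset.exists_max_image Finset.univ
      (fun k => (m k x - m k y) / m k x) Finset.univ_nonempty
    have hjpos : 0 < (m j x - m j y) / m j x := by
      obtain ⟨k, hk⟩ := hlt y x hxy.symm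
      exact (div_pos (sub_pos.mpr hk) (hx k)).trans_le (hj k (Finset.mem_univ _))
    have hd : 0 < m j x - m j y := by
      have := mul_pos hjpos (hx j)
      rwa [div_mul_cancel₀ _ (hx j).ne'] at this
    have hle : ∀ k, m j x / (m j x - m j y) * (m k x - m k y) ≤ m k x := by
      intro k
      have h1 := hj k (Finset.mem_univ _)
      rw [div_le_div_iff₀ (hx k) (hx j)] at h1
      rw [div_mul_eq_mul_div, div_le_iff₀ hd]
      linarith
    refine ⟨m j x / (m j x - m j y), div_pos (hx j) hd, hle, j, hedge j _ ?_ ?_⟩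
    · rw [haff]
      field_simp
      ring
    · intro k
      rw [haff]
      linarith [hle k]
  have hvertex : ∀ j, p j ∈ convexHull ℝ (Set.range p) := fun j => subset_convexHull _ _ ⟨j, rfl⟩
  have hconv := convex_convexHull ℝ (Set.range p)
  have hsub : ∀ x ∈ convexHull ℝ (Set.range p), ∀ k, 0 ≤ m k x := by
    intro x hx k
    have hc : Convex ℝ {x | 0 ≤ m k x} := by
      intro a ha b hb s t hs ht hst
      obtain rfl : s = 1 - t := by linarith
      have : (1 - t) • a + t • b = a + t • (b - a) := by module
      rw [Set.mem_ofPred_eq] at ha hb ⊢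
      rw [this, haff]
      nlinarith [mul_nonneg hs ha, mul_nonneg ht hb]
    refine convexHull_min ?_ hc hx
    rintro _ ⟨j, rfl⟩
    rw [Set.mem_ofPred_eq]
    by_cases h1 : j = k
    · rw [h1, hself]
    · by_cases h2 : j = σ k
      · rw [h2, hsucc]
      · exact (hpos k j h1 h2).le
  have hint : ∀ x ∈ interior (convexHull ℝ (Set.range p)), ∀ k, 0 < m k x := by
    intro x hx k
    obtain ⟨c, hc⟩ : ∃ c, 0 < m k c := ⟨p (σ (σ k)), hpos k _ (hττ k) (hτne (σ k))⟩
    have hcts : ContinuousAt (fun t : ℝ => x + t • (c - x)) 0 := by fun_prop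
    have hev : ∀ᶠ t : ℝ in nhds 0, x + t • (c - x) ∈ convexHull ℝ (Set.range p) := by
      apply hcts.eventually_mem
      simpa using mem_interior_iff_mem_nhds.mp hx
    have hev2 := hev.filter_mono (nhdsWithin_le_nhds (s := Set.Iio 0))
    obtain ⟨t, ht, htneg⟩ := (hev2.and self_mem_nhdsWithin).exists
    have h1 := hsub _ ht k
    have h2 := hsub _ (interior_subset hx) k
    rw [haff] at h1
    have htneg : t < 0 := htneg
    nlinarith [mul_pos (neg_pos.mpr htneg) hc]
  have hsub' : ∀ x, (∀ k, 0 < m k x) → x ∈ convexHull ℝ (Set.range p) := by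
    intro x hx
    by_cases hxo : x = o
    · exact hxo ▸ interior_subset ho
    obtain ⟨T, hT, hle, j, s, hs, hz⟩ := hray o (hint o ho) x hxo
    have hzmem : o + T • (x - o) ∈ convexHull ℝ (Set.range p) := by
      rw [hz]
      exact hconv.add_smul_sub_mem (hvertex _) (hvertex _) hs
    have hT1 : 1 ≤ T := by
      by_contra! hT1
      have hzero : m j (o + T • (x - o)) = 0 := by rw [hz, haff, hself, hsucc]; ring
      rw [haff] at hzero
      nlinarith [mul_pos hT (hx j), mul_pos (sub_pos.mpr hT1) (hint o ho j)]
    have hx' : x = o + T⁻¹ • ((o + T • (x - o)) - o) := by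
      rw [add_sub_cancel_left, smul_smul, inv_mul_cancel₀ hT.ne', one_smul, add_sub_cancel]
    rw [hx']
    exact hconv.add_smul_sub_mem (interior_subset ho) hzmem
      ⟨(inv_pos.mpr hT).le, inv_le_one_of_one_le₀ hT1⟩
  have hiff : ∀ x, x ∈ interior (convexHull ℝ (Set.range p)) ↔ ∀ k, 0 < m k x := by
    refine fun x => ⟨hint x, fun hx => ?_⟩
    have hopen : IsOpen {x | ∀ k, 0 < m k x} := by
      rw [Set.ofPred_forall]
      exact isOpen_iInter_of_finite fun k => isOpen_lt continuous_const (hcont k)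
    exact interior_maximal hsub' hopen hx
  exact ⟨σ, m, haff, hiff, hself, hsucc, hpos, hτne, hττ, fun x hx y hxy => by
    obtain ⟨T, hT, -, h⟩ := hray x (hint x hx) y hxy
    exact ⟨T, hT, h⟩, hlt⟩

section HilbertDistance

variable {n : ℕ} {Ω : Set (Euc 2)} {p : Fin n → Euc 2} {σ : Equiv.Perm (Fin n)}
  {m : Fin n → Euc 2 → ℝ}

theorem IsFacetSystem.edge_self (h : IsFacetSystem Ω p σ m) (j : Fin n) (s : ℝ) :
    m j (p j + s • (p (σ j) - p j)) = 0 := by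
  rw [h.affine, h.vertex_self, h.vertex_succ]; ring

theorem IsFacetSystem.edge_nonneg (h : IsFacetSystem Ω p σ m) (j k : Fin n) {s : ℝ}
    (hs : s ∈ Set.Icc (0 : ℝ) 1) : 0 ≤ m k (p j + s • (p (σ j) - p j)) := by
  rw [h.affine]
  nlinarith [mul_nonneg hs.1 (h.vertex_nonneg k (σ j)),
    mul_nonneg (sub_nonneg.mpr hs.2) (h.vertex_nonneg k j)]

theorem IsFacetSystem.edge_mem_frontier (h : IsFacetSystem Ω p σ m) {x : Euc 2} (hx : x ∈ Ω)
    (j : Fin n) {s : ℝ} (hs : s ∈ Set.Icc (0 : ℝ) 1) :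
    p j + s • (p (σ j) - p j) ∈ frontier Ω := by
  constructor
  · have hsub : openSegment ℝ x (p j + s • (p (σ j) - p j)) ⊆ Ω := by
      rw [openSegment_eq_image']
      rintro _ ⟨t, ht, rfl⟩
      rw [h.mem_iff]
      intro k
      simp only [h.affine k x]
      nlinarith [mul_nonneg ht.1.le (h.edge_nonneg j k hs),
        mul_pos (sub_pos.mpr ht.2) ((h.mem_iff x).mp hx k)]
    exact closure_mono hsub (segment_subset_closure_openSegment (right_mem_segment ℝ _ _))
  · intro hmem
    have := (h.mem_iff _).mp (interior_subset hmem) j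
    rw [h.edge_self] at this
    exact this.false

theorem IsFacetSystem.one_lt_of_ray (h : IsFacetSystem Ω p σ m) {x y : Euc 2} (hx : x ∈ Ω)
    (hy : y ∈ Ω) {T s : ℝ} (hT : 0 < T) {j : Fin n}
    (hz : x + T • (y - x) = p j + s • (p (σ j) - p j)) : 1 < T := by
  by_contra! hT1
  have h0 := h.edge_self j s
  rw [← hz, h.affine] at h0
  nlinarith [mul_nonneg (sub_nonneg.mpr hT1) ((h.mem_iff x).mp hx j).le,
    mul_pos hT ((h.mem_iff y).mp hy j)]

/-- The Hilbert distance of a polygon is half the logarithmic oscillation of the ratios of its facet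
functions. -/
theorem IsFacetSystem.exists_hilbertDist_eq (h : IsFacetSystem Ω p σ m) {d : Euc 2 → Euc 2 → ℝ}
    (hd : IsHilbertDist Ω d) {x y : Euc 2} (hx : x ∈ Ω) (hy : y ∈ Ω) :
    ∃ i j, d x y = 1 / 2 * (Real.log (m i y / m i x) - Real.log (m j y / m j x)) ∧
      ∀ k, m k y / m k x ≤ m i y / m i x ∧ m j y / m j x ≤ m k y / m k x := by
  have hxpos := (h.mem_iff x).mp hx
  have hypos := (h.mem_iff y).mp hy
  by_cases hxy : y = x
  · subst hxy
    obtain ⟨k, -⟩ := h.exists_lt y (y + !₂[1, 0]) (by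
      intro h0
      have := congrArg (fun z : Euc 2 => z 0) h0
      simp at this)
    refine ⟨k, k, ?_, fun l => ?_⟩
    · rw [hd.1 y hy]; ring
    · rw [div_self (hypos l).ne', div_self (hypos k).ne']
      exact ⟨le_rfl, le_rfl⟩
  obtain ⟨t, ht, j, s, hs, hb⟩ := h.ray x hx y hxy
  obtain ⟨t', ht', i, s', hs', ha⟩ := h.ray x hx (x + (x - y)) (by
    rw [Ne, add_eq_left, sub_eq_zero]; exact Ne.symm hxy)
  have ht1 := h.one_lt_of_ray hx hy ht hb
  have ha' : x + t' • (x + (x - y) - x) = x + (-t') • (y - x) := by module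
  rw [ha'] at ha
  have hdist := hd.2 x hx y hy (Ne.symm hxy) _ _ (ha ▸ h.edge_mem_frontier hx i hs')
    (hb ▸ h.edge_mem_frontier hx j hs) ⟨-t', t, by linarith, ht1, rfl, rfl⟩
  have e1 : y - (x + (-t') • (y - x)) = (1 + t') • (y - x) := by module
  have e2 : x - (x + (-t') • (y - x)) = t' • (y - x) := by module
  have e3 : x - (x + t • (y - x)) = (-t) • (y - x) := by module
  have e4 : y - (x + t • (y - x)) = (-(t - 1)) • (y - x) := by module
  have hnorm : 0 < ‖y - x‖ := norm_pos_iff.mpr (sub_ne_zero.mpr hxy)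
  rw [e1, e2, e3, e4, norm_smul, norm_smul, norm_smul, norm_smul, norm_neg, norm_neg,
    Real.norm_of_nonneg (by linarith : 0 ≤ 1 + t'), Real.norm_of_nonneg ht'.le,
    Real.norm_of_nonneg ht.le, Real.norm_of_nonneg (by linarith : 0 ≤ t - 1),
    mul_div_mul_right _ _ hnorm.ne', mul_div_mul_right _ _ hnorm.ne'] at hdist
  have hai := h.edge_self i s'
  have hbj := h.edge_self j s
  rw [← ha, h.affine] at hai
  rw [← hb, h.affine] at hbj
  have hri : m i y / m i x = (1 + t') / t' := by
    rw [div_eq_div_iff (hxpos i).ne' ht'.ne']; linarith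
  have hrj : m j y / m j x = (t - 1) / t := by
    rw [div_eq_div_iff (hxpos j).ne' ht.ne']; linarith
  refine ⟨i, j, ?_, fun k => ⟨?_, ?_⟩⟩
  · have h1 : 0 < t - 1 := by linarith
    rw [hdist, hri, hrj, ← Real.log_div (by positivity) (by positivity)]
    congr 2
    field_simp
  · have hak := h.edge_nonneg i k hs'
    rw [← ha, h.affine] at hak
    rw [hri, div_le_div_iff₀ (hxpos k) ht']; linarith
  · have hbk := h.edge_nonneg j k hs
    rw [← hb, h.affine] at hbk
    rw [hrj, div_le_div_iff₀ ht (hxpos k)]; linarith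

end HilbertDistance

section Sphere

variable {n : ℕ} {Ω : Set (Euc 2)} {p : Fin n → Euc 2} {σ : Equiv.Perm (Fin n)}
  {m : Fin n → Euc 2 → ℝ} {d : Euc 2 → Euc 2 → ℝ} {X : Type} [MetricSpace X] {φ : X → Euc 2}

theorem IsFacetSystem.exists_dist_eq (h : IsFacetSystem Ω p σ m) (hd : IsHilbertDist Ω d)
    (hφ : Set.BijOn φ Set.univ Ω) (hdist : ∀ x y : X, dist x y = d (φ x) (φ y)) (x y : X) :
    ∃ i j, dist x y = 1 / 2 * (Real.log (m i (φ y) / m i (φ x)) -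
        Real.log (m j (φ y) / m j (φ x))) ∧
      ∀ k, m k (φ y) / m k (φ x) ≤ m i (φ y) / m i (φ x) ∧
        m j (φ y) / m j (φ x) ≤ m k (φ y) / m k (φ x) := by
  rw [hdist]
  exact h.exists_hilbertDist_eq hd (hφ.mapsTo (Set.mem_univ x)) (hφ.mapsTo (Set.mem_univ y))

theorem IsFacetSystem.half_log_sub_log_le_dist (h : IsFacetSystem Ω p σ m)
    (hd : IsHilbertDist Ω d) (hφ : Set.BijOn φ Set.univ Ω)
    (hdist : ∀ x y : X, dist x y = d (φ x) (φ y)) (x y : X) (k l : Fin n) :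
    1 / 2 * (Real.log (m k (φ y) / m k (φ x)) - Real.log (m l (φ y) / m l (φ x))) ≤
      dist x y := by
  have hpos : ∀ x k, 0 < m k (φ x) := fun x => (h.mem_iff _).mp (hφ.mapsTo (Set.mem_univ x))
  obtain ⟨i, j, hij, hle⟩ := h.exists_dist_eq hd hφ hdist x y
  rw [hij]
  have h1 := Real.log_le_log (div_pos (hpos y k) (hpos x k)) (hle k).1
  have h2 := Real.log_le_log (div_pos (hpos y j) (hpos x j)) (hle l).2
  linarith

/-- If the facet functions equal `1` at `o` then the distance from `o` to a point is determined by
the largest and smallest values of the facet functions there. -/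
theorem IsFacetSystem.dist_eq_of_isMax_isMin (h : IsFacetSystem Ω p σ m)
    (hd : IsHilbertDist Ω d) (hφ : Set.BijOn φ Set.univ Ω)
    (hdist : ∀ x y : X, dist x y = d (φ x) (φ y)) {o y : X} (ho : ∀ k, m k (φ o) = 1)
    {i j : Fin n} (hi : ∀ k, m k (φ y) ≤ m i (φ y)) (hj : ∀ k, m j (φ y) ≤ m k (φ y)) :
    dist o y = 1 / 2 * Real.log (m i (φ y) / m j (φ y)) := by
  have hpos : ∀ x k, 0 < m k (φ x) := fun x => (h.mem_iff _).mp (hφ.mapsTo (Set.mem_univ x))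
  obtain ⟨i', j', hij, hle⟩ := h.exists_dist_eq hd hφ hdist o y
  simp only [ho, div_one] at hij hle
  rw [hij, le_antisymm (hi i') (hle i).1, le_antisymm (hle j).2 (hj j'),
    Real.log_div (hpos y i).ne' (hpos y j).ne']

/-- Metric spheres in a polygonal Hilbert geometry are radial images of the boundary edges. -/
theorem IsFacetSystem.exists_sphere_param (h : IsFacetSystem Ω p σ m) (hd : IsHilbertDist Ω d)
    (hφ : Set.BijOn φ Set.univ Ω) (hdist : ∀ x y : X, dist x y = d (φ x) (φ y)) {o : X}
    (ho : ∀ k, m k (φ o) = 1) {K : ℝ} (hK : 0 < K) :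
    ∃ (γ : Fin n → ℝ → X) (M : Fin n → ℝ → ℝ),
      (∀ j, ∀ s ∈ Set.Icc (0 : ℝ) 1, 1 ≤ M j s ∧
        (∀ k, m k (p j) + s * (m k (p (σ j)) - m k (p j)) ≤ M j s) ∧
        (∃ k, m k (p j) + s * (m k (p (σ j)) - m k (p j)) = M j s) ∧
        ∀ k, m k (φ (γ j s)) =
          (M j s + K * (m k (p j) + s * (m k (p (σ j)) - m k (p j)))) / (K + M j s)) ∧
      Metric.sphere o (1 / 2 * Real.log (1 + K)) = ⋃ j, γ j '' Set.Icc 0 1 := by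
  have hoΩ : φ o ∈ Ω := hφ.mapsTo (Set.mem_univ o)
  have hpos : ∀ x k, 0 < m k (φ x) := fun x => (h.mem_iff _).mp (hφ.mapsTo (Set.mem_univ x))
  have hparam : ∀ j s, ∃ (y : X) (M : ℝ), s ∈ Set.Icc (0 : ℝ) 1 → 1 ≤ M ∧
      (∀ k, m k (p j + s • (p (σ j) - p j)) ≤ M) ∧
      (∃ k, m k (p j + s • (p (σ j) - p j)) = M) ∧
      φ y = φ o + (K / (K + M)) • ((p j + s • (p (σ j) - p j)) - φ o) := by
    intro j s
    by_cases hs : s ∈ Set.Icc (0 : ℝ) 1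
    swap
    · exact ⟨o, 0, fun h => absurd h hs⟩
    have : Nonempty (Fin n) := ⟨j⟩
    obtain ⟨i, -, hi⟩ := Finset.exists_max_image Finset.univ
      (fun k => m k (p j + s • (p (σ j) - p j))) Finset.univ_nonempty
    have hzo : p j + s • (p (σ j) - p j) ≠ φ o := by
      intro heq
      have := h.edge_self j s
      rw [heq, ho] at this
      exact one_ne_zero this
    have hM : 1 ≤ m i (p j + s • (p (σ j) - p j)) := by
      obtain ⟨k, hk⟩ := h.exists_lt _ _ hzo
      rw [ho] at hk
      exact hk.le.trans (hi k (Finset.mem_univ _))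
    have hmem : φ o + (K / (K + m i (p j + s • (p (σ j) - p j)))) •
        ((p j + s • (p (σ j) - p j)) - φ o) ∈ Ω := by
      rw [h.mem_iff]
      intro k
      have := h.edge_nonneg j k hs
      have hKM : 0 < K + m i (p j + s • (p (σ j) - p j)) := by linarith
      rw [h.affine, ho]
      have : 1 + K / (K + m i (p j + s • (p (σ j) - p j))) *
          (m k (p j + s • (p (σ j) - p j)) - 1) = (m i (p j + s • (p (σ j) - p j)) +
            K * m k (p j + s • (p (σ j) - p j))) / (K + m i (p j + s • (p (σ j) - p j))) := by
        field_simp; ring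
      rw [this]
      positivity
    obtain ⟨y, -, hy⟩ := hφ.surjOn hmem
    exact ⟨y, _, fun _ => ⟨hM, fun k => hi k (Finset.mem_univ _), ⟨i, rfl⟩, hy⟩⟩
  choose γ M hγ using hparam
  have hval : ∀ j, ∀ s ∈ Set.Icc (0 : ℝ) 1, ∀ k, m k (φ (γ j s)) =
      (M j s + K * m k (p j + s • (p (σ j) - p j))) / (K + M j s) := by
    intro j s hs k
    obtain ⟨h1, -, -, h4⟩ := hγ j s hs
    have : 0 < K + M j s := by linarith
    rw [h4, h.affine, ho]
    field_simp; ring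
  refine ⟨γ, M, fun j s hs => ?_, ?_⟩
  · obtain ⟨h1, h2, h3, -⟩ := hγ j s hs
    have h4 := hval j s hs
    simp only [h.affine] at h2 h3 h4
    exact ⟨h1, h2, h3, h4⟩
  have hRpos : 0 < 1 / 2 * Real.log (1 + K) := by
    have := Real.log_pos (show 1 < 1 + K by linarith)
    positivity
  ext y
  simp only [Set.mem_iUnion, Set.mem_image, Metric.mem_sphere']
  constructor
  · intro hy
    have hne : φ y ≠ φ o := by
      intro heq
      rw [hφ.injOn (Set.mem_univ _) (Set.mem_univ _) heq, dist_self] at hy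
      exact hRpos.ne hy
    obtain ⟨T, hT, j, s, hs, hz⟩ := h.ray _ hoΩ _ hne
    have hT1 := h.one_lt_of_ray hoΩ (hφ.mapsTo (Set.mem_univ y)) hT hz
    obtain ⟨h1, h2, ⟨i, h3⟩, h4⟩ := hγ j s hs
    have hyval : ∀ k, m k (φ y) = 1 + (m k (p j + s • (p (σ j) - p j)) - 1) / T := by
      intro k
      rw [← hz, h.affine, ho]
      field_simp; ring
    have hj0 := h.edge_self j s
    have hdy := h.dist_eq_of_isMax_isMin hd hφ hdist ho (i := i) (j := j) (y := y)
      (fun k => by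
        rw [hyval, hyval, h3]; gcongr; exact h2 k)
      (fun k => by
        rw [hyval, hyval, hj0]; gcongr; exact h.edge_nonneg j k hs)
    rw [hy] at hdy
    have hlog : Real.log (1 + K) = Real.log (m i (φ y) / m j (φ y)) := by linarith
    have heq := Real.log_injOn_pos (show (0 : ℝ) < 1 + K by linarith)
      (div_pos (hpos y i) (hpos y j)) hlog
    rw [eq_div_iff (hpos y j).ne', hyval, hyval, hj0, h3] at heq
    have hKT : K / (K + M j s) = T⁻¹ := by
      have : 0 < K + M j s := by linarith
      field_simp at heq ⊢
      linarith
    refine ⟨j, s, hs, hφ.injOn (Set.mem_univ _) (Set.mem_univ _) ?_⟩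
    rw [h4, hKT, ← hz, add_sub_cancel_left, smul_smul, inv_mul_cancel₀ hT.ne', one_smul,
      add_sub_cancel]
  · rintro ⟨j, s, hs, rfl⟩
    obtain ⟨h1, h2, ⟨i, h3⟩, -⟩ := hγ j s hs
    have hKM : 0 < K + M j s := by linarith
    have hM : 0 < M j s := by linarith
    have hj0 := h.edge_self j s
    rw [h.dist_eq_of_isMax_isMin hd hφ hdist ho (i := i) (j := j)
      (fun k => by
        rw [hval j s hs, hval j s hs, h3]; gcongr; exact h2 k)
      (fun k => by
        rw [hval j s hs, hval j s hs, hj0]; gcongr; exact h.edge_nonneg j k hs),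
      hval j s hs, hval j s hs, hj0, h3]
    congr 2
    field_simp
    ring

end Sphere

/-- A curve whose increments are dominated by those of `F` has length at most `F 1 - F 0`. -/
theorem hausdorffMeasure_image_Icc_le {X : Type*} [MetricSpace X] [MeasurableSpace X]
    [BorelSpace X] {γ : ℝ → X} {F : ℝ → ℝ} (hF : StrictMonoOn F (Set.Icc 0 1))
    (hγ : ∀ s ∈ Set.Icc (0 : ℝ) 1, ∀ t ∈ Set.Icc (0 : ℝ) 1, s < t →
      dist (γ s) (γ t) ≤ F t - F s) :
    μH[(1 : ℝ)] (γ '' Set.Icc 0 1) ≤ ENNReal.ofReal (F 1 - F 0) := by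
  have hinv : Set.LeftInvOn (Function.invFunOn F (Set.Icc 0 1)) F (Set.Icc 0 1) :=
    hF.injOn.leftInvOn_invFunOn
  have hdist : ∀ s ∈ Set.Icc (0 : ℝ) 1, ∀ t ∈ Set.Icc (0 : ℝ) 1,
      dist (γ s) (γ t) ≤ dist (F s) (F t) := by
    intro s hs t ht
    rcases lt_trichotomy s t with hst | rfl | hst
    · rw [dist_comm (F s), Real.dist_eq]
      exact (hγ s hs t ht hst).trans (le_abs_self _)
    · simp
    · rw [dist_comm (γ s), Real.dist_eq]
      exact (hγ t ht s hs hst).trans (le_abs_self _)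
  have hlip : LipschitzOnWith 1 (γ ∘ Function.invFunOn F (Set.Icc 0 1)) (F '' Set.Icc 0 1) := by
    apply LipschitzOnWith.of_dist_le_mul
    rintro _ ⟨s, hs, rfl⟩ _ ⟨t, ht, rfl⟩
    simp only [Function.comp_apply, hinv hs, hinv ht, NNReal.coe_one, one_mul]
    exact hdist s hs t ht
  have himage : γ '' Set.Icc 0 1 =
      (γ ∘ Function.invFunOn F (Set.Icc 0 1)) '' (F '' Set.Icc 0 1) := by
    rw [Set.image_image]
    exact Set.image_congr fun s hs => by simp only [Function.comp_apply, hinv hs]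
  have hsub : F '' Set.Icc 0 1 ⊆ Set.Icc (F 0) (F 1) :=
    hF.monotoneOn.image_Icc_subset
  calc μH[(1 : ℝ)] (γ '' Set.Icc 0 1)
      ≤ μH[(1 : ℝ)] (F '' Set.Icc 0 1) := by
        rw [himage]
        simpa using hlip.hausdorffMeasure_image_le zero_le_one
    _ = volume (F '' Set.Icc 0 1) := by rw [hausdorffMeasure_real]
    _ ≤ volume (Set.Icc (F 0) (F 1)) := measure_mono hsub
    _ = ENNReal.ofReal (F 1 - F 0) := Real.volume_Icc

theorem log_increment_le {M M' K B α β s t : ℝ} (hM : 1 ≤ M) (hM' : 1 ≤ M')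
    (hK : 0 < K) (hα : 0 ≤ α) (hβ : 0 ≤ β) (hβB : β ≤ B) (hs : 0 ≤ s) (hst : s ≤ t)
    (ht : t ≤ 1) (hMM : M' ≤ M + B * (t - s)) :
    Real.log (M' + K * (α + t * (β - α))) - Real.log (M + K * (α + s * (β - α))) ≤
      B * (t - s) + (Real.log (1 + K * B * t) - Real.log (1 + K * B * s)) := by
  have hB : 0 ≤ B := hβ.trans hβB
  have hΔ : 0 ≤ t - s := sub_nonneg.mpr hst
  have hval : ∀ r, 0 ≤ r → r ≤ 1 → 0 ≤ α + r * (β - α) := fun r h0 h1 => by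
    nlinarith [mul_nonneg h0 hβ, mul_nonneg (sub_nonneg.mpr h1) hα]
  have hvs := hval s hs (hst.trans ht)
  have hvt := hval t (hs.trans hst) ht
  have h1 : M' + K * (α + t * (β - α)) ≤
      (M + K * (α + t * (β - α))) * (1 + B * (t - s)) := by
    nlinarith [mul_nonneg (mul_nonneg hK.le hvt) (mul_nonneg hB hΔ),
      mul_nonneg (sub_nonneg.mpr hM) (mul_nonneg hB hΔ)]
  have h2 : (M + K * (α + t * (β - α))) * (1 + K * B * s) ≤
      (M + K * (α + s * (β - α))) * (1 + K * B * t) := by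
    have hMB : 0 ≤ M * B - (β - α) := by nlinarith
    nlinarith [mul_nonneg (mul_nonneg hK.le hΔ) hMB,
      mul_nonneg (mul_nonneg (mul_nonneg hK.le hK.le) (mul_nonneg hB hα)) hΔ]
  have p0 : 0 < M' + K * (α + t * (β - α)) := by positivity
  have p1 : 0 < M + K * (α + t * (β - α)) := by positivity
  have p2 : 0 < 1 + B * (t - s) := by positivity
  have p3 : 0 < 1 + K * B * s := by positivity
  have p4 : 0 < M + K * (α + s * (β - α)) := by positivity
  have p5 : 0 < 1 + K * B * t := by have := hs.trans hst; positivity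
  have l1 := Real.log_le_log p0 h1
  have l2 := Real.log_le_log (mul_pos p1 p3) h2
  rw [Real.log_mul p1.ne' p2.ne'] at l1
  rw [Real.log_mul p1.ne' p3.ne', Real.log_mul p4.ne' p5.ne'] at l2
  have l3 := Real.log_le_sub_one_of_pos p2
  linarith

section Length

variable {n : ℕ} {Ω : Set (Euc 2)} {p : Fin n → Euc 2} {σ : Equiv.Perm (Fin n)}
  {m : Fin n → Euc 2 → ℝ} {d : Euc 2 → Euc 2 → ℝ} {X : Type} [MetricSpace X] {φ : X → Euc 2}

theorem IsFacetSystem.max_le_add (h : IsFacetSystem Ω p σ m) {B : ℝ}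
    (hB : ∀ k j, m k (p j) ≤ B) {j : Fin n} {M : ℝ → ℝ}
    (hle : ∀ s ∈ Set.Icc (0 : ℝ) 1,
      ∀ k, m k (p j) + s * (m k (p (σ j)) - m k (p j)) ≤ M s)
    (heq : ∀ s ∈ Set.Icc (0 : ℝ) 1,
      ∃ k, m k (p j) + s * (m k (p (σ j)) - m k (p j)) = M s)
    {s t : ℝ} (hs : s ∈ Set.Icc (0 : ℝ) 1) (ht : t ∈ Set.Icc (0 : ℝ) 1) :
    M s ≤ M t + B * |s - t| := by
  obtain ⟨k, hk⟩ := heq s hs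
  have h1 := hle t ht k
  have h2 : (s - t) * (m k (p (σ j)) - m k (p j)) ≤ |s - t| * B := by
    refine (le_abs_self _).trans ?_
    rw [abs_mul]
    gcongr
    rw [abs_le]
    constructor <;> linarith [hB k j, hB k (σ j), h.vertex_nonneg k j, h.vertex_nonneg k (σ j)]
  rw [← hk]
  linarith

variable [MeasurableSpace X] [BorelSpace X]

theorem IsFacetSystem.hausdorffMeasure_sphere_le (h : IsFacetSystem Ω p σ m)
    (hd : IsHilbertDist Ω d) (hφ : Set.BijOn φ Set.univ Ω)
    (hdist : ∀ x y : X, dist x y = d (φ x) (φ y)) {o : X} (ho : ∀ k, m k (φ o) = 1) {B : ℝ}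
    (hB1 : 1 ≤ B) (hB : ∀ k j, m k (p j) ≤ B) {K : ℝ} (hK : 0 < K) :
    μH[(1 : ℝ)] (Metric.sphere o (1 / 2 * Real.log (1 + K))) ≤
      n * ENNReal.ofReal (B + Real.log (1 + K * B)) := by
  obtain ⟨γ, M, hγ, hsphere⟩ := h.exists_sphere_param hd hφ hdist ho hK
  have hpos : ∀ x k, 0 < m k (φ x) := fun x => (h.mem_iff _).mp (hφ.mapsTo (Set.mem_univ x))
  suffices hedge : ∀ j, μH[(1 : ℝ)] (γ j '' Set.Icc 0 1) ≤
      ENNReal.ofReal (B + Real.log (1 + K * B)) by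
    rw [hsphere]
    refine (measure_iUnion_le _).trans ?_
    rw [tsum_fintype]
    refine (Finset.sum_le_card_nsmul _ _ _ fun j _ => hedge j).trans ?_
    simp
  intro j
  have hB0 : 0 < B := by linarith
  have hMlip : ∀ {s t}, s ∈ Set.Icc (0 : ℝ) 1 → t ∈ Set.Icc (0 : ℝ) 1 →
      M j s ≤ M j t + B * |s - t| :=
    h.max_le_add hB (fun s hs => (hγ j s hs).2.1) (fun s hs => (hγ j s hs).2.2.1)
  set F : ℝ → ℝ := fun s => B * s + 1 / 2 * (Real.log (1 + K * B * s) -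
    Real.log (1 + K * B * (1 - s))) with hFdef
  have hF : F 1 - F 0 = B + Real.log (1 + K * B) := by
    simp only [hFdef, sub_zero, sub_self, mul_zero, add_zero, Real.log_one, mul_one]
    ring
  rw [← hF]
  apply hausdorffMeasure_image_Icc_le
  · intro s hs t ht hst
    have h0 : 0 ≤ s := hs.1
    have h1 : 0 ≤ 1 - t := sub_nonneg.mpr ht.2
    have l1 : Real.log (1 + K * B * s) ≤ Real.log (1 + K * B * t) :=
      Real.log_le_log (by positivity) (by gcongr)
    have l2 : Real.log (1 + K * B * (1 - t)) ≤ Real.log (1 + K * B * (1 - s)) :=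
      Real.log_le_log (by positivity) (by gcongr)
    have l3 : B * s < B * t := mul_lt_mul_of_pos_left hst hB0
    simp only [hFdef]
    linarith
  · intro s hs t ht hst
    obtain ⟨a, b, hab, -⟩ := h.exists_dist_eq hd hφ hdist (γ j s) (γ j t)
    obtain ⟨hMs, -, -, hvs⟩ := hγ j s hs
    obtain ⟨hMt, -, -, hvt⟩ := hγ j t ht
    have hl : ∀ r ∈ Set.Icc (0 : ℝ) 1, ∀ k,
        0 < M j r + K * (m k (p j) + r * (m k (p (σ j)) - m k (p j))) := by
      intro r hr k
      have h1 := h.edge_nonneg j k hr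
      rw [h.affine] at h1
      have := (hγ j r hr).1
      positivity
    have hratio : ∀ k, Real.log (m k (φ (γ j t)) / m k (φ (γ j s))) =
        Real.log (M j t + K * (m k (p j) + t * (m k (p (σ j)) - m k (p j)))) -
        Real.log (M j s + K * (m k (p j) + s * (m k (p (σ j)) - m k (p j)))) +
        (Real.log (K + M j s) - Real.log (K + M j t)) := by
      intro k
      rw [Real.log_div (hpos _ k).ne' (hpos _ k).ne', hvs, hvt,
        Real.log_div (hl t ht k).ne' (by positivity),
        Real.log_div (hl s hs k).ne' (by positivity)]
      ring
    have ha := log_increment_le hMs hMt hK (h.vertex_nonneg a j) (h.vertex_nonneg a (σ j))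
      (hB a (σ j)) hs.1 hst.le ht.2 (by
        have := hMlip ht hs
        rwa [abs_of_pos (sub_pos.mpr hst)] at this)
    have hb := log_increment_le (s := 1 - t) (t := 1 - s) hMt hMs hK (h.vertex_nonneg b (σ j))
      (h.vertex_nonneg b j) (hB b j) (sub_nonneg.mpr ht.2) (by linarith) (by linarith [hs.1]) (by
        have := hMlip hs ht
        rw [abs_of_neg (sub_neg.mpr hst)] at this
        linarith)
    have e1 : ∀ r, m b (p (σ j)) + (1 - r) * (m b (p j) - m b (p (σ j))) =
        m b (p j) + r * (m b (p (σ j)) - m b (p j)) := fun r => by ring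
    rw [e1, e1] at hb
    rw [hab, hratio, hratio]
    simp only [hFdef]
    linarith

theorem IsFacetSystem.le_hausdorffMeasure_sphere (h : IsFacetSystem Ω p σ m)
    (hd : IsHilbertDist Ω d) (hφ : Set.BijOn φ Set.univ Ω)
    (hdist : ∀ x y : X, dist x y = d (φ x) (φ y)) {o : X} (ho : ∀ k, m k (φ o) = 1) {B : ℝ}
    (hB1 : 1 ≤ B) (hB : ∀ k j, m k (p j) ≤ B) (hBinv : ∀ k j, (m k (p j))⁻¹ ≤ B) {K : ℝ}
    (hK : 0 < K) :
    n * ENNReal.ofReal (Real.log K - 2 * Real.log B) ≤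
      μH[(1 : ℝ)] (Metric.sphere o (1 / 2 * Real.log (1 + K))) := by
  obtain ⟨γ, M, hγ, hsphere⟩ := h.exists_sphere_param hd hφ hdist ho hK
  have hB0 : 0 < B := by linarith
  have hpos : ∀ x k, 0 < m k (φ x) := fun x => (h.mem_iff _).mp (hφ.mapsTo (Set.mem_univ x))
  obtain ⟨G, hG⟩ : ∃ G : Fin n → Fin n → X → ℝ,
      ∀ k l x, G k l x = 1 / 2 * (Real.log (m k (φ x)) - Real.log (m l (φ x))) :=
    ⟨_, fun _ _ _ => rfl⟩
  have hGlip : ∀ k l, LipschitzWith 1 (G k l) := by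
    intro k l
    apply LipschitzWith.of_le_add
    intro x y
    have := h.half_log_sub_log_le_dist hd hφ hdist y x k l
    rw [Real.log_div (hpos x k).ne' (hpos y k).ne', Real.log_div (hpos x l).ne' (hpos y l).ne',
      dist_comm] at this
    rw [hG, hG]
    linarith
  have hGpos : ∀ k l x, 0 < G k l x ↔ m l (φ x) < m k (φ x) := by
    intro k l x
    rw [hG, ← Real.log_lt_log_iff (hpos x l) (hpos x k)]
    constructor <;> intro <;> linarith
  set S := Metric.sphere o (1 / 2 * Real.log (1 + K))
  set T : Fin n → Set X := fun j => S ∩ ⋂ l, ⋂ (_ : l ≠ j), {x | 0 < G l j x}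
  have hTmeas : ∀ j, MeasurableSet (T j) := fun j =>
    Metric.isClosed_sphere.measurableSet.inter <| MeasurableSet.iInter fun l =>
      MeasurableSet.iInter fun _ =>
        (isOpen_lt continuous_const (hGlip l j).continuous).measurableSet
  have hTdisj : Pairwise (Function.onFun Disjoint T) := by
    intro i j hij
    refine Set.disjoint_left.mpr fun x hxi hxj => ?_
    have h1 := Set.mem_iInter₂.mp hxi.2 j hij.symm
    have h2 := Set.mem_iInter₂.mp hxj.2 i hij
    exact lt_asymm ((hGpos _ _ _).mp h1) ((hGpos _ _ _).mp h2)
  suffices hedge : ∀ j, ENNReal.ofReal (Real.log K - 2 * Real.log B) ≤ μH[(1 : ℝ)] (T j) by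
    calc n * ENNReal.ofReal (Real.log K - 2 * Real.log B)
        = ∑ _j : Fin n, ENNReal.ofReal (Real.log K - 2 * Real.log B) := by simp
      _ ≤ ∑ j, μH[(1 : ℝ)] (T j) := Finset.sum_le_sum fun j _ => hedge j
      _ = μH[(1 : ℝ)] (⋃ j, T j) := by rw [measure_iUnion hTdisj hTmeas, tsum_fintype]
      _ ≤ μH[(1 : ℝ)] S := measure_mono (Set.iUnion_subset fun j => Set.inter_subset_left)
  intro j
  obtain ⟨k, rfl⟩ : ∃ k, j = σ k := ⟨σ.symm j, (σ.apply_symm_apply j).symm⟩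
  have hMlip : ∀ {s t}, s ∈ Set.Icc (0 : ℝ) 1 → t ∈ Set.Icc (0 : ℝ) 1 →
      M (σ k) s ≤ M (σ k) t + B * |s - t| :=
    h.max_le_add hB (fun s hs => (hγ _ s hs).2.1) (fun s hs => (hγ _ s hs).2.2.1)
  have hMcont : ContinuousOn (M (σ k)) (Set.Icc 0 1) := by
    refine LipschitzOnWith.continuousOn (K := B.toNNReal) (LipschitzOnWith.of_le_add_mul _ ?_)
    intro s hs t ht
    rw [Real.coe_toNNReal B hB0.le, Real.dist_eq]
    exact hMlip hs ht
  have hMB : ∀ s ∈ Set.Icc (0 : ℝ) 1, M (σ k) s ≤ B := by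
    intro s hs
    obtain ⟨-, -, ⟨l, hl⟩, -⟩ := hγ (σ k) s hs
    rw [← hl]
    nlinarith [mul_nonneg hs.1 (sub_nonneg.mpr (hB l (σ (σ k)))),
      mul_nonneg (sub_nonneg.mpr hs.2) (sub_nonneg.mpr (hB l (σ k)))]
  have hβ : 0 < m k (p (σ (σ k))) := h.vertex_pos _ _ (h.succ_succ_ne k) (h.succ_ne (σ k))
  have hα : 0 < m (σ (σ k)) (p (σ k)) :=
    h.vertex_pos _ _ (h.succ_ne (σ k)).symm (h.succ_succ_ne (σ k)).symm
  have hval : ∀ s ∈ Set.Icc (0 : ℝ) 1, G k (σ (σ k)) (γ (σ k) s) =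
      1 / 2 * (Real.log (M (σ k) s + K * (s * m k (p (σ (σ k))))) -
        Real.log (M (σ k) s + K * ((1 - s) * m (σ (σ k)) (p (σ k))))) := by
    intro s hs
    obtain ⟨h1, -, -, h4⟩ := hγ (σ k) s hs
    have hs0 := hs.1
    have hs1 : 0 ≤ 1 - s := sub_nonneg.mpr hs.2
    have e : m (σ (σ k)) (p (σ k)) + s * (0 - m (σ (σ k)) (p (σ k))) =
        (1 - s) * m (σ (σ k)) (p (σ k)) := by ring
    rw [hG, h4, h4, h.vertex_succ k, h.vertex_self (σ (σ k)), zero_add, sub_zero, e,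
      Real.log_div (by positivity) (by positivity), Real.log_div (by positivity) (by positivity)]
    ring
  have hcont : ContinuousOn (fun s => G k (σ (σ k)) (γ (σ k) s)) (Set.Icc 0 1) := by
    refine ContinuousOn.congr ?_ hval
    refine continuousOn_const.mul (ContinuousOn.sub ?_ ?_)
    · refine ContinuousOn.log (hMcont.add (by fun_prop)) fun s hs => ?_
      have := (hγ (σ k) s hs).1
      have := hs.1
      positivity
    · refine ContinuousOn.log (hMcont.add (by fun_prop)) fun s hs => ?_
      have := (hγ (σ k) s hs).1
      have : 0 ≤ 1 - s := sub_nonneg.mpr hs.2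
      positivity
  have hmemT : ∀ s ∈ Set.Ioo (0 : ℝ) 1, γ (σ k) s ∈ T (σ k) := by
    intro s hs
    have hs' := Set.Ioo_subset_Icc_self hs
    refine ⟨?_, Set.mem_iInter₂.mpr fun l hl => (hGpos _ _ _).mpr ?_⟩
    · rw [hsphere]
      exact Set.mem_iUnion.mpr ⟨_, s, hs', rfl⟩
    · obtain ⟨h1, -, -, h4⟩ := hγ (σ k) s hs'
      have hl0 : 0 < m l (p (σ k)) + s * (m l (p (σ (σ k))) - m l (p (σ k))) := by
        by_cases hlk : l = k
        · rw [hlk, h.vertex_succ]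
          have := hs.1
          simp only [sub_zero, zero_add]
          positivity
        · have h5 := h.vertex_pos l (σ k) hl.symm fun h6 => hlk (σ.injective h6).symm
          nlinarith [mul_nonneg hs.1.le (h.vertex_nonneg l (σ (σ k))),
            mul_pos (sub_pos.mpr hs.2) h5]
      have hKM : 0 < K + M (σ k) s := by linarith
      rw [h4, h4, h.vertex_self, h.vertex_succ]
      rw [div_lt_div_iff_of_pos_right hKM]
      linarith [mul_pos hK hl0]
  have h01 : (0 : ℝ) ∈ Set.Icc (0 : ℝ) 1 := by simp
  have h11 : (1 : ℝ) ∈ Set.Icc (0 : ℝ) 1 := by simp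
  have hends : Real.log K - 2 * Real.log B ≤
      G k (σ (σ k)) (γ (σ k) 1) - G k (σ (σ k)) (γ (σ k) 0) := by
    have hbound : ∀ {N b : ℝ}, 1 ≤ N → N ≤ B → 0 < b → b⁻¹ ≤ B →
        Real.log K - 2 * Real.log B ≤ Real.log (N + K * b) - Real.log N := by
      intro N b hN hNB hb hbB
      have l1 : Real.log N ≤ Real.log B := Real.log_le_log (by linarith) hNB
      have l2 : Real.log (K * b) ≤ Real.log (N + K * b) :=
        Real.log_le_log (by positivity) (by linarith)
      have l3 : Real.log b⁻¹ ≤ Real.log B := Real.log_le_log (by positivity) hbB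
      rw [Real.log_mul hK.ne' hb.ne'] at l2
      rw [Real.log_inv] at l3
      linarith
    have b0 := hbound (hγ _ 0 h01).1 (hMB 0 h01) hα (hBinv _ _)
    have b1 := hbound (hγ _ 1 h11).1 (hMB 1 h11) hβ (hBinv _ _)
    rw [hval 0 h01, hval 1 h11]
    simp only [sub_zero, sub_self, one_mul, zero_mul, mul_zero, add_zero]
    linarith
  calc ENNReal.ofReal (Real.log K - 2 * Real.log B)
      ≤ ENNReal.ofReal (G k (σ (σ k)) (γ (σ k) 1) - G k (σ (σ k)) (γ (σ k) 0)) :=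
        ENNReal.ofReal_le_ofReal hends
    _ = volume (Set.Ioo (G k (σ (σ k)) (γ (σ k) 0)) (G k (σ (σ k)) (γ (σ k) 1))) :=
        Real.volume_Ioo.symm
    _ ≤ volume (G k (σ (σ k)) '' T (σ k)) := by
        refine measure_mono ((intermediate_value_Ioo zero_le_one hcont).trans ?_)
        rintro _ ⟨s, hs, rfl⟩
        exact ⟨_, hmemT s hs, rfl⟩
    _ = μH[(1 : ℝ)] (G k (σ (σ k)) '' T (σ k)) := by rw [hausdorffMeasure_real]
    _ ≤ μH[(1 : ℝ)] (T (σ k)) := by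
        simpa using (hGlip k (σ (σ k))).hausdorffMeasure_image_le zero_le_one (T (σ k))

end Length

theorem tendsto_div_of_linear_bounds {f : ℝ → ENNReal} {n : ℕ} (hn : 0 < n) {a b : ℝ}
    (hlower : ∀ᶠ R in atTop, (n : ENNReal) * ENNReal.ofReal (2 * R - a) ≤ f R)
    (hupper : ∀ᶠ R in atTop, f R ≤ (n : ENNReal) * ENNReal.ofReal (2 * R + b)) :
    Tendsto (fun R => f R / ENNReal.ofReal (2 * n * R)) atTop (nhds 1) := by
  have hlim : ∀ c : ℝ, Tendsto (fun R : ℝ => ENNReal.ofReal (1 + c / 2 * R⁻¹)) atTop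
      (nhds 1) := by
    intro c
    have h := (tendsto_const_nhds (x := (1 : ℝ))).add
      (tendsto_inv_atTop_zero.const_mul (c / 2))
    simpa using ENNReal.tendsto_ofReal h
  have hquot : ∀ c R : ℝ, 0 < R → (n : ENNReal) * ENNReal.ofReal (2 * R + c) /
      ENNReal.ofReal (2 * n * R) = ENNReal.ofReal (1 + c / 2 * R⁻¹) := by
    intro c R hR
    have hn' : (0 : ℝ) < n := Nat.cast_pos.mpr hn
    rw [← ENNReal.ofReal_natCast, ← ENNReal.ofReal_mul hn'.le,
      ← ENNReal.ofReal_div_of_pos (by positivity)]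
    congr 1
    field_simp
  refine tendsto_of_tendsto_of_tendsto_of_le_of_le' (hlim (-a)) (hlim b) ?_ ?_
  · filter_upwards [hlower, eventually_gt_atTop 0] with R h1 h2
    rw [← hquot _ _ h2, ← sub_eq_add_neg]
    gcongr
  · filter_upwards [hupper, eventually_gt_atTop 0] with R h1 h2
    rw [← hquot _ _ h2]
    gcongr

/-- In the Hilbert geometry of a convex polygon `P ⊆ ℝ²` with exactly `n` vertices (realized
as an abstract metric space `X` identified with `(int P, d_P)` via `φ`), the length
(one-dimensional Hausdorff measure with respect to `d_P`) of the metric sphere of radius `R`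
centered at a fixed point `o` satisfies `L(R)/(2nR) → 1` as `R → ∞`. -/
theorem polygon_sphere_length_asymptotics {n : ℕ} (hn : 3 ≤ n)
    (p : Fin n → Euc 2) (hinj : Function.Injective p)
    (P : Set (Euc 2)) (hP : P = convexHull ℝ (Set.range p))
    (hvert : Set.extremePoints ℝ P = Set.range p)
    (hint : (interior P).Nonempty)
    (d : Euc 2 → Euc 2 → ℝ) (hd : IsHilbertDist (interior P) d)
    (X : Type) [MetricSpace X] [MeasurableSpace X] [BorelSpace X]
    (φ : X → Euc 2) (hφ : Set.BijOn φ Set.univ (interior P))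
    (hdist : ∀ x y : X, dist x y = d (φ x) (φ y))
    (o : X) :
    Filter.Tendsto
      (fun R : ℝ => μH[(1 : ℝ)] (Metric.sphere o R) / ENNReal.ofReal (2 * n * R))
      Filter.atTop (nhds 1) := by
  have ho : φ o ∈ interior P := hφ.mapsTo (Set.mem_univ o)
  subst hP
  obtain ⟨σ, m, h, hmo⟩ := exists_isFacetSystem hn p hinj hvert ho
  obtain ⟨B₁, hB₁⟩ := (Set.finite_range fun q : Fin n × Fin n => m q.1 (p q.2)).bddAbove
  obtain ⟨B₂, hB₂⟩ := (Set.finite_range fun q : Fin n × Fin n => (m q.1 (p q.2))⁻¹).bddAbove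
  obtain ⟨B, hB1, hBB₁, hBB₂⟩ : ∃ B, 1 ≤ B ∧ B₁ ≤ B ∧ B₂ ≤ B :=
    ⟨max 1 (max B₁ B₂), by simp, by simp, by simp⟩
  have hB : ∀ k j, m k (p j) ≤ B := fun k j => (hB₁ ⟨(k, j), rfl⟩).trans hBB₁
  have hBinv : ∀ k j, (m k (p j))⁻¹ ≤ B := fun k j => (hB₂ ⟨(k, j), rfl⟩).trans hBB₂
  have hB0 : 0 < B := by linarith
  have hradius : ∀ R : ℝ, 1 / 2 * Real.log (1 + (Real.exp (2 * R) - 1)) = R := by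
    intro R
    rw [add_sub_cancel, Real.log_exp]; ring
  have hexp : ∀ R : ℝ, 1 ≤ R → 2 ≤ Real.exp (2 * R) := by
    intro R hR
    linarith [Real.add_one_le_exp (2 * R)]
  refine tendsto_div_of_linear_bounds (a := Real.log 2 + 2 * Real.log B) (b := B + Real.log B)
    (by omega) ?_ ?_
  · filter_upwards [eventually_ge_atTop 1] with R hR
    have hE := hexp R hR
    have hlow := h.le_hausdorffMeasure_sphere hd hφ hdist hmo hB1 hB hBinv
      (K := Real.exp (2 * R) - 1) (by linarith)
    rw [hradius] at hlow
    refine le_trans ?_ hlow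
    refine mul_le_mul' le_rfl (ENNReal.ofReal_le_ofReal ?_)
    have hlog := Real.log_le_log (show 0 < Real.exp (2 * R) / 2 by linarith)
      (show Real.exp (2 * R) / 2 ≤ Real.exp (2 * R) - 1 by linarith)
    rw [Real.log_div (Real.exp_pos _).ne' two_ne_zero, Real.log_exp] at hlog
    linarith
  · filter_upwards [eventually_ge_atTop 1] with R hR
    have hE := hexp R hR
    have hup := h.hausdorffMeasure_sphere_le hd hφ hdist hmo hB1 hB
      (K := Real.exp (2 * R) - 1) (by linarith)
    rw [hradius] at hup
    refine hup.trans ?_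
    refine mul_le_mul' le_rfl (ENNReal.ofReal_le_ofReal ?_)
    have hpos : 0 < 1 + (Real.exp (2 * R) - 1) * B := by nlinarith
    have hlog := Real.log_le_log hpos
      (show 1 + (Real.exp (2 * R) - 1) * B ≤ Real.exp (2 * R) * B by linarith)
    rw [Real.log_mul (Real.exp_pos _).ne' hB0.ne', Real.log_exp] at hlog
    linarith
end
end
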